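/- For every finite simple graph G, the following are equivalent: (1) G has strongly chordal treewidth at most two; (2) every block of G is either a 2-connected graph whose cell completion is a tree of two-boundaried cycles, or a single edge, or an isolated vertex; (3) G has no minor isomorphic to K_4 or to S_3. -/

import Mathlib

open SimpleGraph

/-- The cycle graph on `ZMod n` (for `3 ≤ n` this is a cycle of length `n`). -/
def cycGraph (n : ℕ) : SimpleGraph (ZMod n) :=
  SimpleGraph.fromRel (fun x y => x = y + 1)

/-- The set `s` of nodes induces a path in the graph `H`. -/
def IsPathSet {ι : Type} (H : SimpleGraph ι) (s : Set ι) : Prop :=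
  (H.induce s).Connected ∧ ∀ x ∈ s, {y | y ∈ s ∧ H.Adj x y}.ncard ≤ 2

/-- The set `s` of nodes induces a directed path in `H` with respect to the
orientation `o` of the edges of `H`. -/
def IsDirPathSet {ι : Type} (H : SimpleGraph ι) (o : ι → ι → Prop) (s : Set ι) : Prop :=
  IsPathSet H s ∧ (∀ x ∈ s, {y | y ∈ s ∧ o x y}.ncard ≤ 1) ∧
    (∀ x ∈ s, {y | y ∈ s ∧ o y x}.ncard ≤ 1)

/-- A tree decomposition of a finite simple graph `G`. -/
structure TreeDecomp {V : Type} (G : SimpleGraph V) where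
  ι : Type
  finι : Finite ι
  tree : SimpleGraph ι
  isTree : tree.IsTree
  bag : ι → Set V
  bag_cover : ∀ v : V, ∃ x, v ∈ bag x
  bag_edge : ∀ ⦃u v : V⦄, G.Adj u v → ∃ x, u ∈ bag x ∧ v ∈ bag x
  bag_conn : ∀ v : V, (tree.induce {x | v ∈ bag x}).Connected

/-- A spaghetti tree decomposition: for every vertex `v` of `G`, the nodes whose
bags contain `v` induce a path in the tree. -/
structure SpaghettiTD {V : Type} (G : SimpleGraph V) extends TreeDecomp G where
  bag_path : ∀ v : V, IsPathSet tree {x | v ∈ bag x}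

/-- A directed spaghetti tree decomposition: the tree edges are oriented, and for
every vertex `v` of `G` the nodes whose bags contain `v` induce a directed path. -/
structure DirSpaghettiTD {V : Type} (G : SimpleGraph V) extends TreeDecomp G where
  orient : ι → ι → Prop
  orient_iff : ∀ x y : ι, tree.Adj x y ↔ (orient x y ∨ orient y x)
  orient_asymm : ∀ x y : ι, orient x y → ¬ orient y x
  bag_dirpath : ∀ v : V, IsDirPathSet tree orient {x | v ∈ bag x}

/-- A special tree decomposition: the tree is rooted, and for every vertex `v` of
`G` the nodes whose bags contain `v` induce a vertical path, i.e. a directed path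
with respect to the orientation of every tree edge towards the root. -/
structure SpecialTD {V : Type} (G : SimpleGraph V) extends TreeDecomp G where
  root : ι
  bag_vertical : ∀ v : V,
    IsDirPathSet tree (fun x y => tree.Adj x y ∧ tree.dist y root < tree.dist x root)
      {x | v ∈ bag x}

/-- A path decomposition of a finite simple graph `G`. -/
structure PathDecomp {V : Type} (G : SimpleGraph V) where
  m : ℕ
  hm : 0 < m
  bag : Fin m → Set V
  bag_cover : ∀ v : V, ∃ i, v ∈ bag i
  bag_edge : ∀ ⦃u v : V⦄, G.Adj u v → ∃ i, u ∈ bag i ∧ v ∈ bag i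
  bag_convex : ∀ (v : V) (i j k : Fin m), i ≤ j → j ≤ k → v ∈ bag i → v ∈ bag k → v ∈ bag j

/-- Treewidth: minimal width of a tree decomposition. -/
noncomputable def treewidth {V : Type} (G : SimpleGraph V) : ℕ :=
  sInf {k | ∃ td : TreeDecomp G, ∀ x, (td.bag x).ncard ≤ k + 1}

/-- Spaghetti treewidth: minimal width of a spaghetti tree decomposition. -/
noncomputable def sptw {V : Type} (G : SimpleGraph V) : ℕ :=
  sInf {k | ∃ td : SpaghettiTD G, ∀ x, (td.bag x).ncard ≤ k + 1}

/-- Directed spaghetti treewidth: minimal width of a directed spaghetti tree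
decomposition. -/
noncomputable def dptw {V : Type} (G : SimpleGraph V) : ℕ :=
  sInf {k | ∃ td : DirSpaghettiTD G, ∀ x, (td.bag x).ncard ≤ k + 1}

/-- Special treewidth: minimal width of a special tree decomposition. -/
noncomputable def spctw {V : Type} (G : SimpleGraph V) : ℕ :=
  sInf {k | ∃ td : SpecialTD G, ∀ x, (td.bag x).ncard ≤ k + 1}

/-- Pathwidth: minimal width of a path decomposition. -/
noncomputable def pw {V : Type} (G : SimpleGraph V) : ℕ :=
  sInf {k | ∃ pd : PathDecomp G, ∀ i, (pd.bag i).ncard ≤ k + 1}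

/-- A graph is chordal iff it has no induced (i.e. chordless) cycle of length at
least four. -/
def IsChordal {V : Type} (G : SimpleGraph V) : Prop :=
  ∀ (S : Set V) (n : ℕ), 4 ≤ n → ¬ Nonempty ((G.induce S) ≃g cycGraph n)

/-- A graph is strongly chordal if it is chordal and every even cycle of length at
least six has an odd chord: a chord splitting the cycle into two odd paths of
length at least three. -/
def IsStronglyChordal {V : Type} (G : SimpleGraph V) : Prop :=
  IsChordal G ∧ ∀ n : ℕ, 6 ≤ n → Even n → ∀ f : ZMod n → V,
    Function.Injective f → (∀ i : ZMod n, G.Adj (f i) (f (i + 1))) →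
      ∃ (i : ZMod n) (d : ℕ), Odd d ∧ 3 ≤ d ∧ d + 3 ≤ n ∧ G.Adj (f i) (f (i + (d : ZMod n)))

/-- Strongly chordal treewidth: the minimum of `ω(H) - 1` over all strongly chordal
supergraphs `H` of `G` (on the same vertex set; here `ω(H) ≤ k + 1` is expressed as
`H.CliqueFree (k + 2)`). -/
noncomputable def sctw {V : Type} (G : SimpleGraph V) : ℕ :=
  sInf {k | ∃ H : SimpleGraph V, G ≤ H ∧ IsStronglyChordal H ∧ H.CliqueFree (k + 2)}

/-- `H` is a minor of `G`: there is a family of nonempty, pairwise disjoint,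
connected branch sets in `G`, one for each vertex of `H`, such that every edge of
`H` is realized by an edge of `G` between the corresponding branch sets. -/
def IsMinorOf {W V : Type} (H : SimpleGraph W) (G : SimpleGraph V) : Prop :=
  ∃ f : W → Set V,
    (∀ w, (f w).Nonempty) ∧ (∀ w, (G.induce (f w)).Connected) ∧
    (Pairwise fun w w' => Disjoint (f w) (f w')) ∧
    ∀ ⦃w w'⦄, H.Adj w w' → ∃ u ∈ f w, ∃ v ∈ f w', G.Adj u v

/-- The complete graph on four vertices. -/
def K4 : SimpleGraph (Fin 4) := ⊤

/-- `D₃`: two vertices (`0` and `1`) joined by three internally vertex-disjoint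
paths of length three. -/
def D3 : SimpleGraph (Fin 8) := SimpleGraph.fromRel (fun x y =>
  (x = 0 ∧ y = 2) ∨ (x = 2 ∧ y = 3) ∨ (x = 3 ∧ y = 1) ∨
  (x = 0 ∧ y = 4) ∨ (x = 4 ∧ y = 5) ∨ (x = 5 ∧ y = 1) ∨
  (x = 0 ∧ y = 6) ∨ (x = 6 ∧ y = 7) ∨ (x = 7 ∧ y = 1))

/-- `S₃` (the 3-sun): a 6-cycle `0 1 2 3 4 5` together with the triangle `1 3 5`. -/
def S3 : SimpleGraph (Fin 6) := SimpleGraph.fromRel (fun x y =>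
  (x = 0 ∧ y = 1) ∨ (x = 1 ∧ y = 2) ∨ (x = 2 ∧ y = 3) ∨ (x = 3 ∧ y = 4) ∨
  (x = 4 ∧ y = 5) ∨ (x = 5 ∧ y = 0) ∨ (x = 1 ∧ y = 3) ∨ (x = 3 ∧ y = 5) ∨ (x = 5 ∧ y = 1))

/-- A graph is 2-connected if it has at least three vertices and deleting any one
vertex leaves it connected. -/
def TwoConnected {V : Type} (G : SimpleGraph V) : Prop :=
  3 ≤ Nat.card V ∧ ∀ v : V, (G.induce {x | x ≠ v}).Connected

/-- The cell completion of `G`: add an edge `vw` for every pair of (nonadjacent)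
vertices `v, w` such that deleting `v` and `w` leaves at least three connected
components. -/
def cellCompletion {V : Type} (G : SimpleGraph V) : SimpleGraph V :=
  SimpleGraph.fromRel (fun v w => G.Adj v w ∨
    3 ≤ Nat.card ((G.induce {x | x ≠ v ∧ x ≠ w}).ConnectedComponent))

/-- The induced subgraph of `G` on `S` has no cut vertex. -/
def NoCutVertex {V : Type} (G : SimpleGraph V) (S : Set V) : Prop :=
  ∀ v ∈ S, (S \ {v}).Nonempty → (G.induce (S \ {v})).Connected

/-- `S` carries a block of `G`: a maximal connected (induced) subgraph without a
cut vertex. -/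
def IsBlock {V : Type} (G : SimpleGraph V) (S : Set V) : Prop :=
  S.Nonempty ∧ (G.induce S).Connected ∧ NoCutVertex G S ∧
    ∀ S' : Set V, S ⊆ S' → (G.induce S').Connected → NoCutVertex G S' → S' = S

/-- Glue a cycle of length `n` onto the graph `G` by identifying the cycle edge
`{0, 1}` (with its end vertices) with the edge `{a, b}` of `G`. -/
def glueCycle {V : Type} (G : SimpleGraph V) (n : ℕ) (a b : V) :
    SimpleGraph (V ⊕ {x : ZMod n // x ≠ 0 ∧ x ≠ 1}) :=
  SimpleGraph.fromRel (fun p q =>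
    match p, q with
    | Sum.inl u, Sum.inl v => G.Adj u v
    | Sum.inl u, Sum.inr x => (u = a ∧ (cycGraph n).Adj 0 x.1) ∨ (u = b ∧ (cycGraph n).Adj 1 x.1)
    | Sum.inr x, Sum.inr y => (cycGraph n).Adj x.1 y.1
    | Sum.inr _, Sum.inl _ => False)

/-- The class of trees of cycles: every cycle is a tree of cycles, and gluing a
cycle onto a tree of cycles along an edge yields a tree of cycles (up to
isomorphism). -/
inductive IsTreeOfCycles : {V : Type} → SimpleGraph V → Prop
  | cycle {V : Type} (G : SimpleGraph V) (n : ℕ) (hn : 3 ≤ n)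
      (e : Nonempty (G ≃g cycGraph n)) : IsTreeOfCycles G
  | glue {V W : Type} (G : SimpleGraph V) (hG : IsTreeOfCycles G)
      (n : ℕ) (hn : 3 ≤ n) (a b : V) (hab : G.Adj a b)
      (H : SimpleGraph W) (e : Nonempty (H ≃g glueCycle G n a b)) : IsTreeOfCycles H

/-- `S` is the vertex set of a chordless cycle of `G`, i.e. it induces a cycle. -/
def IsChordlessCycle {V : Type} (G : SimpleGraph V) (S : Set V) : Prop :=
  ∃ n : ℕ, 3 ≤ n ∧ Nonempty ((G.induce S) ≃g cycGraph n)

/-- The edge `uv` is an edge separator: it lies in at least two distinct chordless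
cycles of `G`. -/
def IsEdgeSeparator {V : Type} (G : SimpleGraph V) (u v : V) : Prop :=
  G.Adj u v ∧ ∃ S₁ S₂ : Set V, S₁ ≠ S₂ ∧ IsChordlessCycle G S₁ ∧ IsChordlessCycle G S₂ ∧
    u ∈ S₁ ∧ v ∈ S₁ ∧ u ∈ S₂ ∧ v ∈ S₂

/-- `S` is a simplicial triangle of `G`: a chordless cycle on three vertices
containing a simplicial vertex of `G`. -/
def IsSimplicialTriangle {V : Type} (G : SimpleGraph V) (S : Set V) : Prop :=
  IsChordlessCycle G S ∧ S.ncard = 3 ∧ ∃ v ∈ S, G.IsClique (G.neighborSet v)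

/-- A chain tree of cycles: a tree of cycles in which every edge lies in at most two
chordless cycles that are not simplicial triangles (equivalently, if an edge lies in
`m ≥ 3` chordless cycles then at least `m - 2` of them are simplicial triangles). -/
def IsChainTreeOfCycles {V : Type} (G : SimpleGraph V) : Prop :=
  IsTreeOfCycles G ∧ ∀ u v : V, G.Adj u v →
    {S : Set V | IsChordlessCycle G S ∧ u ∈ S ∧ v ∈ S ∧ ¬ IsSimplicialTriangle G S}.ncard ≤ 2

/-- A tree of two-boundaried cycles: a tree of cycles in which every chordless
cycle contains at most two edge separators. -/
def IsTreeOfTwoBoundariedCycles {V : Type} (G : SimpleGraph V) : Prop :=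
  IsTreeOfCycles G ∧ ∀ S : Set V, IsChordlessCycle G S →
    {e : Sym2 V | ∃ u v : V, e = s(u, v) ∧ u ∈ S ∧ v ∈ S ∧ IsEdgeSeparator G u v}.ncard ≤ 2

/-- A path of cycles: a tree of cycles in which every chordless cycle contains at
most two edge separators and every edge lies in at most two chordless cycles that
are not simplicial triangles. -/
def IsPathOfCycles {V : Type} (G : SimpleGraph V) : Prop :=
  IsTreeOfCycles G ∧
    (∀ S : Set V, IsChordlessCycle G S →
      {e : Sym2 V | ∃ u v : V, e = s(u, v) ∧ u ∈ S ∧ v ∈ S ∧ IsEdgeSeparator G u v}.ncard ≤ 2) ∧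
    ∀ u v : V, G.Adj u v →
      {S : Set V | IsChordlessCycle G S ∧ u ∈ S ∧ v ∈ S ∧ ¬ IsSimplicialTriangle G S}.ncard ≤ 2

/-- The graph is a single edge. -/
def IsSingleEdgeGraph {V : Type} (G : SimpleGraph V) : Prop :=
  Nat.card V = 2 ∧ ∀ a b : V, a ≠ b → G.Adj a b

/-- A mamba: a 2-connected graph of pathwidth two, a single edge, or an isolated
vertex. -/
def IsMamba {V : Type} (G : SimpleGraph V) : Prop :=
  (TwoConnected G ∧ pw G = 2) ∨ IsSingleEdgeGraph G ∨ Nat.card V = 1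

/-- `v` is a head vertex of the mamba `G`: some path decomposition of `G` of width
at most two has `v` in its first bag. -/
def IsHeadVertex {V : Type} (G : SimpleGraph V) (v : V) : Prop :=
  ∃ pd : PathDecomp G, (∀ i, (pd.bag i).ncard ≤ 3) ∧ v ∈ pd.bag ⟨0, pd.hm⟩

/-- Glue the graph `M` onto the graph `G` by identifying the vertex `h` of `M` with
the vertex `x` of `G`. -/
def glueAtVertex {V W : Type} (G : SimpleGraph V) (x : V) (M : SimpleGraph W) (h : W) :
    SimpleGraph (V ⊕ {w : W // w ≠ h}) :=
  SimpleGraph.fromRel (fun p q =>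
    match p, q with
    | Sum.inl u, Sum.inl u' => G.Adj u u'
    | Sum.inl u, Sum.inr w => u = x ∧ M.Adj h w.1
    | Sum.inr w, Sum.inr w' => M.Adj w.1 w'.1
    | Sum.inr _, Sum.inl _ => False)

/-- The class of mamba trees: every mamba is a mamba tree, and gluing a mamba onto
a mamba tree by identifying a vertex of the mamba tree with a head vertex of the
mamba yields a mamba tree (up to isomorphism). -/
inductive IsMambaTree : {V : Type} → SimpleGraph V → Prop
  | mamba {V : Type} (G : SimpleGraph V) (hG : IsMamba G) : IsMambaTree G
  | glue {V W U : Type} (G : SimpleGraph V) (hG : IsMambaTree G)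
      (M : SimpleGraph W) (hM : IsMamba M) (x : V) (h : W) (hh : IsHeadVertex M h)
      (K : SimpleGraph U) (e : Nonempty (K ≃g glueAtVertex G x M h)) : IsMambaTree K

/-- Subdivide the edge `{a, b}` of `G` by a new vertex. -/
def subdivideEdge {V : Type} (G : SimpleGraph V) (a b : V) : SimpleGraph (V ⊕ Unit) :=
  SimpleGraph.fromRel (fun p q =>
    match p, q with
    | Sum.inl u, Sum.inl v => G.Adj u v ∧ ¬(u = a ∧ v = b) ∧ ¬(u = b ∧ v = a)
    | Sum.inl u, Sum.inr _ => u = a ∨ u = b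
    | Sum.inr _, _ => False)

/-- `H` is a subdivision of `G`: `H` is obtained from (an isomorphic copy of) `G`
by repeatedly subdividing edges. -/
inductive IsSubdivisionOf : {W V : Type} → SimpleGraph W → SimpleGraph V → Prop
  | base {V W : Type} {G : SimpleGraph V} {H : SimpleGraph W}
      (e : Nonempty (H ≃g G)) : IsSubdivisionOf H G
  | step {V W U : Type} {G : SimpleGraph V} {H : SimpleGraph W} (a b : W) (hab : H.Adj a b)
      (h : IsSubdivisionOf H G) {K : SimpleGraph U}
      (e : Nonempty (K ≃g subdivideEdge H a b)) : IsSubdivisionOf K G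

/-- Contract the edge `{a, b}` of `G` (the contracted vertex is `a`, `b` is removed). -/
def contractEdge {V : Type} (G : SimpleGraph V) (a b : V) : SimpleGraph {x : V // x ≠ b} :=
  SimpleGraph.fromRel (fun x y =>
    G.Adj x.1 y.1 ∨ (x.1 = a ∧ G.Adj b y.1) ∨ (y.1 = a ∧ G.Adj b x.1))

/-- `s` is nonempty and connected in `G`, phrased through subsets closed under adjacency. -/
def ConnSet {V : Type} (G : SimpleGraph V) (s : Set V) : Prop :=
  s.Nonempty ∧ ∀ t : Set V, (∃ x ∈ s, x ∈ t) →
    (∀ u ∈ s, u ∈ t → ∀ v ∈ s, G.Adj u v → v ∈ t) → s ⊆ t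

/-- Some edge of `G` joins `s` and `t`. -/
def Touch {V : Type} (G : SimpleGraph V) (s t : Set V) : Prop :=
  ∃ a ∈ s, ∃ b ∈ t, G.Adj a b

section ConnSet

variable {V : Type} {G : SimpleGraph V}

theorem Touch.symm {s t : Set V} (h : Touch G s t) : Touch G t s := by
  obtain ⟨a, ha, b, hb, hab⟩ := h
  exact ⟨b, hb, a, ha, hab.symm⟩

theorem Touch.mono {s t s' t' : Set V} (h : Touch G s t) (hs : s ⊆ s') (ht : t ⊆ t') :
    Touch G s' t' := by
  obtain ⟨a, ha, b, hb, hab⟩ := h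
  exact ⟨a, hs ha, b, ht hb, hab⟩

theorem ConnSet.nonempty {s : Set V} (h : ConnSet G s) : s.Nonempty := h.1

theorem ConnSet.mono {H : SimpleGraph V} (hGH : G ≤ H) {s : Set V} (h : ConnSet G s) :
    ConnSet H s :=
  ⟨h.1, fun t ht hc => h.2 t ht fun u hu hut v hv huv => hc u hu hut v hv (hGH huv)⟩

theorem connSet_congr {H : SimpleGraph V} {s : Set V}
    (hGH : ∀ u ∈ s, ∀ v ∈ s, G.Adj u v → H.Adj u v) (h : ConnSet G s) : ConnSet H s :=
  ⟨h.1, fun t ht hc => h.2 t ht fun u hu hut v hv huv => hc u hu hut v hv (hGH u hu v hv huv)⟩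

theorem connSet_singleton (x : V) : ConnSet G {x} := by
  refine ⟨⟨x, rfl⟩, fun t ht _ => ?_⟩
  grind

theorem connSet_iff {s : Set V} : (G.induce s).Connected ↔ ConnSet G s := by
  constructor
  · intro h
    obtain ⟨x0⟩ := h.nonempty
    refine ⟨⟨x0.1, x0.2⟩, ?_⟩
    rintro t ⟨x, hx, hxt⟩ hc y hy
    have hr : (G.induce s).Reachable ⟨x, hx⟩ ⟨y, hy⟩ := h.preconnected _ _
    rw [SimpleGraph.reachable_iff_reflTransGen] at hr
    have : ∀ z : s, Relation.ReflTransGen (G.induce s).Adj ⟨x, hx⟩ z → z.1 ∈ t := by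
      intro z hz
      induction hz with
      | refl => exact hxt
      | tail _ hbc ih => exact hc _ (Subtype.prop _) ih _ (Subtype.prop _) hbc
    exact this _ hr
  · rintro ⟨⟨x, hx⟩, h⟩
    have key : ∀ a : s, ∀ b : s, (G.induce s).Reachable a b := by
      intro a b
      have := h {z | ∃ hz : z ∈ s, (G.induce s).Reachable a ⟨z, hz⟩}
        ⟨a.1, a.2, a.2, SimpleGraph.Reachable.refl _⟩ (by
          rintro u hu ⟨_, hau⟩ v hv huv
          refine ⟨hv, hau.trans (SimpleGraph.Adj.reachable ?_)⟩
          exact huv)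
      obtain ⟨_, hb⟩ := this b.2
      exact hb
    have : Nonempty s := ⟨⟨x, hx⟩⟩
    exact ⟨key⟩

theorem ConnSet.union_touch {s t : Set V} (hs : ConnSet G s) (ht : ConnSet G t)
    (h : Touch G s t) : ConnSet G (s ∪ t) := by
  obtain ⟨a, ha, b, hb, hab⟩ := h
  refine ⟨⟨a, Or.inl ha⟩, fun r hr hc => ?_⟩
  have h1 : (∃ x ∈ s, x ∈ r) → s ⊆ r := fun hx => hs.2 r hx fun u hu hur v hv huv =>
    hc u (Or.inl hu) hur v (Or.inl hv) huv
  have h2 : (∃ x ∈ t, x ∈ r) → t ⊆ r := fun hx => ht.2 r hx fun u hu hur v hv huv =>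
    hc u (Or.inr hu) hur v (Or.inr hv) huv
  have h3 := hc a (Or.inl ha)
  have h4 := hc b (Or.inr hb)
  have := hab.symm
  obtain ⟨x, hx | hx, hxr⟩ := hr
  · have hs' := h1 ⟨x, hx, hxr⟩
    exact Set.union_subset hs' (h2 ⟨b, hb, h3 (hs' ha) b (Or.inr hb) hab⟩)
  · have ht' := h2 ⟨x, hx, hxr⟩
    exact Set.union_subset (h1 ⟨a, ha, h4 (ht' hb) a (Or.inl ha) this⟩) ht'

theorem ConnSet.union_inter {s t : Set V} (hs : ConnSet G s) (ht : ConnSet G t)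
    (h : (s ∩ t).Nonempty) : ConnSet G (s ∪ t) := by
  obtain ⟨a, ha, hb⟩ := h
  refine ⟨⟨a, Or.inl ha⟩, fun r hr hc => ?_⟩
  have h1 : (∃ x ∈ s, x ∈ r) → s ⊆ r := fun hx => hs.2 r hx fun u hu hur v hv huv =>
    hc u (Or.inl hu) hur v (Or.inl hv) huv
  have h2 : (∃ x ∈ t, x ∈ r) → t ⊆ r := fun hx => ht.2 r hx fun u hu hur v hv huv =>
    hc u (Or.inr hu) hur v (Or.inr hv) huv
  obtain ⟨x, hx | hx, hxr⟩ := hr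
  · have hs' := h1 ⟨x, hx, hxr⟩
    exact Set.union_subset hs' (h2 ⟨a, hb, hs' ha⟩)
  · have ht' := h2 ⟨x, hx, hxr⟩
    exact Set.union_subset (h1 ⟨a, ha, ht' hb⟩) ht'

theorem ConnSet.insert {s : Set V} (hs : ConnSet G s) {u v : V} (hu : u ∈ s)
    (h : G.Adj u v) : ConnSet G (insert v s) := by
  rw [Set.insert_eq, Set.union_comm]
  exact hs.union_touch (connSet_singleton v) ⟨u, hu, v, rfl, h⟩

theorem exists_component {s : Set V} {x : V} (hx : x ∈ s) :
    ∃ C ⊆ s, x ∈ C ∧ ConnSet G C ∧ ∀ u ∈ C, ∀ v ∈ s, G.Adj u v → v ∈ C := by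
  let C : Set V := {y | y ∈ s ∧ ∀ t : Set V, x ∈ t →
    (∀ u ∈ s, u ∈ t → ∀ v ∈ s, G.Adj u v → v ∈ t) → y ∈ t}
  have hcl : ∀ u ∈ C, ∀ v ∈ s, G.Adj u v → v ∈ C := by
    rintro u ⟨hus, hu⟩ v hv huv
    exact ⟨hv, fun t hxt hc => hc u hus (hu t hxt hc) v hv huv⟩
  refine ⟨C, fun y hy => hy.1, ⟨hx, fun t ht _ => ht⟩, ⟨⟨x, hx, fun t ht _ => ht⟩, ?_⟩, hcl⟩
  rintro t ⟨y, hyC, hyt⟩ hc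
  have hxt : x ∈ t := by
    by_contra hxt
    have := hyC.2 (C \ t) ⟨⟨hx, fun t ht _ => ht⟩, hxt⟩ (by
      rintro u hus ⟨huC, hut⟩ v hv huv
      have hvC := hcl u huC v hv huv
      exact ⟨hvC, fun hvt => hut (hc v hvC hvt u huC huv.symm)⟩)
    exact this.2 hyt
  intro z hz
  have := hz.2 (C ∩ t) ⟨⟨hx, fun t ht _ => ht⟩, hxt⟩ (by
    rintro u hus ⟨huC, hut⟩ v hv huv
    have hvC := hcl u huC v hv huv
    exact ⟨hvC, hc u huC hut v hvC huv⟩)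
  exact this.2

theorem ConnSet.exists_component_diff {D : Set V} (hD : ConnSet G D) {v p : V} (hv : v ∈ D)
    (hp : p ∈ D) (hpv : p ≠ v) :
    ∃ C ⊆ D \ {v}, p ∈ C ∧ ConnSet G C ∧ (∃ c ∈ C, G.Adj c v) ∧
      ∀ u ∈ C, ∀ w ∈ D \ {v}, G.Adj u w → w ∈ C := by
  obtain ⟨C, hCs, hpC, hC, hcl⟩ := exists_component (G := G) (s := D \ {v}) (x := p) ⟨hp, hpv⟩
  refine ⟨C, hCs, hpC, hC, ?_, hcl⟩
  by_contra hcon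
  push Not at hcon
  have := hD.2 C ⟨p, hp, hpC⟩ (by
    intro u hu huC w hw huw
    by_cases hwv : w = v
    · subst hwv; exact absurd huw (hcon u huC)
    · exact hcl u huC w ⟨hw, hwv⟩ huw)
  exact (hCs (this hv)).2 rfl

theorem ConnSet.exists_adj_of_ne {D : Set V} (hD : ConnSet G D) {v p : V} (hv : v ∈ D)
    (hp : p ∈ D) (hpv : p ≠ v) : ∃ u ∈ D, u ≠ v ∧ G.Adj u v := by
  obtain ⟨C, hCs, _, _, ⟨c, hc, hcv⟩, _⟩ := hD.exists_component_diff hv hp hpv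
  exact ⟨c, (hCs hc).1, (hCs hc).2, hcv⟩

theorem ConnSet.exists_link {D : Set V} (hD : ConnSet G D) {x y : V} (hx : x ∈ D) (hy : y ∈ D)
    (hxy : x ≠ y) (hna : ¬ G.Adj x y) :
    ∃ R ⊆ D \ {x, y}, ConnSet G R ∧ (∃ r ∈ R, G.Adj x r) ∧ ∃ r ∈ R, G.Adj y r := by
  obtain ⟨C, hCs, hyC, hC, ⟨c, hc, hcx⟩, -⟩ := hD.exists_component_diff hx hy hxy.symm
  have hcy : c ≠ y := by
    rintro rfl; exact hna hcx.symm
  obtain ⟨R, hRs, hcR, hR, ⟨r, hr, hry⟩, -⟩ := hC.exists_component_diff hyC hc hcy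
  refine ⟨R, ?_, hR, ⟨c, hcR, hcx.symm⟩, ⟨r, hr, hry.symm⟩⟩
  intro z hz
  have h1 := hRs hz
  have h2 := hCs h1.1
  grind

/-- A set that is not connected splits off a proper part without outgoing edges. -/
theorem ConnSet.touch_compl {D t : Set V} (hD : ConnSet G D) (h1 : (D ∩ t).Nonempty)
    (h2 : (D \ t).Nonempty) : Touch G (D ∩ t) (D \ t) := by
  by_contra hcon
  obtain ⟨y, hy, hyt⟩ := h2
  obtain ⟨x, hx, hxt⟩ := h1
  refine hyt (hD.2 t ⟨x, hx, hxt⟩ ?_ hy)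
  intro u hu hut v hv huv
  by_contra hvt
  exact hcon ⟨u, ⟨hu, hut⟩, v, ⟨hv, hvt⟩, huv⟩

theorem connSet_image_Icc {q : ℕ → V} {i j : ℕ} (hij : i ≤ j)
    (h : ∀ k, i ≤ k → k < j → G.Adj (q k) (q (k + 1))) : ConnSet G (q '' Set.Icc i j) := by
  induction j, hij using Nat.le_induction with
  | base => simpa using connSet_singleton (q i)
  | succ j hij ih =>
    have h1 := ih fun k hk hkj => h k hk (by omega)
    have h2 : q '' Set.Icc i (j + 1) = insert (q (j + 1)) (q '' Set.Icc i j) := by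
      rw [← Set.image_insert_eq]
      congr 1
      ext k
      simp only [Set.mem_Icc, Set.mem_insert_iff]
      omega
    rw [h2]
    exact h1.insert ⟨j, ⟨hij, le_rfl⟩, rfl⟩ (h j hij (by omega))

end ConnSet

/-- Every edge that closes up a connected set forms a triangle with a vertex of that set. -/
def EdgeTriangle {V : Type} (G : SimpleGraph V) : Prop :=
  ∀ x y, G.Adj x y → ∀ D : Set V, ConnSet G D → x ∉ D → y ∉ D → (∃ d ∈ D, G.Adj x d) →
    (∃ d ∈ D, G.Adj y d) → ∃ z ∈ D, G.Adj x z ∧ G.Adj y z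

/-- The neighbors of `v` inside `S` are pairwise adjacent. -/
def SimplicialIn {V : Type} (G : SimpleGraph V) (S : Set V) (v : V) : Prop :=
  ∀ a ∈ S, ∀ b ∈ S, G.Adj v a → G.Adj v b → a ≠ b → G.Adj a b

/-- No four vertices are pairwise adjacent. -/
def NoFourClique {V : Type} (G : SimpleGraph V) : Prop :=
  ∀ a b c d, G.Adj a b → G.Adj a c → G.Adj a d → G.Adj b c → G.Adj b d → G.Adj c d → False

section Simplicial

variable {V : Type} {G : SimpleGraph V}

theorem EdgeTriangle.exists_simplicialIn [Finite V] (hG : EdgeTriangle G) (S : Set V)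
    (hS : S.Nonempty) : (∃ v ∈ S, SimplicialIn G S v) ∧
      ∀ x ∈ S, (∃ y ∈ S, y ≠ x ∧ ¬ G.Adj x y) →
        ∃ v ∈ S, SimplicialIn G S v ∧ v ≠ x ∧ ¬ G.Adj x v := by
  induction hn : S.ncard using Nat.strong_induction_on generalizing S with
  | _ n ih =>
  have main : ∀ x ∈ S, (∃ y ∈ S, y ≠ x ∧ ¬ G.Adj x y) →
        ∃ v ∈ S, SimplicialIn G S v ∧ v ≠ x ∧ ¬ G.Adj x v := by
    rintro x hx ⟨y, hy, hyx, hxy⟩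
    obtain ⟨C, hCs, hyC, hC, hcl⟩ :=
      exists_component (G := G) (s := {z | z ∈ S ∧ z ≠ x ∧ ¬ G.Adj x z}) (x := y) ⟨hy, hyx, hxy⟩
    set N : Set V := {u | u ∈ S ∧ u ∉ C ∧ ∃ c ∈ C, G.Adj u c} with hN
    have hNx : ∀ u ∈ N, G.Adj x u := by
      rintro u ⟨huS, huC, c, hc, huc⟩
      by_contra hxu
      refine huC (hcl c hc u ⟨huS, ?_, hxu⟩ huc.symm)
      rintro rfl
      exact (hCs hc).2.2 huc
    have hNclique : ∀ u ∈ N, ∀ w ∈ N, u ≠ w → G.Adj u w := by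
      intro u hu w hw huw
      obtain ⟨cu, hcu, hucu⟩ := hu.2.2
      obtain ⟨cw, hcw, hwcw⟩ := hw.2.2
      obtain ⟨z, hz, hxz, huz⟩ := hG x u (hNx u hu) (insert w C) (hC.insert hcw hwcw.symm)
        (by
          rintro (rfl | h)
          · exact (hNx x hw).ne rfl
          · exact (hCs h).2.1 rfl)
        (by
          rintro (h | h)
          · exact huw h
          · exact hu.2.1 h)
        ⟨w, Or.inl rfl, hNx w hw⟩ ⟨cu, Or.inr hcu, hucu⟩
      rcases hz with rfl | hz
      · exact huz
      · exact absurd hxz (hCs hz).2.2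
    have hCS : C ⊆ S := fun c hc => (hCs hc).1
    have hxC : x ∉ C := fun h => (hCs h).2.1 rfl
    have hxN : x ∉ N := fun h => (hNx x h).ne rfl
    have hsub : C ∪ N ⊆ S := Set.union_subset hCS fun u hu => hu.1
    have hlt : (C ∪ N).ncard < n := by
      rw [← hn]
      apply Set.ncard_lt_ncard _ (Set.toFinite _)
      exact ⟨hsub, fun h => by rcases h hx with h | h <;> contradiction⟩
    have hltC : C.ncard < n :=
      lt_of_le_of_lt (Set.ncard_le_ncard Set.subset_union_left (Set.toFinite _)) hlt
    have lift : ∀ v ∈ C, SimplicialIn G (C ∪ N) v → ∃ v ∈ S, SimplicialIn G S v ∧ v ≠ x ∧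
        ¬ G.Adj x v := by
      intro v hv hsv
      refine ⟨v, hCS hv, ?_, (hCs hv).2.1, (hCs hv).2.2⟩
      have hnb : ∀ a ∈ S, G.Adj v a → a ∈ C ∪ N := by
        intro a ha hva
        by_cases haC : a ∈ C
        · exact Or.inl haC
        · exact Or.inr ⟨ha, haC, v, hv, hva.symm⟩
      intro a ha b hb hva hvb hab
      exact hsv a (hnb a ha hva) b (hnb b hb hvb) hva hvb hab
    by_cases hu : ∃ u ∈ N, ∃ z ∈ C ∪ N, z ≠ u ∧ ¬ G.Adj u z
    · obtain ⟨u, huN, hz⟩ := hu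
      obtain ⟨v, hv, hsv, hvu, huv⟩ :=
        (ih _ hlt (C ∪ N) ⟨y, Or.inl hyC⟩ rfl).2 u (Or.inr huN) hz
      have hvC : v ∈ C := by
        rcases hv with hv | hv
        · exact hv
        · exact absurd (hNclique u huN v hv hvu.symm) huv
      exact lift v hvC hsv
    · push Not at hu
      obtain ⟨v, hv, hsv⟩ := (ih _ hltC C ⟨y, hyC⟩ rfl).1
      refine lift v hv ?_
      rintro a (ha | ha) b (hb | hb) hva hvb hab
      · exact hsv a ha b hb hva hvb hab
      · exact (hu b hb a (Or.inl ha) hab).symm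
      · exact hu a ha b (Or.inl hb) hab.symm
      · exact hNclique a ha b hb hab
  refine ⟨?_, main⟩
  by_cases h : ∃ x ∈ S, ∃ y ∈ S, y ≠ x ∧ ¬ G.Adj x y
  · obtain ⟨x, hx, hy⟩ := h
    obtain ⟨v, hv, hsv, -⟩ := main x hx hy
    exact ⟨v, hv, hsv⟩
  · push Not at h
    obtain ⟨x, hx⟩ := hS
    exact ⟨x, hx, fun a ha b hb _ _ hab => h a ha b hb hab.symm⟩

theorem ConnSet.diff_simplicialIn {S A : Set V} {v : V} (hA : ConnSet G A) (hAS : A ⊆ S)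
    (hv : SimplicialIn G S v) (hne : A ≠ {v}) : ConnSet G (A \ {v}) := by
  by_cases hvA : v ∈ A
  · have hex : ∃ p ∈ A, p ≠ v := by
      by_contra hcon
      push Not at hcon
      exact hne (Set.eq_singleton_iff_unique_mem.2 ⟨hvA, hcon⟩)
    obtain ⟨p, hp, hpv⟩ := hex
    obtain ⟨u, hu, huv, huadj⟩ := hA.exists_adj_of_ne hvA hp hpv
    refine ⟨⟨p, hp, hpv⟩, ?_⟩
    rintro t ⟨x, ⟨hxA, hxv⟩, hxt⟩ hc
    have key : ∀ s : Set V, s ⊆ A \ {v} →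
        (∀ a ∈ A \ {v}, a ∈ s → ∀ b ∈ A \ {v}, G.Adj a b → b ∈ s) → u ∈ s → A \ {v} ⊆ s := by
      intro s hs hcs hus
      have := hA.2 (s ∪ {v}) ⟨v, hvA, Or.inr rfl⟩ (by
        rintro a ha has b hb hab
        by_cases hbv : b = v
        · exact Or.inr hbv
        by_cases hav : a = v
        · subst hav
          by_cases hbu : b = u
          · subst hbu; exact Or.inl hus
          · exact Or.inl (hcs u ⟨hu, huv⟩ hus b ⟨hb, hbv⟩
              (hv u (hAS hu) b (hAS hb) huadj.symm hab (Ne.symm hbu)))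
        · rcases has with has | has
          · exact Or.inl (hcs a ⟨ha, hav⟩ has b ⟨hb, hbv⟩ hab)
          · exact absurd has hav)
      intro z hz
      rcases this hz.1 with h | h
      · exact h
      · exact absurd h hz.2
    by_cases hut : u ∈ t
    · intro z hz
      exact (key (t ∩ (A \ {v})) Set.inter_subset_right
        (fun a ha hat b hb hab => ⟨hc a ha hat.1 b hb hab, hb⟩) ⟨hut, hu, huv⟩ hz).1
    · exfalso
      have := key ((A \ {v}) \ t) Set.sdiff_subset
        (fun a ha hat b hb hab => ⟨hb, fun hbt => hat.2 (hc b hb hbt a ha hab.symm)⟩)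
        ⟨⟨hu, huv⟩, hut⟩ ⟨hxA, hxv⟩
      exact this.2 hxt
  · rwa [Set.sdiff_singleton_eq_self hvA]

theorem ConnSet.exists_simplicialIn_replacement {S A : Set V} {v b : V} (hA : ConnSet G A)
    (hAS : A ⊆ S) (hv : SimplicialIn G S v) (hne : A ≠ {v}) (hvA : v ∈ A) (hbA : b ∉ A)
    (hbS : b ∈ S) (hvb : G.Adj v b) : ∃ u ∈ A \ {v}, G.Adj u b ∧ G.Adj v u := by
  have hex : ∃ p ∈ A, p ≠ v := by
    by_contra hcon
    push Not at hcon
    exact hne (Set.eq_singleton_iff_unique_mem.2 ⟨hvA, hcon⟩)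
  obtain ⟨p, hp, hpv⟩ := hex
  obtain ⟨u, hu, huv, huadj⟩ := hA.exists_adj_of_ne hvA hp hpv
  refine ⟨u, ⟨hu, huv⟩, hv u (hAS hu) b hbS huadj.symm hvb ?_, huadj.symm⟩
  rintro rfl
  exact hbA hu

theorem Touch.diff_simplicialIn {S A B : Set V} {v : V} (h : Touch G A B) (hA : ConnSet G A)
    (hB : ConnSet G B) (hAS : A ⊆ S) (hBS : B ⊆ S) (hv : SimplicialIn G S v) (hAne : A ≠ {v})
    (hBne : B ≠ {v}) (hAB : Disjoint A B) : Touch G (A \ {v}) (B \ {v}) := by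
  have hAB' := Set.disjoint_left.1 hAB
  obtain ⟨a, ha, b, hb, hab⟩ := h
  by_cases hav : a = v
  · subst hav
    obtain ⟨u, hu, hub, -⟩ := hA.exists_simplicialIn_replacement hAS hv hAne ha
      (fun h => hAB' h hb) (hBS hb) hab
    exact ⟨u, hu, b, ⟨hb, hab.ne'⟩, hub⟩
  · by_cases hbv : b = v
    · subst hbv
      obtain ⟨u, hu, hua, -⟩ := hB.exists_simplicialIn_replacement hBS hv hBne hb
        (hAB' ha) (hAS ha) hab.symm
      exact ⟨a, ⟨ha, hav⟩, u, hu, hua.symm⟩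
    · exact ⟨a, ⟨ha, hav⟩, b, ⟨hb, hbv⟩, hab⟩

end Simplicial

section Minors

variable {V : Type} {G : SimpleGraph V}

/-- A `K₄`-minor model inside a vertex set `S`. -/
theorem EdgeTriangle.no_four_branch_sets [Finite V] (hG : EdgeTriangle G) (h4 : NoFourClique G)
    (S : Set V) (f : Fin 4 → Set V) (hf : ∀ i, ConnSet G (f i)) (hfS : ∀ i, f i ⊆ S)
    (hd : ∀ i j, i ≠ j → Disjoint (f i) (f j)) (ht : ∀ i j, i ≠ j → Touch G (f i) (f j)) :
    False := by
  induction hn : S.ncard using Nat.strong_induction_on generalizing S f with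
  | _ n ih =>
  have hS : S.Nonempty := (hf 0).nonempty.mono (hfS 0)
  obtain ⟨v, hvS, hv⟩ := (hG.exists_simplicialIn S hS).1
  by_cases h : ∃ i, f i = {v}
  · obtain ⟨i, hi⟩ := h
    have nb : ∀ j, j ≠ i → ∃ b ∈ f j, G.Adj v b := by
      intro j hj
      obtain ⟨a, ha, b, hb, hab⟩ := ht i j hj.symm
      rw [hi] at ha
      rw [Set.mem_singleton_iff] at ha
      subst ha
      exact ⟨b, hb, hab⟩
    have : Nonempty V := ⟨v⟩
    choose! b hbf hvb using nb
    have adj : ∀ j k, j ≠ i → k ≠ i → j ≠ k → G.Adj (b j) (b k) := by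
      intro j k hj hk hjk
      refine hv _ (hfS j (hbf j hj)) _ (hfS k (hbf k hk)) (hvb j hj) (hvb k hk) ?_
      intro h
      have h1 := hbf j hj
      rw [h] at h1
      exact Set.disjoint_left.1 (hd j k hjk) h1 (hbf k hk)
    have : ∃ j k l : Fin 4, j ≠ i ∧ k ≠ i ∧ l ≠ i ∧ j ≠ k ∧ j ≠ l ∧ k ≠ l := by
      clear hi adj hbf hvb; revert i; decide
    obtain ⟨j, k, l, hj, hk, hl, hjk, hjl, hkl⟩ := this
    exact h4 v (b j) (b k) (b l) (hvb j hj) (hvb k hk) (hvb l hl) (adj j k hj hk hjk)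
      (adj j l hj hl hjl) (adj k l hk hl hkl)
  · push Not at h
    refine ih (S \ {v}).ncard ?_ (S \ {v}) (fun i => f i \ {v}) (fun i => ?_) (fun i => ?_)
      (fun i j hij => ?_) (fun i j hij => ?_) rfl
    · rw [← hn]
      exact Set.ncard_sdiff_singleton_lt_of_mem hvS (Set.toFinite _)
    · exact (hf i).diff_simplicialIn (hfS i) hv (h i)
    · exact Set.sdiff_subset_sdiff_left (hfS i)
    · exact (hd i j hij).mono Set.sdiff_subset Set.sdiff_subset
    · exact (ht i j hij).diff_simplicialIn (hf i) (hf j) (hfS i) (hfS j) hv (h i) (h j) (hd i j hij)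

/-- `P` and `Q` are joined by a marked edge, or `E` connects them. -/
def Thick (G : SimpleGraph V) (M : Set (Sym2 V)) (P Q E : Set V) : Prop :=
  (∃ x ∈ P, ∃ y ∈ Q, G.Adj x y ∧ s(x, y) ∈ M) ∨ (ConnSet G E ∧ Touch G E P ∧ Touch G E Q)

theorem Thick.symm {M : Set (Sym2 V)} {P Q E : Set V} (h : Thick G M P Q E) :
    Thick G M Q P E := by
  rcases h with ⟨x, hx, y, hy, hxy, hM⟩ | ⟨h1, h2, h3⟩
  · exact Or.inl ⟨y, hy, x, hx, hxy.symm, by rwa [Sym2.eq_swap]⟩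
  · exact Or.inr ⟨h1, h3, h2⟩

/-- A model of the 3-sun inside `S`, where marked edges may replace the ears `E i`. -/
structure SunModel (G : SimpleGraph V) (M : Set (Sym2 V)) (S : Set V) (A E : Fin 3 → Set V) :
    Prop where
  conn : ∀ i, ConnSet G (A i)
  subA : ∀ i, A i ⊆ S
  subE : ∀ i, E i ⊆ S
  disj : ∀ i j, i ≠ j → Disjoint (A i) (A j)
  disjE : ∀ i j, Disjoint (A i) (E j)
  touch : ∀ i j, i ≠ j → Touch G (A i) (A j)
  thick : ∀ i, Thick G M (A (i + 1)) (A (i + 2)) (E i)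

/-- In the triangle `a b c` the edge `a b` is marked or lies in another triangle within `S`. -/
def RichIn (G : SimpleGraph V) (M : Set (Sym2 V)) (S : Set V) (a b c : V) : Prop :=
  s(a, b) ∈ M ∨ ∃ z ∈ S, z ≠ c ∧ G.Adj a z ∧ G.Adj b z

theorem RichIn.swap {M : Set (Sym2 V)} {S : Set V} {a b c : V} (h : RichIn G M S a b c) :
    RichIn G M S b a c := by
  rcases h with h | ⟨z, hz, hzc, h1, h2⟩
  · exact Or.inl (by rwa [Sym2.eq_swap])
  · exact Or.inr ⟨z, hz, hzc, h2, h1⟩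

/-- The marks inherited when the simplicial vertex `v` is removed. -/
def inheritedMarks (G : SimpleGraph V) (M : Set (Sym2 V)) (v : V) : Set (Sym2 V) :=
  M ∪ {e | ∃ x y, e = s(x, y) ∧ G.Adj v x ∧ G.Adj v y}

theorem Thick.diff_simplicialIn {M : Set (Sym2 V)} {S P Q E : Set V} {v : V}
    (h : Thick G M P Q E) (hP : ConnSet G P) (hQ : ConnSet G Q) (hPS : P ⊆ S) (hQS : Q ⊆ S)
    (hES : E ⊆ S) (hv : SimplicialIn G S v) (hPne : P ≠ {v}) (hQne : Q ≠ {v})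
    (hPQ : Disjoint P Q) (hPE : Disjoint P E) (hQE : Disjoint Q E) :
    Thick G (inheritedMarks G M v) (P \ {v}) (Q \ {v}) (E \ {v}) := by
  have hPQ' := Set.disjoint_left.1 hPQ
  have hPE' := Set.disjoint_left.1 hPE
  have hQE' := Set.disjoint_left.1 hQE
  rcases h with ⟨x, hx, y, hy, hxy, hM⟩ | ⟨hE, h1, h2⟩
  · left
    by_cases hxv : x = v
    · subst hxv
      obtain ⟨u, hu, huy, hxu⟩ := hP.exists_simplicialIn_replacement hPS hv hPne hx
        (fun h => hPQ' h hy) (hQS hy) hxy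
      exact ⟨u, hu, y, ⟨hy, hxy.ne'⟩, huy, Or.inr ⟨u, y, rfl, hxu, hxy⟩⟩
    by_cases hyv : y = v
    · subst hyv
      obtain ⟨u, hu, hux, hyu⟩ := hQ.exists_simplicialIn_replacement hQS hv hQne hy
        (hPQ' hx) (hPS hx) hxy.symm
      exact ⟨x, ⟨hx, hxv⟩, u, hu, hux.symm, Or.inr ⟨x, u, rfl, hxy.symm, hyu⟩⟩
    exact ⟨x, ⟨hx, hxv⟩, y, ⟨hy, hyv⟩, hxy, Or.inl hM⟩
  · by_cases hEv : E = {v}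
    · left
      obtain ⟨a, ha, x, hx, hax⟩ := h1
      obtain ⟨b, hb, y, hy, hby⟩ := h2
      rw [hEv, Set.mem_singleton_iff] at ha hb
      subst ha hb
      refine ⟨x, ⟨hx, hax.ne'⟩, y, ⟨hy, hby.ne'⟩, hv x (hPS hx) y (hQS hy) hax hby ?_,
        Or.inr ⟨x, y, rfl, hax, hby⟩⟩
      rintro rfl
      exact hPQ' hx hy
    · right
      exact ⟨hE.diff_simplicialIn hES hv hEv,
        h1.diff_simplicialIn hE hP hES hPS hv hEv hPne hPE.symm,
        h2.diff_simplicialIn hE hQ hES hQS hv hEv hQne hQE.symm⟩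

theorem EdgeTriangle.exists_common_of_second_edge (hG : EdgeTriangle G) {P Q : Set V}
    (hP : ConnSet G P) (hQ : ConnSet G Q) (hPQ : Disjoint P Q) {x y x' y' : V} (hx : x ∈ P)
    (hy : y ∈ Q) (hx' : x' ∈ P) (hy' : y' ∈ Q) (hxy : G.Adj x y) (hxy' : G.Adj x' y')
    (hne : x ≠ x' ∨ y ≠ y') : ∃ z ∈ P ∪ Q, G.Adj x z ∧ G.Adj y z := by
  have hPQ' := Set.disjoint_left.1 hPQ
  have hyP : y ∉ P := fun h => hPQ' h hy
  have hxQ : x ∉ Q := hPQ' hx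
  by_cases h1 : x = x'
  · subst h1
    have h2 : y' ≠ y := fun h => by simp_all
    obtain ⟨C, hC, hyC, hCc, ⟨c, hc, hcy⟩, -⟩ := hQ.exists_component_diff hy hy' h2
    obtain ⟨z, hz, h⟩ := hG x y hxy C hCc (fun h => hxQ (hC h).1) (fun h => (hC h).2 rfl)
      ⟨y', hyC, hxy'⟩ ⟨c, hc, hcy.symm⟩
    exact ⟨z, Or.inr (hC hz).1, h⟩
  · obtain ⟨C, hC, hxC, hCc, ⟨c, hc, hcx⟩, -⟩ := hP.exists_component_diff hx hx' (Ne.symm h1)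
    by_cases h2 : y = y'
    · subst h2
      obtain ⟨z, hz, h⟩ := hG x y hxy C hCc (fun h => (hC h).2 rfl) (fun h => hyP (hC h).1)
        ⟨c, hc, hcx.symm⟩ ⟨x', hxC, hxy'.symm⟩
      exact ⟨z, Or.inl (hC hz).1, h⟩
    · obtain ⟨D, hD, hyD, hDc, ⟨d, hd, hdy⟩, -⟩ := hQ.exists_component_diff hy hy' (Ne.symm h2)
      obtain ⟨z, hz, h⟩ := hG x y hxy (C ∪ D) (hCc.union_touch hDc ⟨x', hxC, y', hyD, hxy'⟩)
        (by rintro (h | h); exacts [(hC h).2 rfl, hxQ (hD h).1])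
        (by rintro (h | h); exacts [hyP (hC h).1, (hD h).2 rfl])
        ⟨c, Or.inl hc, hcx.symm⟩ ⟨d, Or.inr hd, hdy.symm⟩
      refine ⟨z, ?_, h⟩
      rcases hz with hz | hz
      exacts [Or.inl (hC hz).1, Or.inr (hD hz).1]

theorem EdgeTriangle.exists_rich_triangle [Finite V] (hG : EdgeTriangle G) (h4 : NoFourClique G)
    {M : Set (Sym2 V)} {S : Set V} {A E : Fin 3 → Set V} (h : SunModel G M S A E) :
    ∃ a ∈ S, ∃ b ∈ S, ∃ c ∈ S, G.Adj a b ∧ G.Adj b c ∧ G.Adj a c ∧ RichIn G M S a b c ∧ RichIn G M S b c a ∧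
      RichIn G M S a c b := by
  induction hn : S.ncard using Nat.strong_induction_on generalizing S A E M with
  | _ n ih =>
  have hS : S.Nonempty := (h.conn 0).nonempty.mono (h.subA 0)
  obtain ⟨v, hvS, hv⟩ := (hG.exists_simplicialIn S hS).1
  by_cases hs : ∃ i, A i = {v}
  · obtain ⟨i, hi⟩ := hs
    have n1 : i + 1 ≠ i := by clear hi; revert i; decide
    have n2 : i + 2 ≠ i := by clear hi; revert i; decide
    have n12 : i + 1 ≠ i + 2 := by clear hi; revert i; decide
    have e1 : i + 1 + 1 = i + 2 := by clear hi; revert i; decide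
    have e2 : i + 1 + 2 = i := by clear hi; revert i; decide
    have e3 : i + 2 + 1 = i := by clear hi; revert i; decide
    have e4 : i + 2 + 2 = i + 1 := by clear hi; revert i; decide
    have nb : ∀ B, Touch G (A i) B → ∃ b ∈ B, G.Adj v b := by
      rintro B ⟨a, ha, b, hb, hab⟩
      rw [hi, Set.mem_singleton_iff] at ha
      subst ha
      exact ⟨b, hb, hab⟩
    obtain ⟨x, hx, hvx⟩ := nb _ (h.touch _ _ n1.symm)
    obtain ⟨y, hy, hvy⟩ := nb _ (h.touch _ _ n2.symm)
    have hd := Set.disjoint_left.1 (h.disj _ _ n12)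
    have hxy : G.Adj x y := hv x (h.subA _ hx) y (h.subA _ hy) hvx hvy (by
      rintro rfl; exact hd hx hy)
    have only : ∀ z ∈ S, G.Adj v z → z = x ∨ z = y := by
      intro z hz hvz
      by_contra hcon
      push Not at hcon
      exact h4 v x y z hvx hvy hvz hxy (hv x (h.subA _ hx) z hz hvx hvz hcon.1.symm)
        (hv y (h.subA _ hy) z hz hvy hvz hcon.2.symm)
    have noear : ∀ j, ¬ Touch G (E j) (A i) := by
      intro j ht
      obtain ⟨b, hb, hvb⟩ := nb _ ht.symm
      rcases only b (h.subE _ hb) hvb with rfl | rfl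
      · exact Set.disjoint_left.1 (h.disjE _ j) hx hb
      · exact Set.disjoint_left.1 (h.disjE _ j) hy hb
    have mem_i : ∀ w, w ∈ A i → w = v := by
      intro w hw; rwa [hi] at hw
    have hvA : ∀ j, j ≠ i → v ∉ A j := by
      intro j hj hvj
      exact Set.disjoint_left.1 (h.disj _ _ hj) hvj (by rw [hi]; rfl)
    have hvE : ∀ j, v ∉ E j := by
      intro j hvj
      exact Set.disjoint_left.1 (h.disjE i j) (by rw [hi]; rfl) hvj
    have mvy : s(v, y) ∈ M := by
      have := h.thick (i + 1)
      rw [e1, e2] at this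
      rcases this with ⟨p, hp, w, hw, hpw, hM⟩ | ⟨_, _, h3⟩
      · have := mem_i w hw
        subst this
        rcases only p (h.subA _ hp) hpw.symm with rfl | rfl
        · exact absurd hp (hd hx)
        · rwa [Sym2.eq_swap]
      · exact absurd h3 (noear _)
    have mvx : s(v, x) ∈ M := by
      have := h.thick (i + 2)
      rw [e3, e4] at this
      rcases this with ⟨w, hw, p, hp, hpw, hM⟩ | ⟨_, h3, _⟩
      · have := mem_i w hw
        subst this
        rcases only p (h.subA _ hp) hpw with rfl | rfl
        · exact hM
        · exact absurd hy (hd hp)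
      · exact absurd h3 (noear _)
    refine ⟨v, hvS, x, h.subA _ hx, y, h.subA _ hy, hvx, hxy, hvy, Or.inl mvx, ?_, Or.inl mvy⟩
    rcases h.thick i with ⟨x', hx', y', hy', hxy', hM⟩ | ⟨hE, ⟨e, he, p, hp, hep⟩, h3⟩
    · by_cases hne : x ≠ x' ∨ y ≠ y'
      · obtain ⟨z, hz, h1, h2⟩ := hG.exists_common_of_second_edge (h.conn _) (h.conn _)
          (h.disj _ _ n12) hx hy hx' hy' hxy hxy' hne
        refine Or.inr ⟨z, ?_, ?_, h1, h2⟩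
        · rcases hz with hz | hz
          exacts [h.subA _ hz, h.subA _ hz]
        · rintro rfl
          rcases hz with hz | hz
          exacts [hvA _ n1 hz, hvA _ n2 hz]
      · push Not at hne
        obtain ⟨rfl, rfl⟩ := hne
        exact Or.inl hM
    · obtain ⟨e', he', q, hq, heq⟩ := h3
      have hPE : ConnSet G (A (i + 1) ∪ E i) :=
        (h.conn _).union_touch hE ⟨p, hp, e, he, hep.symm⟩
      obtain ⟨z, hz, h1, h2⟩ := hG.exists_common_of_second_edge hPE (h.conn (i + 2))
          (Set.disjoint_union_left.2 ⟨h.disj _ _ n12, (h.disjE _ _).symm⟩) (Or.inl hx) hy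
          (Or.inr he') hq hxy heq (Or.inl (by
            rintro rfl
            exact Set.disjoint_left.1 (h.disjE _ _) hx he'))
      refine Or.inr ⟨z, ?_, ?_, h1, h2⟩
      · rcases hz with (hz | hz) | hz
        exacts [h.subA _ hz, h.subE _ hz, h.subA _ hz]
      · rintro rfl
        rcases hz with (hz | hz) | hz
        exacts [hvA _ n1 hz, hvE _ hz, hvA _ n2 hz]
  · push Not at hs
    have hmodel : SunModel G (inheritedMarks G M v) (S \ {v}) (fun i => A i \ {v})
        (fun i => E i \ {v}) := by
      refine ⟨fun i => ?_, fun i => ?_, fun i => ?_, fun i j hij => ?_, fun i j => ?_,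
        fun i j hij => ?_, fun i => ?_⟩
      · exact (h.conn i).diff_simplicialIn (h.subA i) hv (hs i)
      · exact Set.sdiff_subset_sdiff_left (h.subA i)
      · exact Set.sdiff_subset_sdiff_left (h.subE i)
      · exact (h.disj i j hij).mono Set.sdiff_subset Set.sdiff_subset
      · exact (h.disjE i j).mono Set.sdiff_subset Set.sdiff_subset
      · exact (h.touch i j hij).diff_simplicialIn (h.conn i) (h.conn j) (h.subA i) (h.subA j) hv
          (hs i) (hs j) (h.disj i j hij)
      · exact (h.thick i).diff_simplicialIn (h.conn _) (h.conn _) (h.subA _) (h.subA _)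
          (h.subE _) hv (hs _) (hs _) (h.disj _ _ (by clear hs; revert i; decide)) (h.disjE _ _)
          (h.disjE _ _)
    obtain ⟨a, ha, b, hb, c, hc, hab, hbc, hac, r1, r2, r3⟩ := ih (S \ {v}).ncard (by
      rw [← hn]
      exact Set.ncard_sdiff_singleton_lt_of_mem hvS (Set.toFinite _)) hmodel rfl
    have lift : ∀ p ∈ S \ {v}, ∀ q ∈ S \ {v}, ∀ r ∈ S \ {v},
        RichIn G (inheritedMarks G M v) (S \ {v}) p q r → RichIn G M S p q r := by
      rintro p hp q hq r hr ((hm | ⟨x, y, he, hx, hy⟩) | ⟨z, hz, h⟩)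
      · exact Or.inl hm
      · refine Or.inr ⟨v, hvS, fun h => hr.2 h.symm, ?_⟩
        rcases Sym2.eq_iff.1 he with ⟨rfl, rfl⟩ | ⟨rfl, rfl⟩
        exacts [⟨hx.symm, hy.symm⟩, ⟨hy.symm, hx.symm⟩]
      · exact Or.inr ⟨z, hz.1, h⟩
    exact ⟨a, ha.1, b, hb.1, c, hc.1, hab, hbc, hac, lift a ha b hb c hc r1,
      lift b hb c hc a ha r2, lift a ha c hc b hb r3⟩

end Minors

/-- Adjacency of the numbers `i, j < n` on the cycle `0, 1, …, n - 1`. -/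
def CycNbr (n i j : ℕ) : Prop :=
  i + 1 = j ∨ j + 1 = i ∨ (i = 0 ∧ j + 1 = n) ∨ (j = 0 ∧ i + 1 = n)

/-- The vertices `q 0, …, q (n - 1)` form an induced cycle with vertex set `S`. -/
structure CycleOn {V : Type} (G : SimpleGraph V) (n : ℕ) (q : ℕ → V) (S : Set V) : Prop where
  inj : ∀ i < n, ∀ j < n, q i = q j → i = j
  range : ∀ x, x ∈ S ↔ ∃ i < n, q i = x
  adj : ∀ i < n, ∀ j < n, G.Adj (q i) (q j) ↔ CycNbr n i j

section Cycles

variable {V : Type} {G : SimpleGraph V}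

theorem zmod_natCast_inj {n i j : ℕ} (hi : i < n) (hj : j < n) :
    (i : ZMod n) = (j : ZMod n) ↔ i = j := by
  rw [ZMod.natCast_eq_natCast_iff', Nat.mod_eq_of_lt hi, Nat.mod_eq_of_lt hj]

theorem zmod_natCast_eq_succ {n i j : ℕ} (hi : i < n) (hj : j < n) :
    (i : ZMod n) = (j : ZMod n) + 1 ↔ i = j + 1 ∨ (i = 0 ∧ j + 1 = n) := by
  by_cases h : j + 1 = n
  · have : (j : ZMod n) + 1 = ((0 : ℕ) : ZMod n) := by
      have : ((j + 1 : ℕ) : ZMod n) = 0 := by rw [h]; simp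
      push_cast at this
      simpa using this
    rw [this, zmod_natCast_inj hi (by omega)]
    omega
  · have : (j : ZMod n) + 1 = ((j + 1 : ℕ) : ZMod n) := by push_cast; rfl
    rw [this, zmod_natCast_inj hi (by omega)]
    omega

theorem cycGraph_adj_natCast {n i j : ℕ} (hn : 3 ≤ n) (hi : i < n) (hj : j < n) :
    (cycGraph n).Adj (i : ZMod n) (j : ZMod n) ↔ CycNbr n i j := by
  rw [cycGraph, SimpleGraph.fromRel_adj, ne_eq, zmod_natCast_inj hi hj,
    zmod_natCast_eq_succ hi hj, zmod_natCast_eq_succ hj hi, CycNbr]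
  omega

theorem nonempty_iso_cycGraph_iff {n : ℕ} (hn : 3 ≤ n) {S : Set V} :
    Nonempty ((G.induce S) ≃g cycGraph n) ↔ ∃ q, CycleOn G n q S := by
  have : NeZero n := ⟨by omega⟩
  constructor
  · rintro ⟨e⟩
    refine ⟨fun i => (e.symm (i : ZMod n)).1, ?_, ?_, ?_⟩
    · intro i hi j hj h
      exact (zmod_natCast_inj hi hj).1 (e.symm.injective (Subtype.ext h))
    · intro x
      constructor
      · intro hx
        refine ⟨(e ⟨x, hx⟩).val, ZMod.val_lt _, ?_⟩
        simp
      · rintro ⟨i, _, rfl⟩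
        exact Subtype.coe_prop _
    · intro i hi j hj
      rw [← cycGraph_adj_natCast hn hi hj, ← e.symm.map_adj_iff]
      rfl
  · rintro ⟨q, hq⟩
    have hm : ∀ z : ZMod n, q z.val ∈ S := fun z => (hq.range _).2 ⟨z.val, ZMod.val_lt _, rfl⟩
    let f : ZMod n → S := fun z => ⟨q z.val, hm z⟩
    have hf : Function.Bijective f := by
      constructor
      · intro a b hab
        exact ZMod.val_injective n
          (hq.inj _ (ZMod.val_lt _) _ (ZMod.val_lt _) (congrArg Subtype.val hab))
      · rintro ⟨x, hx⟩
        obtain ⟨i, hi, rfl⟩ := (hq.range _).1 hx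
        refine ⟨(i : ZMod n), Subtype.ext ?_⟩
        simp [f, ZMod.val_natCast, Nat.mod_eq_of_lt hi]
    refine ⟨(RelIso.mk (Equiv.ofBijective f hf) ?_).symm⟩
    intro a b
    change G.Adj (q a.val) (q b.val) ↔ _
    rw [hq.adj _ (ZMod.val_lt _) _ (ZMod.val_lt _),
      ← cycGraph_adj_natCast hn (ZMod.val_lt _) (ZMod.val_lt _)]
    simp

theorem isChordlessCycle_iff {S : Set V} :
    IsChordlessCycle G S ↔ ∃ n, 3 ≤ n ∧ ∃ q, CycleOn G n q S := by
  constructor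
  · rintro ⟨n, hn, h⟩
    exact ⟨n, hn, (nonempty_iso_cycGraph_iff hn).1 h⟩
  · rintro ⟨n, hn, h⟩
    exact ⟨n, hn, (nonempty_iso_cycGraph_iff hn).2 h⟩

/-- An induced path, except possibly for an edge between its two ends. -/
structure InducedPath (G : SimpleGraph V) (D : Set V) (m : ℕ) (q : ℕ → V) : Prop where
  two_le : 2 ≤ m
  interior : ∀ i, 0 < i → i < m → q i ∈ D
  inj : ∀ i ≤ m, ∀ j ≤ m, q i = q j → i = j
  step : ∀ i < m, G.Adj (q i) (q (i + 1))
  induced : ∀ i ≤ m, ∀ j ≤ m, i < j → G.Adj (q i) (q j) → i + 1 = j ∨ (i = 0 ∧ j = m)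

theorem ConnSet.exists_inducedPath {D : Set V} (hD : ConnSet G D) {x y : V} (hxD : x ∉ D)
    (hyD : y ∉ D) (hxy : x ≠ y) (hx : ∃ d ∈ D, G.Adj x d) (hy : ∃ d ∈ D, G.Adj y d) :
    ∃ m q, InducedPath G D m q ∧ q 0 = x ∧ q m = y := by
  classical
  let P : ℕ → V → Prop := fun m z => 2 ≤ m ∧ ∃ q : ℕ → V, q 0 = x ∧ q m = z ∧
    (∀ i, 0 < i → i < m → q i ∈ D) ∧ ∀ i < m, G.Adj (q i) (q (i + 1))
  have extend : ∀ m z w (q : ℕ → V), q 0 = x → q m = z → 1 ≤ m → z ∈ D →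
      (∀ i, 0 < i → i < m → q i ∈ D) → (∀ i < m, G.Adj (q i) (q (i + 1))) → G.Adj z w →
      P (m + 1) w := by
    intro m z w q h0 hm h1 hz hi hs hzw
    refine ⟨by omega, fun i => if i ≤ m then q i else w, by simpa using h0, by simp, ?_, ?_⟩
    · intro i hi0 him
      dsimp only
      rw [if_pos (by omega)]
      rcases Nat.lt_or_ge i m with h | h
      · exact hi i hi0 h
      · rw [show i = m by omega, hm]; exact hz
    · intro i him
      dsimp only
      rw [if_pos (by omega)]
      split_ifs with h
      · exact hs i (by omega)
      · rw [show i = m by omega, hm]; exact hzw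
  have hex : ∃ m, P m y := by
    obtain ⟨d, hd, hxd⟩ := hx
    obtain ⟨e, he, hye⟩ := hy
    have key : D ⊆ {z | z ∈ D ∧ ∃ m, 1 ≤ m ∧ ∃ q : ℕ → V, q 0 = x ∧ q m = z ∧
        (∀ i, 0 < i → i < m → q i ∈ D) ∧ ∀ i < m, G.Adj (q i) (q (i + 1))} := by
      refine hD.2 _ ⟨d, hd, hd, 1, le_rfl, fun i => if i = 0 then x else d, by simp, by simp,
        fun i h0 h1 => by omega, ?_⟩ ?_
      · intro i hi
        rw [show i = 0 by omega]
        simpa using hxd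
      · rintro u hu ⟨-, m, hm, q, h0, h1, h2, h3⟩ v hv huv
        obtain ⟨-, q', h⟩ := extend m u v q h0 h1 hm hu h2 h3 huv
        exact ⟨hv, m + 1, by omega, q', h⟩
    obtain ⟨-, m, hm, q, h0, h1, h2, h3⟩ := key he
    exact ⟨m + 1, extend m e y q h0 h1 hm he h2 h3 hye.symm⟩
  obtain ⟨h2m, q, h0, hm, hint, hstep⟩ := Nat.find_spec hex
  have hmin : ∀ k, k < Nat.find hex → ¬ P k y := fun k hk => Nat.find_min hex hk
  set m := Nat.find hex
  have shortcut : ∀ i j, i < j → j ≤ m → i + 1 ≠ j → ¬ (i = 0 ∧ j = m) → ¬ G.Adj (q i) (q j) := by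
    intro i j hij hj h1 h2 hadj
    refine hmin (m - (j - i - 1)) (by omega) ⟨by omega,
      fun k => if k ≤ i then q k else q (k + (j - i - 1)), by simpa using h0, ?_, ?_, ?_⟩
    · dsimp only
      rw [if_neg (by omega), show m - (j - i - 1) + (j - i - 1) = m by omega, hm]
    · intro k hk0 hk
      dsimp only
      split_ifs
      · exact hint k hk0 (by omega)
      · exact hint _ (by omega) (by omega)
    · intro k hk
      dsimp only
      by_cases hki : k + 1 ≤ i
      · rw [if_pos (by omega), if_pos hki]
        exact hstep k (by omega)
      · by_cases hki' : k ≤ i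
        · rw [if_pos hki', if_neg hki, show k = i by omega,
            show i + 1 + (j - i - 1) = j by omega]
          exact hadj
        · rw [if_neg hki', if_neg hki, show k + 1 + (j - i - 1) = k + (j - i - 1) + 1 by omega]
          exact hstep _ (by omega)
  have hinj : ∀ i j, i < j → j ≤ m → q i ≠ q j := by
    intro i j hij hj heq
    by_cases hi0 : i = 0
    · subst hi0
      rw [h0] at heq
      by_cases hjm : j = m
      · rw [hjm, hm] at heq; exact hxy heq
      · exact hxD (heq ▸ hint j hij (by omega))
    by_cases hjm : j = m
    · rw [hjm, hm] at heq
      exact hyD (heq ▸ hint i (by omega) (by omega))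
    refine hmin (m - (j - i)) (by omega) ⟨by omega,
      fun k => if k ≤ i then q k else q (k + (j - i)), by simpa using h0, ?_, ?_, ?_⟩
    · dsimp only
      rw [if_neg (by omega), show m - (j - i) + (j - i) = m by omega, hm]
    · intro k hk0 hk
      dsimp only
      split_ifs
      · exact hint k hk0 (by omega)
      · exact hint _ (by omega) (by omega)
    · intro k hk
      dsimp only
      by_cases hki : k + 1 ≤ i
      · rw [if_pos (by omega), if_pos hki]
        exact hstep k (by omega)
      · by_cases hki' : k ≤ i
        · rw [if_pos hki', if_neg hki, show k = i by omega, heq,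
            show i + 1 + (j - i) = j + 1 by omega]
          exact hstep j (by omega)
        · rw [if_neg hki', if_neg hki, show k + 1 + (j - i) = k + (j - i) + 1 by omega]
          exact hstep _ (by omega)
  refine ⟨m, q, ⟨h2m, hint, ?_, hstep, ?_⟩, h0, hm⟩
  · intro i hi j hj heq
    rcases Nat.lt_trichotomy i j with h | h | h
    · exact absurd heq (hinj i j h hj)
    · exact h
    · exact absurd heq.symm (hinj j i h hi)
  · intro i hi j hj hij hadj
    by_contra hcon
    push Not at hcon
    exact shortcut i j hij hj hcon.1 (fun h => hcon.2 h.1 h.2) hadj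

theorem InducedPath.cycleOn {D : Set V} {m : ℕ} {q : ℕ → V} (h : InducedPath G D m q)
    (hadj : G.Adj (q 0) (q m)) : CycleOn G (m + 1) q (q '' Set.Iic m) := by
  refine ⟨fun i hi j hj => h.inj i (by omega) j (by omega), fun x => ?_, fun i hi j hj => ?_⟩
  · constructor
    · rintro ⟨i, hi, rfl⟩
      exact ⟨i, Nat.lt_succ_of_le hi, rfl⟩
    · rintro ⟨i, hi, rfl⟩
      exact ⟨i, Nat.le_of_lt_succ hi, rfl⟩
  · constructor
    · intro hij
      rcases Nat.lt_trichotomy i j with hlt | rfl | hlt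
      · have := h.induced i (by omega) j (by omega) hlt hij
        unfold CycNbr; omega
      · exact absurd hij (G.irrefl)
      · have := h.induced j (by omega) i (by omega) hlt hij.symm
        unfold CycNbr; omega
    · rintro (h' | h' | ⟨h1, h2⟩ | ⟨h1, h2⟩)
      · subst h'; exact h.step i (by omega)
      · subst h'; exact (h.step j (by omega)).symm
      · obtain rfl : j = m := by omega
        subst h1; exact hadj
      · obtain rfl : i = m := by omega
        subst h1; exact hadj.symm

theorem edgeTriangle_of_isChordal (hG : IsChordal G) : EdgeTriangle G := by
  intro x y hxy D hD hx hy hxD hyD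
  obtain ⟨m, q, hq, rfl, rfl⟩ := hD.exists_inducedPath hx hy hxy.ne hxD hyD
  have h2 := hq.two_le
  by_cases hm : m = 2
  · subst hm
    exact ⟨q 1, hq.interior 1 (by omega) (by omega), hq.step 0 (by omega),
      (hq.step 1 (by omega)).symm⟩
  · exact absurd ((nonempty_iso_cycGraph_iff (by omega)).2 ⟨q, hq.cycleOn hxy⟩)
      (hG _ (m + 1) (by omega))

theorem CycleOn.connSet_image_Icc {n : ℕ} {q : ℕ → V} {S : Set V} (h : CycleOn G n q S)
    {i j : ℕ} (hij : i ≤ j) (hj : j < n) : ConnSet G (q '' Set.Icc i j) :=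
  _root_.connSet_image_Icc hij fun k hk hkj =>
    (h.adj k (by omega) (k + 1) (by omega)).2 (Or.inl rfl)

theorem EdgeTriangle.isChordal (hG : EdgeTriangle G) : IsChordal G := by
  intro S n hn he
  obtain ⟨q, hq⟩ := (nonempty_iso_cycGraph_iff (by omega)).1 he
  have h01 : G.Adj (q 0) (q 1) := (hq.adj 0 (by omega) 1 (by omega)).2 (Or.inl rfl)
  obtain ⟨z, ⟨k, hk, rfl⟩, h1, h2⟩ := hG (q 0) (q 1) h01 (q '' Set.Icc 2 (n - 1))
    (hq.connSet_image_Icc (by omega) (by omega))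
    (by rintro ⟨k, hk, hk0⟩
        have := hq.inj k (by grind) 0 (by omega) hk0
        grind)
    (by rintro ⟨k, hk, hk0⟩
        have := hq.inj k (by grind) 1 (by omega) hk0
        grind)
    ⟨q (n - 1), ⟨n - 1, by grind, rfl⟩,
      (hq.adj 0 (by omega) (n - 1) (by omega)).2 (by unfold CycNbr; omega)⟩
    ⟨q 2, ⟨2, by grind, rfl⟩, (hq.adj 1 (by omega) 2 (by omega)).2 (Or.inl rfl)⟩
  have hk1 : 2 ≤ k := hk.1
  have hk2 : k ≤ n - 1 := hk.2
  have h3 := (hq.adj 0 (by omega) k (by omega)).1 h1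
  have h4 := (hq.adj 1 (by omega) k (by omega)).1 h2
  unfold CycNbr at h3 h4
  omega

end Cycles

/-- No triangle has all three edges in further triangles. -/
def NoRich {V : Type} (G : SimpleGraph V) : Prop :=
  ∀ a b c x y z, G.Adj a b → G.Adj b c → G.Adj a c → x ≠ c → G.Adj a x → G.Adj b x →
    y ≠ a → G.Adj b y → G.Adj c y → z ≠ b → G.Adj a z → G.Adj c z → False

section StronglyChordal

variable {V : Type} {G : SimpleGraph V}

theorem noFourClique_of_cliqueFree (h : G.CliqueFree 4) : NoFourClique G := by
  classical
  intro a b c d hab hac had hbc hbd hcd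
  refine h {a, b, c, d} ⟨?_, ?_⟩
  · simp [SimpleGraph.isClique_insert, hab, hac, had, hbc, hbd, hcd]
  · rw [Finset.card_insert_of_notMem, Finset.card_insert_of_notMem, Finset.card_pair hcd.ne] <;>
      simp [hab.ne, hac.ne, had.ne, hbc.ne, hbd.ne]

theorem NoFourClique.cliqueFree (h : NoFourClique G) : G.CliqueFree 4 := by
  rw [SimpleGraph.cliqueFree_iff]
  refine ⟨fun e => ?_⟩
  have key : ∀ i j : Fin 4, i ≠ j → G.Adj (e i) (e j) := fun i j hij =>
    e.toHom.map_adj ((SimpleGraph.top_adj i j).2 hij)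
  exact h _ _ _ _ (key 0 1 (by decide)) (key 0 2 (by decide)) (key 0 3 (by decide))
    (key 1 2 (by decide)) (key 1 3 (by decide)) (key 2 3 (by decide))

theorem IsStronglyChordal.noRich (hG : IsStronglyChordal G) (h4 : NoFourClique G) :
    NoRich G := by
  intro a b c x y z hab hbc hac hxc hax hbx hya hby hcy hzb haz hcz
  have hxy : x ≠ y := by rintro rfl; exact h4 a b c x hab hac hax hbc hbx hcy
  have hxz : x ≠ z := by rintro rfl; exact h4 a b c x hab hac hax hbc hbx hcz
  have hyz : y ≠ z := by rintro rfl; exact h4 a b c y hab hac haz hbc hby hcz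
  have hay : ¬ G.Adj a y := fun h => h4 a b c y hab hac h hbc hby hcy
  have hbz : ¬ G.Adj b z := fun h => h4 a b c z hab hac haz hbc h hcz
  have hcx : ¬ G.Adj c x := fun h => h4 a b c x hab hac hax hbc hbx h
  let f : Fin 6 → V := ![a, x, b, y, c, z]
  obtain ⟨i, d, hd, h3, hd3, hadj⟩ := hG.2 6 le_rfl (by decide) f
    (by
      change Function.Injective (f : Fin 6 → V)
      intro i j hij
      have := hab.ne; have := hbc.ne; have := hac.ne; have := hax.ne; have := hbx.ne
      have := hby.ne; have := hcy.ne; have := haz.ne; have := hcz.ne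
      fin_cases i <;> fin_cases j <;> simp [f] at hij ⊢ <;> grind)
    (by
      change ∀ i : Fin 6, G.Adj (f i) (f (i + 1))
      intro i
      fin_cases i
      exacts [hax, hbx.symm, hby, hcy.symm, hcz, haz.symm])
  obtain rfl : d = 3 := by omega
  have : ∀ i : Fin 6, ¬ G.Adj (f i) (f (i + 3)) := by
    intro i
    fin_cases i
    exacts [hay, fun h => hcx h.symm, hbz, fun h => hay h.symm, hcx, fun h => hbz h.symm]
  exact this i hadj

/-- A cyclic sequence of period `m` whose consecutive members are adjacent with a common
neighbour off the sequence yields a triangle with three rich edges. -/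
theorem EdgeTriangle.false_of_earedCycle (hG : EdgeTriangle G) (hR : NoRich G) {m : ℕ}
    (hm : 3 ≤ m) {h e : ℕ → V} (hinj : ∀ i j, i < j → j < m → h i ≠ h j) (hper : h m = h 0)
    (hadj : ∀ i, G.Adj (h i) (h (i + 1))) (he1 : ∀ i, G.Adj (h i) (e i))
    (he2 : ∀ i, G.Adj (h (i + 1)) (e i)) (hne : ∀ i j, e i ≠ h j) : False := by
  have hcl : G.Adj (h (m - 1)) (h 0) := by
    have := hadj (m - 1)
    rwa [show m - 1 + 1 = m by omega, hper] at this
  have arc : ∀ i j, i ≤ j → ConnSet G (h '' Set.Icc i j) := fun i j hij =>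
    connSet_image_Icc hij fun k _ _ => hadj k
  have nm : ∀ i j k, j < m → k < m → (k < i ∨ j < k) → h k ∉ h '' Set.Icc i j := by
    rintro i j k hj hk hor ⟨l, ⟨hl1, hl2⟩, hl⟩
    rcases Nat.lt_or_ge l k with hlk | hlk
    · exact hinj l k hlk hk hl
    · exact hinj k l (by omega) (by omega) hl.symm
  obtain ⟨_, ⟨k, ⟨hk2, hkm⟩, rfl⟩, h0k, h1k⟩ := hG (h 0) (h 1) (hadj 0) _
    (arc 2 (m - 1) (by omega)) (nm _ _ _ (by omega) (by omega) (by omega))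
    (nm _ _ _ (by omega) (by omega) (by omega))
    ⟨_, ⟨m - 1, ⟨by omega, le_rfl⟩, rfl⟩, hcl.symm⟩ ⟨_, ⟨2, ⟨le_rfl, by omega⟩, rfl⟩, hadj 1⟩
  have hy : ∃ y, y ≠ h 0 ∧ G.Adj (h 1) y ∧ G.Adj (h k) y := by
    by_cases hk : k = 2
    · subst hk
      exact ⟨e 1, hne _ _, he1 1, he2 1⟩
    · obtain ⟨_, ⟨j, ⟨hj1, hj2⟩, rfl⟩, h1, h2⟩ := hG (h 1) (h k) h1k _ (arc 2 (k - 1) (by omega))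
        (nm _ _ _ (by omega) (by omega) (by omega)) (nm _ _ _ (by omega) (by omega) (by omega))
        ⟨_, ⟨2, ⟨le_rfl, by omega⟩, rfl⟩, hadj 1⟩
        ⟨_, ⟨k - 1, ⟨by omega, le_rfl⟩, rfl⟩, by
          have := (hadj (k - 1)).symm
          rwa [show k - 1 + 1 = k by omega] at this⟩
      exact ⟨h j, (hinj 0 j (by omega) (by omega)).symm, h1, h2⟩
  have hz : ∃ z, z ≠ h 1 ∧ G.Adj (h 0) z ∧ G.Adj (h k) z := by
    by_cases hk : k = m - 1
    · subst hk
      have := he2 (m - 1)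
      rw [show m - 1 + 1 = m by omega, hper] at this
      exact ⟨e (m - 1), hne _ _, this, he1 _⟩
    · obtain ⟨_, ⟨j, ⟨hj1, hj2⟩, rfl⟩, h1, h2⟩ := hG (h 0) (h k) h0k _
        (arc (k + 1) (m - 1) (by omega))
        (nm _ _ _ (by omega) (by omega) (by omega)) (nm _ _ _ (by omega) (by omega) (by omega))
        ⟨_, ⟨m - 1, ⟨by omega, le_rfl⟩, rfl⟩, hcl.symm⟩
        ⟨_, ⟨k + 1, ⟨le_rfl, by omega⟩, rfl⟩, hadj k⟩
      exact ⟨h j, (hinj 1 j (by omega) (by omega)).symm, h1, h2⟩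
  obtain ⟨y, hy0, hy1, hy2⟩ := hy
  obtain ⟨z, hz0, hz1, hz2⟩ := hz
  exact hR (h 0) (h 1) (h k) (e 0) y z (hadj 0) h1k h0k (hne _ _) (he1 0) (he2 0) hy0 hy1 hy2
    hz0 hz1 hz2

theorem isStronglyChordal_of_edgeTriangle [Finite V] (hG : EdgeTriangle G) (h4 : NoFourClique G)
    (hR : NoRich G) : IsStronglyChordal G := by
  refine ⟨hG.isChordal, fun n hn hne f hf hadj => ?_⟩
  by_contra hcon
  push Not at hcon
  have hno : ∀ i d : ℕ, d % 2 = 1 → 3 ≤ d → d + 3 ≤ n →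
      ¬ G.Adj (f (i : ZMod n)) (f ((i + d : ℕ) : ZMod n)) := by
    intro i d h1 h2 h3
    have := hcon (i : ZMod n) d (Nat.odd_iff.2 h1) h2 h3
    push_cast
    exact this
  have hn2 : n % 2 = 0 := Nat.even_iff.1 hne
  obtain ⟨g, hg⟩ : ∃ g : ℕ → V, ∀ i : ℕ, g i = f (i : ZMod n) := ⟨fun i => f i, fun _ => rfl⟩
  simp only [← hg] at hno
  have per : ∀ i, g (i + n) = g i := by intro i; simp [hg]
  have gadj : ∀ i, G.Adj (g i) (g (i + 1)) := by
    intro i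
    rw [hg, hg]; push_cast; exact hadj _
  have ginj : ∀ i j, i < j → j < i + n → g i ≠ g j := by
    intro i j hij hj heq
    rw [hg, hg] at heq
    have h1 := (ZMod.natCast_eq_natCast_iff i j n).1 (hf heq)
    have h2 := (Nat.modEq_iff_dvd' hij.le).1 h1
    have := Nat.le_of_dvd (by omega) h2
    omega
  have arc : ∀ i j, i ≤ j → ConnSet G (g '' Set.Icc i j) := fun i j hij =>
    connSet_image_Icc hij fun k _ _ => gadj k
  have nm : ∀ i j k, k < i → j < k + n → g k ∉ g '' Set.Icc i j := by
    rintro i j k hki hj ⟨l, ⟨hl1, hl2⟩, hl⟩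
    exact ginj k l (by omega) (by omega) hl.symm
  have dich : ∀ i, G.Adj (g i) (g (i + 2)) ∨ G.Adj (g (i + 1)) (g (i + 3)) := by
    intro i
    obtain ⟨_, ⟨k, ⟨hk2, hkm⟩, rfl⟩, h1, h2⟩ := hG (g (i + 1)) (g (i + 2)) (gadj (i + 1)) _
      (arc (i + 3) (i + n) (by omega)) (nm _ _ _ (by omega) (by omega))
      (nm _ _ _ (by omega) (by omega))
      ⟨_, ⟨i + n, ⟨by omega, le_rfl⟩, rfl⟩, by rw [per]; exact (gadj i).symm⟩
      ⟨_, ⟨i + 3, ⟨le_rfl, by omega⟩, rfl⟩, gadj (i + 2)⟩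
    by_cases hk3 : k = i + 3
    · subst hk3; exact Or.inr h1
    by_cases hkn : k = i + n
    · subst hkn
      rw [per] at h2
      exact Or.inl h2.symm
    rcases Nat.mod_two_eq_zero_or_one (k - i) with hp | hp
    · refine absurd ?_ (hno (i + 1) (k - i - 1) (by omega) (by omega) (by omega))
      rwa [show i + 1 + (k - i - 1) = k by omega]
    · refine absurd ?_ (hno (i + 2) (k - i - 2) (by omega) (by omega) (by omega))
      rwa [show i + 2 + (k - i - 2) = k by omega]
  have notboth : ∀ i, G.Adj (g i) (g (i + 2)) → ¬ G.Adj (g (i + 1)) (g (i + 3)) := by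
    intro i h1 h2
    have hlast : G.Adj (g i) (g (i + n - 1)) := by
      have := gadj (i + n - 1)
      rw [show i + n - 1 + 1 = i + n by omega, per] at this
      exact this.symm
    let F : Fin 4 → Set V := ![{g i}, {g (i + 1)}, {g (i + 2)}, g '' Set.Icc (i + 3) (i + n - 1)]
    have t01 : Touch G (F 0) (F 1) := ⟨_, rfl, _, rfl, gadj i⟩
    have t02 : Touch G (F 0) (F 2) := ⟨_, rfl, _, rfl, h1⟩
    have t03 : Touch G (F 0) (F 3) := ⟨_, rfl, _, ⟨_, ⟨by omega, le_rfl⟩, rfl⟩, hlast⟩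
    have t12 : Touch G (F 1) (F 2) := ⟨_, rfl, _, rfl, gadj (i + 1)⟩
    have t13 : Touch G (F 1) (F 3) := ⟨_, rfl, _, ⟨_, ⟨le_rfl, by omega⟩, rfl⟩, h2⟩
    have t23 : Touch G (F 2) (F 3) := ⟨_, rfl, _, ⟨_, ⟨le_rfl, by omega⟩, rfl⟩, gadj (i + 2)⟩
    have d01 : Disjoint (F 0) (F 1) := Set.disjoint_singleton.2 (ginj _ _ (by omega) (by omega))
    have d02 : Disjoint (F 0) (F 2) := Set.disjoint_singleton.2 (ginj _ _ (by omega) (by omega))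
    have d12 : Disjoint (F 1) (F 2) := Set.disjoint_singleton.2 (ginj _ _ (by omega) (by omega))
    have d03 : Disjoint (F 0) (F 3) :=
      Set.disjoint_singleton_left.2 (nm _ _ _ (by omega) (by omega))
    have d13 : Disjoint (F 1) (F 3) :=
      Set.disjoint_singleton_left.2 (nm _ _ _ (by omega) (by omega))
    have d23 : Disjoint (F 2) (F 3) :=
      Set.disjoint_singleton_left.2 (nm _ _ _ (by omega) (by omega))
    refine hG.no_four_branch_sets h4 Set.univ F ?_ (fun _ => Set.subset_univ _) ?_ ?_
    · intro j
      fin_cases j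
      exacts [connSet_singleton _, connSet_singleton _, connSet_singleton _, arc _ _ (by omega)]
    · intro j k hjk
      fin_cases j <;> fin_cases k <;>
        first
        | exact absurd rfl hjk
        | assumption
        | exact Disjoint.symm ‹_›
    · intro j k hjk
      fin_cases j <;> fin_cases k <;>
        first
        | exact absurd rfl hjk
        | assumption
        | exact Touch.symm ‹_›
  obtain ⟨s, hs⟩ : ∃ s, ∀ i, G.Adj (g (s + 2 * i)) (g (s + 2 * i + 2)) := by
    have prop : ∀ i, G.Adj (g i) (g (i + 2)) → G.Adj (g (i + 2)) (g (i + 2 + 2)) := by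
      intro i hi
      have h1 := dich (i + 1)
      have h2 := notboth i hi
      rcases h1 with h1 | h1
      · exact absurd h1 h2
      · exact h1
    rcases dich 0 with h | h
    · refine ⟨0, fun i => ?_⟩
      induction i with
      | zero => exact h
      | succ i ih => exact prop _ ih
    · refine ⟨1, fun i => ?_⟩
      induction i with
      | zero => exact h
      | succ i ih => exact prop _ ih
  refine hG.false_of_earedCycle hR (m := n / 2) (by omega) (h := fun i => g (s + 2 * i))
    (e := fun i => g (s + 2 * i + 1)) (fun i j hij hj => ginj _ _ (by omega) (by omega)) ?_ hs
    (fun i => gadj _) (fun i => (gadj _).symm) (fun i j heq => ?_)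
  · rw [show s + 2 * (n / 2) = s + 2 * 0 + n by omega, per]
  · rw [hg, hg] at heq
    have h1 := (ZMod.natCast_eq_natCast_iff _ _ n).1 (hf heq)
    have h2 := Nat.ModEq.of_dvd (Nat.dvd_of_mod_eq_zero hn2) h1
    unfold Nat.ModEq at h2
    omega

end StronglyChordal

section TreewidthToMinors

variable {V : Type} {G : SimpleGraph V}

theorem isStronglyChordal_top : IsStronglyChordal (⊤ : SimpleGraph V) := by
  constructor
  · refine EdgeTriangle.isChordal fun x y _ D hD hx hy _ _ => ?_
    obtain ⟨d, hd⟩ := hD.nonempty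
    exact ⟨d, hd, fun h => hx (h ▸ hd), fun h => hy (h ▸ hd)⟩
  · intro n hn _ f hf _
    refine ⟨((0 : ℕ) : ZMod n), 3, by decide, le_rfl, by omega, ?_⟩
    rw [SimpleGraph.top_adj]
    intro h
    have h1 := hf h
    rw [← Nat.cast_add, zmod_natCast_inj (by omega) (by omega)] at h1
    omega

theorem sctw_le_two_iff [Finite V] : sctw G ≤ 2 ↔
    ∃ H : SimpleGraph V, G ≤ H ∧ EdgeTriangle H ∧ NoFourClique H ∧ NoRich H := by
  classical
  constructor
  · intro h
    have := Fintype.ofFinite V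
    have hne : {k | ∃ H : SimpleGraph V, G ≤ H ∧ IsStronglyChordal H ∧
        H.CliqueFree (k + 2)}.Nonempty :=
      ⟨Fintype.card V, ⊤, le_top, isStronglyChordal_top,
        SimpleGraph.cliqueFree_of_card_lt (by omega)⟩
    obtain ⟨H, hGH, hH, hf⟩ := Nat.sInf_mem hne
    have h4 := noFourClique_of_cliqueFree (hf.mono (Nat.add_le_add_right h 2))
    exact ⟨H, hGH, edgeTriangle_of_isChordal hH.1, h4, hH.noRich h4⟩
  · rintro ⟨H, hGH, h1, h2, h3⟩
    exact Nat.sInf_le ⟨H, hGH, isStronglyChordal_of_edgeTriangle h1 h2 h3, h2.cliqueFree⟩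

/-- A minor model, phrased with `ConnSet` and `Touch`. -/
theorem isMinorOf_iff {W : Type} {H : SimpleGraph W} : IsMinorOf H G ↔
    ∃ f : W → Set V, (∀ w, ConnSet G (f w)) ∧ (∀ w w', w ≠ w' → Disjoint (f w) (f w')) ∧
      ∀ w w', H.Adj w w' → Touch G (f w) (f w') := by
  constructor
  · rintro ⟨f, -, hc, hd, ha⟩
    exact ⟨f, fun w => connSet_iff.1 (hc w), fun w w' h => hd h, fun w w' h => ha h⟩
  · rintro ⟨f, hc, hd, ha⟩
    exact ⟨f, fun w => (hc w).nonempty, fun w => connSet_iff.2 (hc w), fun w w' h => hd w w' h,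
      fun w w' h => ha w w' h⟩

theorem IsMinorOf.mono {W : Type} {H : SimpleGraph W} {G' : SimpleGraph V} (hG : G ≤ G')
    (h : IsMinorOf H G) : IsMinorOf H G' := by
  rw [isMinorOf_iff] at h ⊢
  obtain ⟨f, hc, hd, ha⟩ := h
  refine ⟨f, fun w => (hc w).mono hG, hd, fun w w' h => ?_⟩
  obtain ⟨a, ha, b, hb, hab⟩ := ha w w' h
  exact ⟨a, ha, b, hb, hG hab⟩

theorem EdgeTriangle.not_isMinorOf_K4 [Finite V] (hG : EdgeTriangle G) (h4 : NoFourClique G) :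
    ¬ IsMinorOf K4 G := by
  intro h
  obtain ⟨f, hc, hd, ha⟩ := isMinorOf_iff.1 h
  exact hG.no_four_branch_sets h4 Set.univ f hc (fun _ => Set.subset_univ _) hd
    fun i j hij => ha i j hij

theorem EdgeTriangle.not_isMinorOf_S3 [Finite V] (hG : EdgeTriangle G) (h4 : NoFourClique G)
    (hR : NoRich G) : ¬ IsMinorOf S3 G := by
  intro h
  obtain ⟨f, hc, hd, ha⟩ := isMinorOf_iff.1 h
  have hadj : ∀ i j : Fin 6, S3.Adj i j → Touch G (f i) (f j) := ha
  let A : Fin 3 → Set V := ![f 1, f 3, f 5]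
  let E : Fin 3 → Set V := ![f 4, f 0, f 2]
  have hs : SunModel G ∅ Set.univ A E := by
    refine ⟨fun i => ?_, fun i => Set.subset_univ _, fun i => Set.subset_univ _,
      fun i j hij => ?_, fun i j => ?_, fun i j hij => ?_, fun i => ?_⟩
    · fin_cases i
      exacts [hc 1, hc 3, hc 5]
    · fin_cases i <;> fin_cases j <;> first | exact absurd rfl hij | exact hd _ _ (by decide)
    · fin_cases i <;> fin_cases j <;> exact hd _ _ (by decide)
    · fin_cases i <;> fin_cases j <;>
        first | exact absurd rfl hij | exact hadj _ _ (by simp [S3])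
    · right
      fin_cases i
      exacts [⟨hc 4, hadj 4 3 (by simp [S3]), hadj 4 5 (by simp [S3])⟩,
        ⟨hc 0, hadj 0 5 (by simp [S3]), hadj 0 1 (by simp [S3])⟩,
        ⟨hc 2, hadj 2 1 (by simp [S3]), hadj 2 3 (by simp [S3])⟩]
  obtain ⟨a, -, b, -, c, -, hab, hbc, hac, r1, r2, r3⟩ := hG.exists_rich_triangle h4 hs
  rcases r1 with r1 | ⟨x, -, hx, hx1, hx2⟩
  · exact r1
  rcases r2 with r2 | ⟨y, -, hy, hy1, hy2⟩
  · exact r2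
  rcases r3 with r3 | ⟨z, -, hz, hz1, hz2⟩
  · exact r3
  exact hR a b c x y z hab hbc hac hx hx1 hx2 hy hy1 hy2 hz hz1 hz2

theorem not_isMinorOf_of_sctw_le_two [Finite V] (h : sctw G ≤ 2) :
    ¬ IsMinorOf K4 G ∧ ¬ IsMinorOf S3 G := by
  obtain ⟨H, hGH, h1, h2, h3⟩ := sctw_le_two_iff.1 h
  exact ⟨fun hm => h1.not_isMinorOf_K4 h2 (hm.mono hGH),
    fun hm => h1.not_isMinorOf_S3 h2 h3 (hm.mono hGH)⟩

end TreewidthToMinors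

/-- The path `q 0, …, q m` is an ear whose interior is attached to `S₀` only at the adjacent
vertices `q 0` and `q m`. -/
structure IsEar {V : Type} (G : SimpleGraph V) (S₀ : Set V) (m : ℕ) (q : ℕ → V) : Prop where
  two_le : 2 ≤ m
  inj : ∀ i ≤ m, ∀ j ≤ m, q i = q j → i = j
  start : q 0 ∈ S₀
  last : q m ∈ S₀
  interior : ∀ i, 0 < i → i < m → q i ∉ S₀
  chord : G.Adj (q 0) (q m)
  step : ∀ i < m, G.Adj (q i) (q (i + 1))
  only : ∀ i, 0 < i → i < m → ∀ x ∈ S₀, G.Adj (q i) x →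
    (x = q 0 ∧ i = 1) ∨ (x = q m ∧ i + 1 = m)
  induced : ∀ i j, 0 < i → i < j → j < m → G.Adj (q i) (q j) → i + 1 = j

/-- Vertex sets obtained from an edge by successively adding ears along edges. -/
inductive ETree {V : Type} (G : SimpleGraph V) : Set V → Prop
  | edge (a b : V) (hab : G.Adj a b) : ETree G {a, b}
  | ear (S₀ : Set V) (m : ℕ) (q : ℕ → V) (h₀ : ETree G S₀) (hq : IsEar G S₀ m q) :
      ETree G (S₀ ∪ q '' Set.Iic m)

section ETree

variable {V W : Type} {G : SimpleGraph V} {H : SimpleGraph W}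

theorem IsEar.map (φ : G ↪g H) {S₀ : Set V} {m : ℕ} {q : ℕ → V} (h : IsEar G S₀ m q) :
    IsEar H (φ '' S₀) m (fun i => φ (q i)) where
  two_le := h.two_le
  inj i hi j hj hij := h.inj i hi j hj (φ.injective hij)
  start := ⟨_, h.start, rfl⟩
  last := ⟨_, h.last, rfl⟩
  interior i h0 hm := by
    rintro ⟨x, hx, hxi⟩
    exact h.interior i h0 hm (φ.injective hxi ▸ hx)
  chord := φ.map_adj_iff.2 h.chord
  step i hi := φ.map_adj_iff.2 (h.step i hi)
  only := by
    rintro i h0 hm _ ⟨x, hx, rfl⟩ hadj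
    rcases h.only i h0 hm x hx (φ.map_adj_iff.1 hadj) with ⟨rfl, hi⟩ | ⟨rfl, hi⟩
    exacts [Or.inl ⟨rfl, hi⟩, Or.inr ⟨rfl, hi⟩]
  induced i j h0 hij hm hadj := h.induced i j h0 hij hm (φ.map_adj_iff.1 hadj)

theorem ETree.map (φ : G ↪g H) {S : Set V} (h : ETree G S) : ETree H (φ '' S) := by
  induction h with
  | edge a b hab =>
    rw [Set.image_pair]
    exact ETree.edge _ _ (φ.map_adj_iff.2 hab)
  | ear S₀ m q _ hq ih =>
    rw [Set.image_union, Set.image_image]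
    exact ETree.ear _ m _ ih (hq.map φ)

theorem IsEar.cycleOn {S₀ : Set V} {m : ℕ} {q : ℕ → V} (h : IsEar G S₀ m q) :
    CycleOn G (m + 1) q (q '' Set.Iic m) := by
  have h2 := h.two_le
  refine InducedPath.cycleOn (D := S₀ᶜ) ⟨h.two_le, h.interior, h.inj, h.step, ?_⟩ h.chord
  intro i hi j hj hij hadj
  by_cases h0 : i = 0
  · subst h0
    by_cases hm : j = m
    · omega
    rcases h.only j hij (by omega) _ h.start hadj.symm with h1 | h1
    · omega
    · have := h.inj _ (by omega) _ le_rfl h1.1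
      omega
  · by_cases hm : j = m
    · subst hm
      rcases h.only i (by omega) hij _ h.last hadj with h1 | h1
      · have := h.inj _ le_rfl _ (by omega) h1.1
        omega
      · omega
    · exact Or.inl (h.induced i j (by omega) hij (by omega) hadj)

theorem CycleOn.isEar {n : ℕ} (hn : 3 ≤ n) {q : ℕ → V} {S : Set V} (h : CycleOn G n q S) :
    IsEar G {q 0, q (n - 1)} (n - 1) q where
  two_le := by omega
  inj i hi j hj := h.inj i (by omega) j (by omega)
  start := Or.inl rfl
  last := Or.inr rfl
  interior i h0 hi := by
    rintro (hq | hq)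
    · have := h.inj i (by omega) 0 (by omega) hq
      omega
    · have := h.inj i (by omega) (n - 1) (by omega) hq
      omega
  chord := (h.adj 0 (by omega) (n - 1) (by omega)).2 (by unfold CycNbr; omega)
  step i hi := (h.adj i (by omega) (i + 1) (by omega)).2 (Or.inl rfl)
  only i h0 hi x hx hadj := by
    rcases hx with rfl | rfl
    · have := (h.adj i (by omega) 0 (by omega)).1 hadj
      unfold CycNbr at this
      exact Or.inl ⟨rfl, by omega⟩
    · have := (h.adj i (by omega) (n - 1) (by omega)).1 hadj
      unfold CycNbr at this
      exact Or.inr ⟨rfl, by omega⟩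
  induced i j h0 hij hj hadj := by
    have := (h.adj i (by omega) j (by omega)).1 hadj
    unfold CycNbr at this
    omega

theorem CycleOn.eTree {n : ℕ} (hn : 3 ≤ n) {q : ℕ → V} {S : Set V} (h : CycleOn G n q S) :
    ETree G S := by
  have he := h.isEar hn
  have : S = {q 0, q (n - 1)} ∪ q '' Set.Iic (n - 1) := by
    ext x
    rw [h.range]
    constructor
    · rintro ⟨i, hi, rfl⟩
      exact Or.inr ⟨i, Nat.le_sub_one_of_lt hi, rfl⟩
    · rintro ((rfl | rfl) | ⟨i, hi, rfl⟩)
      · exact ⟨0, by omega, rfl⟩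
      · exact ⟨n - 1, by omega, rfl⟩
      · exact ⟨i, by have : i ≤ n - 1 := hi
                     omega, rfl⟩
  rw [this]
  exact ETree.ear _ _ _ (ETree.edge _ _ he.chord) he

theorem glueCycle_adj_inl_inl {n : ℕ} {a b u v : V} :
    (glueCycle G n a b).Adj (Sum.inl u) (Sum.inl v) ↔ G.Adj u v := by
  rw [glueCycle, SimpleGraph.fromRel_adj]
  constructor
  · rintro ⟨-, h | h⟩
    exacts [h, h.symm]
  · intro h
    exact ⟨fun h' => h.ne (Sum.inl.inj h'), Or.inl h⟩

theorem glueCycle_adj_inl_inr {n : ℕ} {a b u : V} {x : {x : ZMod n // x ≠ 0 ∧ x ≠ 1}} :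
    (glueCycle G n a b).Adj (Sum.inl u) (Sum.inr x) ↔
      (u = a ∧ (cycGraph n).Adj 0 x.1) ∨ (u = b ∧ (cycGraph n).Adj 1 x.1) := by
  rw [glueCycle, SimpleGraph.fromRel_adj]
  simp

theorem glueCycle_adj_inr_inr {n : ℕ} {a b : V} {x y : {x : ZMod n // x ≠ 0 ∧ x ≠ 1}} :
    (glueCycle G n a b).Adj (Sum.inr x) (Sum.inr y) ↔ (cycGraph n).Adj x.1 y.1 := by
  rw [glueCycle, SimpleGraph.fromRel_adj]
  constructor
  · rintro ⟨-, h | h⟩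
    exacts [h, h.symm]
  · intro h
    exact ⟨fun h' => h.ne (congrArg Subtype.val (Sum.inr.inj h')), Or.inl h⟩

theorem zmod_natCast_add_one_ne {n i : ℕ} (h0 : 0 < i) (hi : i < n - 1) :
    ((i + 1 : ℕ) : ZMod n) ≠ 0 ∧ ((i + 1 : ℕ) : ZMod n) ≠ 1 := by
  constructor
  · intro h
    rw [← Nat.cast_zero, zmod_natCast_inj (by omega) (by omega)] at h
    omega
  · intro h
    have h' : ((i + 1 : ℕ) : ZMod n) = ((1 : ℕ) : ZMod n) := by rw [h, Nat.cast_one]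
    rw [zmod_natCast_inj (by omega) (by omega)] at h'
    omega

theorem exists_natCast_add_one {n : ℕ} (hn : 3 ≤ n) {x : ZMod n} (h0 : x ≠ 0) (h1 : x ≠ 1) :
    ∃ i, 0 < i ∧ i < n - 1 ∧ ((i + 1 : ℕ) : ZMod n) = x := by
  have : NeZero n := ⟨by omega⟩
  have hlt := ZMod.val_lt x
  have e : ((x.val : ℕ) : ZMod n) = x := by simp
  have v0 : x.val ≠ 0 := fun h => h0 (by rw [← e, h]; simp)
  have v1 : x.val ≠ 1 := fun h => h1 (by rw [← e, h]; simp)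
  exact ⟨x.val - 1, by omega, by omega, by rw [show x.val - 1 + 1 = x.val by omega, e]⟩

/-- The ear of the glued cycle, from `b` to `a`. -/
def gluedPath (n : ℕ) (a b : V) (i : ℕ) : V ⊕ {x : ZMod n // x ≠ 0 ∧ x ≠ 1} :=
  if h : 0 < i ∧ i < n - 1 then Sum.inr ⟨((i + 1 : ℕ) : ZMod n), zmod_natCast_add_one_ne h.1 h.2⟩
  else if i = 0 then Sum.inl b else Sum.inl a

theorem cycGraph_adj_zero {n i : ℕ} (hn : 3 ≤ n) (h0 : 0 < i) (hi : i < n - 1) :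
    (cycGraph n).Adj 0 ((i + 1 : ℕ) : ZMod n) ↔ i + 2 = n := by
  rw [← Nat.cast_zero, cycGraph_adj_natCast hn (by omega) (by omega), CycNbr]
  omega

theorem cycGraph_adj_one {n i : ℕ} (hn : 3 ≤ n) (h0 : 0 < i) (hi : i < n - 1) :
    (cycGraph n).Adj 1 ((i + 1 : ℕ) : ZMod n) ↔ i = 1 := by
  rw [← Nat.cast_one, cycGraph_adj_natCast hn (by omega) (by omega), CycNbr]
  omega

theorem gluedPath_isEar {n : ℕ} (hn : 3 ≤ n) {a b : V} (hab : G.Adj a b) :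
    IsEar (glueCycle G n a b) (Set.range Sum.inl) (n - 1) (gluedPath n a b) := by
  have p0 : gluedPath n a b 0 = Sum.inl b := by simp [gluedPath]
  have pl : gluedPath n a b (n - 1) = Sum.inl a := by
    unfold gluedPath
    rw [dif_neg (by omega), if_neg (by omega)]
  have pi : ∀ i (h0 : 0 < i) (hi : i < n - 1), gluedPath n a b i =
      Sum.inr ⟨((i + 1 : ℕ) : ZMod n), zmod_natCast_add_one_ne h0 hi⟩ := by
    intro i h0 hi
    unfold gluedPath
    rw [dif_pos ⟨h0, hi⟩]
  have hcases : ∀ i ≤ n - 1, i = 0 ∨ i = n - 1 ∨ (0 < i ∧ i < n - 1) := by omega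
  refine ⟨by omega, ?_, ?_, ?_, ?_, ?_, ?_, ?_, ?_⟩
  · intro i hi j hj hij
    rcases hcases i hi with rfl | rfl | ⟨h1, h2⟩ <;>
      rcases hcases j hj with rfl | rfl | ⟨h3, h4⟩
    · rfl
    · rw [p0, pl] at hij
      exact absurd (Sum.inl.inj hij) hab.ne'
    · rw [p0, pi j h3 h4] at hij
      cases hij
    · rw [p0, pl] at hij
      exact absurd (Sum.inl.inj hij) hab.ne
    · rfl
    · rw [pl, pi j h3 h4] at hij
      cases hij
    · rw [p0, pi i h1 h2] at hij
      cases hij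
    · rw [pl, pi i h1 h2] at hij
      cases hij
    · rw [pi i h1 h2, pi j h3 h4] at hij
      have := congrArg Subtype.val (Sum.inr.inj hij)
      rw [zmod_natCast_inj (by omega) (by omega)] at this
      omega
  · exact ⟨b, p0.symm⟩
  · exact ⟨a, pl.symm⟩
  · rintro i h0 hi ⟨x, hx⟩
    rw [pi i h0 hi] at hx
    cases hx
  · rw [p0, pl, glueCycle_adj_inl_inl]
    exact hab.symm
  · intro i hi
    rcases hcases i (by omega) with rfl | rfl | ⟨h1, h2⟩
    · rw [p0, pi 1 (by omega) (by omega), glueCycle_adj_inl_inr]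
      exact Or.inr ⟨rfl, (cycGraph_adj_one hn (by omega) (by omega)).2 rfl⟩
    · omega
    · by_cases h3 : i + 1 = n - 1
      · rw [h3, pl, pi i h1 h2, SimpleGraph.adj_comm, glueCycle_adj_inl_inr]
        exact Or.inl ⟨rfl, (cycGraph_adj_zero hn (by omega) (by omega)).2 (by omega)⟩
      · rw [pi i h1 h2, pi (i + 1) (by omega) (by omega), glueCycle_adj_inr_inr,
          cycGraph_adj_natCast hn (by omega) (by omega)]
        exact Or.inl rfl
  · rintro i h0 hi _ ⟨x, rfl⟩ hadj
    rw [pi i h0 hi, SimpleGraph.adj_comm, glueCycle_adj_inl_inr] at hadj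
    rcases hadj with ⟨rfl, h⟩ | ⟨rfl, h⟩
    · rw [cycGraph_adj_zero hn h0 hi] at h
      exact Or.inr ⟨pl.symm, by omega⟩
    · rw [cycGraph_adj_one hn h0 hi] at h
      exact Or.inl ⟨p0.symm, h⟩
  · intro i j h0 hij hj hadj
    rw [pi i h0 (by omega), pi j (by omega) hj, glueCycle_adj_inr_inr,
      cycGraph_adj_natCast hn (by omega) (by omega), CycNbr] at hadj
    omega

theorem IsTreeOfCycles.eTree (h : IsTreeOfCycles G) : ETree G Set.univ := by
  induction h with
  | cycle G n hn e =>
    obtain ⟨e⟩ := e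
    obtain ⟨q, hq⟩ := (nonempty_iso_cycGraph_iff (G := G) hn).1 ⟨(SimpleGraph.induceUnivIso G).trans e⟩
    exact hq.eTree hn
  | glue G hG n hn a b hab H e ih =>
    obtain ⟨e⟩ := e
    let ι : G ↪g glueCycle G n a b :=
      ⟨⟨Sum.inl, Sum.inl_injective⟩, by intro u v; exact glueCycle_adj_inl_inl⟩
    have h1 : ETree (glueCycle G n a b) (Set.range Sum.inl) := by
      have := ih.map ι
      rwa [Set.image_univ] at this
    have h2 := (ETree.ear _ _ _ h1 (gluedPath_isEar hn hab)).map e.symm.toEmbedding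
    convert h2
    symm
    rw [Set.eq_univ_iff_forall]
    intro w
    refine ⟨e w, ?_, by simp⟩
    rcases hw : e w with u | ⟨x, h0, h1⟩
    · exact Or.inl ⟨u, rfl⟩
    · right
      obtain ⟨i, hi0, hi, rfl⟩ := exists_natCast_add_one hn h0 h1
      exact ⟨i, hi.le, by unfold gluedPath; rw [dif_pos ⟨hi0, hi⟩]⟩

theorem IsEar.nonempty_iso_glueCycle {S₀ : Set V} {m : ℕ} {q : ℕ → V} (h : IsEar G S₀ m q) :
    Nonempty ((G.induce (S₀ ∪ q '' Set.Iic m)) ≃g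
      glueCycle (G.induce S₀) (m + 1) ⟨q m, h.last⟩ ⟨q 0, h.start⟩) := by
  have hm := h.two_le
  have hn : 3 ≤ m + 1 := by omega
  let f : S₀ ⊕ {x : ZMod (m + 1) // x ≠ 0 ∧ x ≠ 1} → (S₀ ∪ q '' Set.Iic m : Set V) := fun p =>
    match p with
    | Sum.inl u => ⟨u.1, Or.inl u.2⟩
    | Sum.inr x => ⟨q (x.1.val - 1), Or.inr ⟨_, by
        have := ZMod.val_lt x.1
        change _ ≤ m
        omega, rfl⟩⟩
  have fr : ∀ i (hx : ((i + 1 : ℕ) : ZMod (m + 1)) ≠ 0 ∧ ((i + 1 : ℕ) : ZMod (m + 1)) ≠ 1),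
      i < m → (f (Sum.inr ⟨_, hx⟩)).1 = q i := by
    intro i hx hi
    change q (((i + 1 : ℕ) : ZMod (m + 1)).val - 1) = q i
    rw [ZMod.val_natCast, Nat.mod_eq_of_lt (by omega), Nat.add_sub_cancel]
  have fl : ∀ u, (f (Sum.inl u)).1 = u.1 := fun _ => rfl
  have hinj : Function.Injective f := by
    rintro (u | ⟨x, hx⟩) (v | ⟨y, hy⟩) huv
    · rw [Subtype.ext_iff, fl, fl] at huv
      rw [Subtype.ext huv]
    · obtain ⟨i, h0, hi, rfl⟩ := exists_natCast_add_one hn hy.1 hy.2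
      rw [Subtype.ext_iff, fl, fr i hy (by omega)] at huv
      exact absurd (huv ▸ u.2) (h.interior i h0 (by omega))
    · obtain ⟨i, h0, hi, rfl⟩ := exists_natCast_add_one hn hx.1 hx.2
      rw [Subtype.ext_iff, fl, fr i hx (by omega)] at huv
      exact absurd (huv ▸ v.2) (h.interior i h0 (by omega))
    · obtain ⟨i, h0, hi, rfl⟩ := exists_natCast_add_one hn hx.1 hx.2
      obtain ⟨j, h0', hj, rfl⟩ := exists_natCast_add_one hn hy.1 hy.2
      rw [Subtype.ext_iff, fr i hx (by omega), fr j hy (by omega)] at huv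
      obtain rfl := h.inj i (by omega) j (by omega) huv
      rfl
  have hsurj : Function.Surjective f := by
    rintro ⟨x, hx⟩
    by_cases hx0 : x ∈ S₀
    · exact ⟨Sum.inl ⟨x, hx0⟩, rfl⟩
    · obtain ⟨i, hi, rfl⟩ := hx.resolve_left hx0
      have hi' : i ≤ m := hi
      have i0 : i ≠ 0 := by rintro rfl; exact hx0 h.start
      have im : i ≠ m := by rintro rfl; exact hx0 h.last
      exact ⟨Sum.inr ⟨_, zmod_natCast_add_one_ne (n := m + 1) (i := i) (by omega) (by omega)⟩,
        Subtype.ext (fr i _ (by omega))⟩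
  have hlr : ∀ (u : S₀) i (hx : ((i + 1 : ℕ) : ZMod (m + 1)) ≠ 0 ∧ ((i + 1 : ℕ) : ZMod (m + 1)) ≠ 1),
      0 < i → i < m → (G.Adj u.1 (q i) ↔ (glueCycle (G.induce S₀) (m + 1) ⟨q m, h.last⟩
        ⟨q 0, h.start⟩).Adj (Sum.inl u) (Sum.inr ⟨_, hx⟩)) := by
    intro u i hx h0 hi
    rw [glueCycle_adj_inl_inr, cycGraph_adj_zero hn h0 (by omega),
      cycGraph_adj_one hn h0 (by omega)]
    constructor
    · intro hadj
      rcases h.only i h0 hi u.1 u.2 hadj.symm with ⟨h1, h2⟩ | ⟨h1, h2⟩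
      · exact Or.inr ⟨Subtype.ext h1, h2⟩
      · exact Or.inl ⟨Subtype.ext h1, by omega⟩
    · rintro (⟨rfl, h2⟩ | ⟨rfl, rfl⟩)
      · have := (h.step i hi).symm
        rwa [show i + 1 = m by omega] at this
      · exact h.step 0 (by omega)
  refine ⟨(RelIso.mk (Equiv.ofBijective f ⟨hinj, hsurj⟩) ?_).symm⟩
  intro p p'
  change G.Adj (f p).1 (f p').1 ↔ _
  rcases p with u | ⟨x, hx⟩ <;> rcases p' with v | ⟨y, hy⟩
  · rw [glueCycle_adj_inl_inl]; rfl
  · obtain ⟨i, h0, hi, rfl⟩ := exists_natCast_add_one hn hy.1 hy.2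
    rw [fr i hy (by omega), fl]
    exact hlr u i hy h0 (by omega)
  · obtain ⟨i, h0, hi, rfl⟩ := exists_natCast_add_one hn hx.1 hx.2
    rw [fr i hx (by omega), fl, SimpleGraph.adj_comm, SimpleGraph.adj_comm _ (Sum.inr _)]
    exact hlr v i hx h0 (by omega)
  · obtain ⟨i, h0, hi, rfl⟩ := exists_natCast_add_one hn hx.1 hx.2
    obtain ⟨j, h0', hj, rfl⟩ := exists_natCast_add_one hn hy.1 hy.2
    rw [fr i hx (by omega), fr j hy (by omega), glueCycle_adj_inr_inr,
      cycGraph_adj_natCast hn (by omega) (by omega), h.cycleOn.adj i (by omega) j (by omega)]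
    unfold CycNbr
    omega

theorem ETree.isTreeOfCycles {S : Set V} (h : ETree G S) :
    (∃ a b, G.Adj a b ∧ S = {a, b}) ∨ IsTreeOfCycles (G.induce S) := by
  induction h with
  | edge a b hab => exact Or.inl ⟨a, b, hab, rfl⟩
  | ear S₀ m q _ hq ih =>
    have hm := hq.two_le
    right
    rcases ih with ⟨a, b, hab, rfl⟩ | ih
    · have hsub : ({a, b} : Set V) ⊆ q '' Set.Iic m := by
        have hne : q 0 ≠ q m := hq.chord.ne
        have m0 : q 0 ∈ q '' Set.Iic m := ⟨0, Nat.zero_le _, rfl⟩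
        have mm : q m ∈ q '' Set.Iic m := ⟨m, Set.self_mem_Iic, rfl⟩
        rcases hq.start with h0 | h0 <;> rcases hq.last with h1 | h1
        · exact absurd (h0.trans h1.symm) hne
        · rintro x (rfl | rfl)
          exacts [h0 ▸ m0, h1 ▸ mm]
        · rintro x (rfl | rfl)
          exacts [h1 ▸ mm, h0 ▸ m0]
        · exact absurd (h0.trans h1.symm) hne
      rw [Set.union_eq_self_of_subset_left hsub]
      exact IsTreeOfCycles.cycle _ (m + 1) (by omega)
        ((nonempty_iso_cycGraph_iff (by omega)).2 ⟨q, hq.cycleOn⟩)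
    · exact IsTreeOfCycles.glue _ ih (m + 1) (by omega) ⟨q m, hq.last⟩ ⟨q 0, hq.start⟩
        hq.chord.symm _
        hq.nonempty_iso_glueCycle

end ETree

/-- The edge `a b` is unmarked and its only triangle is the one with `c`. -/
def PoorEdge {V : Type} (H : SimpleGraph V) (M : Set (Sym2 V)) (a b c : V) : Prop :=
  s(a, b) ∉ M ∧ ∀ z, H.Adj a z → H.Adj b z → z = c

/-- A chordal graph without `K₄` in which every triangle has an unmarked edge that lies in no
other triangle. -/
structure GoodMarked {V : Type} (H : SimpleGraph V) (M : Set (Sym2 V)) : Prop where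
  edgeTriangle : EdgeTriangle H
  noFourClique : NoFourClique H
  poor : ∀ a b c, H.Adj a b → H.Adj b c → H.Adj c a →
    PoorEdge H M a b c ∨ PoorEdge H M b c a ∨ PoorEdge H M c a b

section GoodMarked

variable {V : Type} {H : SimpleGraph V} {M : Set (Sym2 V)}

theorem PoorEdge.swap {a b c : V} (h : PoorEdge H M a b c) : PoorEdge H M b a c :=
  ⟨by rw [Sym2.eq_swap]; exact h.1, fun z h1 h2 => h.2 z h2 h1⟩

theorem GoodMarked.anti {M' : Set (Sym2 V)} (h : GoodMarked H M) (hM : M' ⊆ M) :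
    GoodMarked H M' where
  edgeTriangle := h.edgeTriangle
  noFourClique := h.noFourClique
  poor a b c h1 h2 h3 := by
    rcases h.poor a b c h1 h2 h3 with h | h | h
    exacts [Or.inl ⟨fun h' => h.1 (hM h'), h.2⟩, Or.inr (Or.inl ⟨fun h' => h.1 (hM h'), h.2⟩),
      Or.inr (Or.inr ⟨fun h' => h.1 (hM h'), h.2⟩)]

theorem GoodMarked.noRich (h : GoodMarked H M) : NoRich H := by
  intro a b c x y z hab hbc hac hx hx1 hx2 hy hy1 hy2 hz hz1 hz2
  rcases h.poor a b c hab hbc hac.symm with h | h | h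
  exacts [hx (h.2 x hx1 hx2), hy (h.2 y hy1 hy2), hz (h.2 z hz2 hz1)]

/-- Attach the vertex `v` to `p` and `q`. -/
def addApex (H : SimpleGraph V) (v p q : V) : SimpleGraph V :=
  SimpleGraph.fromRel fun x y => H.Adj x y ∨ (x = v ∧ (y = p ∨ y = q))

theorem addApex_adj {v p q x y : V} (hp : v ≠ p) (hq : v ≠ q) : (addApex H v p q).Adj x y ↔
    H.Adj x y ∨ (x = v ∧ (y = p ∨ y = q)) ∨ (y = v ∧ (x = p ∨ x = q)) := by
  rw [addApex, SimpleGraph.fromRel_adj]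
  constructor
  · rintro ⟨-, (h | h) | (h | h)⟩
    exacts [Or.inl h, Or.inr (Or.inl h), Or.inl h.symm, Or.inr (Or.inr h)]
  · rintro (h | h | h)
    · exact ⟨h.ne, Or.inl (Or.inl h)⟩
    · exact ⟨by grind, Or.inl (Or.inr h)⟩
    · exact ⟨by grind, Or.inr (Or.inr h)⟩

theorem EdgeTriangle.addApex (hH : EdgeTriangle H) {v p q : V} (hv : ∀ x, ¬ H.Adj v x)
    (hpq : H.Adj p q) : EdgeTriangle (addApex H v p q) := by
  have hvp : v ≠ p := by rintro rfl; exact hv _ hpq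
  have hvq : v ≠ q := by rintro rfl; exact hv _ hpq.symm
  have hadj : ∀ x y, (_root_.addApex H v p q).Adj x y ↔ _ := fun x y => addApex_adj hvp hvq
  have hvadj : ∀ x, (_root_.addApex H v p q).Adj v x → x = p ∨ x = q := by
    intro x hx
    rcases (hadj v x).1 hx with h | h | h
    · exact absurd h (hv x)
    · exact h.2
    · grind
  have hpq' : (_root_.addApex H v p q).Adj p q := (hadj p q).2 (Or.inl hpq)
  have old : ∀ x y, x ≠ v → y ≠ v → (_root_.addApex H v p q).Adj x y → H.Adj x y := by
    intro x y hx hy h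
    rcases (hadj x y).1 h with h | h | h
    exacts [h, absurd h.1 hx, absurd h.1 hy]
  have edgeAtV : ∀ y, (_root_.addApex H v p q).Adj v y → ∀ D : Set V, y ∉ D →
      (∃ d ∈ D, (_root_.addApex H v p q).Adj v d) →
      ∃ z ∈ D, (_root_.addApex H v p q).Adj v z ∧ (_root_.addApex H v p q).Adj y z := by
    rintro y hy D hyD ⟨d, hd, hvd⟩
    refine ⟨d, hd, hvd, ?_⟩
    rcases hvadj y hy with rfl | rfl <;> rcases hvadj d hvd with rfl | rfl
    exacts [absurd hd hyD, hpq', hpq'.symm, absurd hd hyD]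
  have hsimp : SimplicialIn (_root_.addApex H v p q) Set.univ v := by
    intro a _ b _ ha hb hab
    rcases hvadj a ha with rfl | rfl <;> rcases hvadj b hb with rfl | rfl
    exacts [absurd rfl hab, hpq', hpq'.symm, absurd rfl hab]
  intro x y hxy D hD hx hy hxD hyD
  by_cases hxv : x = v
  · subst hxv
    exact edgeAtV y hxy D hy hxD
  by_cases hyv : y = v
  · subst hyv
    obtain ⟨z, hz, h1, h2⟩ := edgeAtV x hxy.symm D hx hyD
    exact ⟨z, hz, h2, h1⟩
  by_cases hDv : D = {v}
  · subst hDv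
    obtain ⟨d, rfl, hd⟩ := hxD
    obtain ⟨e, rfl, he⟩ := hyD
    exact ⟨e, rfl, hd, he⟩
  have hD' : ConnSet H (D \ {v}) := by
    refine connSet_congr (fun a ha b hb hab => old a b ha.2 hb.2 hab)
      (hD.diff_simplicialIn (Set.subset_univ D) hsimp hDv)
  have move : ∀ x, x ≠ v → x ∉ D → (∃ d ∈ D, (_root_.addApex H v p q).Adj x d) →
      ∃ d ∈ D \ {v}, H.Adj x d := by
    rintro x hxv hx ⟨d, hd, hxd⟩
    by_cases hdv : d = v
    · subst hdv
      obtain ⟨u, hu, hux, -⟩ := hD.exists_simplicialIn_replacement (Set.subset_univ D) hsimp hDv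
        hd hx (Set.mem_univ x) hxd.symm
      exact ⟨u, hu, old _ _ hxv hu.2 hux.symm⟩
    · exact ⟨d, ⟨hd, hdv⟩, old _ _ hxv hdv hxd⟩
  obtain ⟨z, hz, h1, h2⟩ := hH x y (old x y hxv hyv hxy) _ hD' (fun h => hx h.1)
    (fun h => hy h.1) (move x hxv hx hxD) (move y hyv hy hyD)
  exact ⟨z, hz.1, (hadj _ _).2 (Or.inl h1), (hadj _ _).2 (Or.inl h2)⟩

theorem GoodMarked.addApex {v p q : V} (hH : GoodMarked H (M ∪ {s(p, q)}))
    (hv : ∀ x, ¬ H.Adj v x) (hpq : H.Adj p q) {M' : Set (Sym2 V)}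
    (hM' : ∀ a b, a ≠ v → b ≠ v → s(a, b) ∈ M' → s(a, b) ∈ M ∪ {s(p, q)})
    (hpoor : s(v, p) ∉ M' ∨ s(v, q) ∉ M' ∨
      (s(p, q) ∉ M' ∧ ∀ z, H.Adj p z → H.Adj q z → False)) :
    GoodMarked (addApex H v p q) M' := by
  have hvp : v ≠ p := by rintro rfl; exact hv _ hpq
  have hvq : v ≠ q := by rintro rfl; exact hv _ hpq.symm
  have hadj : ∀ x y, (_root_.addApex H v p q).Adj x y ↔ _ := fun x y => addApex_adj hvp hvq
  have hvadj : ∀ x, (_root_.addApex H v p q).Adj v x → x = p ∨ x = q := by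
    intro x hx
    rcases (hadj v x).1 hx with h | h | h
    · exact absurd h (hv x)
    · exact h.2
    · grind
  have old : ∀ x y, x ≠ v → y ≠ v → (_root_.addApex H v p q).Adj x y → H.Adj x y := by
    intro x y hx hy h
    rcases (hadj x y).1 h with h | h | h
    exacts [h, absurd h.1 hx, absurd h.1 hy]
  have noK4v : ∀ a b c, (_root_.addApex H v p q).Adj v a → (_root_.addApex H v p q).Adj v b →
      (_root_.addApex H v p q).Adj v c → a ≠ b → a ≠ c → b ≠ c → False := by
    intro a b c ha hb hc hab hac hbc
    have := hvadj a ha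
    have := hvadj b hb
    have := hvadj c hc
    grind
  refine ⟨hH.edgeTriangle.addApex hv hpq, ?_, ?_⟩
  · intro a b c d hab hac had hbc hbd hcd
    by_cases hav : a = v
    · subst hav; exact noK4v b c d hab hac had hbc.ne hbd.ne hcd.ne
    by_cases hbv : b = v
    · subst hbv; exact noK4v a c d hab.symm hbc hbd hac.ne had.ne hcd.ne
    by_cases hcv : c = v
    · subst hcv; exact noK4v a b d hac.symm hbc.symm hcd hab.ne had.ne hbd.ne
    by_cases hdv : d = v
    · subst hdv; exact noK4v a b c had.symm hbd.symm hcd.symm hab.ne hac.ne hbc.ne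
    exact hH.noFourClique a b c d (old _ _ hav hbv hab) (old _ _ hav hcv hac)
      (old _ _ hav hdv had) (old _ _ hbv hcv hbc) (old _ _ hbv hdv hbd) (old _ _ hcv hdv hcd)
  · have core : PoorEdge (_root_.addApex H v p q) M' v p q ∨
        PoorEdge (_root_.addApex H v p q) M' p q v ∨
        PoorEdge (_root_.addApex H v p q) M' q v p := by
      rcases hpoor with h | h | ⟨h, h'⟩
      · exact Or.inl ⟨h, fun z h1 h2 => (hvadj z h1).resolve_left h2.ne'⟩
      · exact Or.inr (Or.inr (PoorEdge.swap
          ⟨h, fun z h1 h2 => (hvadj z h1).resolve_right h2.ne'⟩))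
      · refine Or.inr (Or.inl ⟨h, fun z h1 h2 => ?_⟩)
        by_contra hzv
        exact h' z (old _ _ hvp.symm hzv h1) (old _ _ hvq.symm hzv h2)
    have core' : ∀ b c, (_root_.addApex H v p q).Adj v b → (_root_.addApex H v p q).Adj b c →
        (_root_.addApex H v p q).Adj c v → PoorEdge (_root_.addApex H v p q) M' v b c ∨
        PoorEdge (_root_.addApex H v p q) M' b c v ∨
        PoorEdge (_root_.addApex H v p q) M' c v b := by
      intro b c h1 h2 h3
      have hb := hvadj b h1
      have hc := hvadj c h3.symm
      have hbc := h2.ne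
      rcases hb with rfl | rfl <;> rcases hc with rfl | rfl
      · exact absurd rfl hbc
      · exact core
      · rcases core with h | h | h
        exacts [Or.inr (Or.inr h.swap), Or.inr (Or.inl h.swap), Or.inl h.swap]
      · exact absurd rfl hbc
    have keep : ∀ a b c, a ≠ v → b ≠ v → a ≠ b → PoorEdge H (M ∪ {s(p, q)}) a b c →
        PoorEdge (_root_.addApex H v p q) M' a b c := by
      rintro a b c ha hb hab ⟨h1, h2⟩
      refine ⟨fun h => h1 (hM' a b ha hb h), fun z hz1 hz2 => ?_⟩
      by_cases hzv : z = v
      · subst hzv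
        have ea := hvadj a hz1.symm
        have eb := hvadj b hz2.symm
        rcases ea with rfl | rfl <;> rcases eb with rfl | rfl
        · exact absurd rfl hab
        · exact absurd (Or.inr rfl) h1
        · exact absurd (Or.inr Sym2.eq_swap) h1
        · exact absurd rfl hab
      · exact h2 z (old _ _ ha hzv hz1) (old _ _ hb hzv hz2)
    intro a b c hab hbc hca
    by_cases hav : a = v
    · subst hav; exact core' b c hab hbc hca
    by_cases hbv : b = v
    · subst hbv
      rcases core' c a hbc hca hab with h | h | h
      exacts [Or.inr (Or.inl h), Or.inr (Or.inr h), Or.inl h]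
    by_cases hcv : c = v
    · subst hcv
      rcases core' a b hca hab hbc with h | h | h
      exacts [Or.inr (Or.inr h), Or.inl h, Or.inr (Or.inl h)]
    rcases hH.poor a b c (old _ _ hav hbv hab) (old _ _ hbv hcv hbc) (old _ _ hcv hav hca)
      with h | h | h
    exacts [Or.inl (keep _ _ _ hav hbv hab.ne h), Or.inr (Or.inl (keep _ _ _ hbv hcv hbc.ne h)),
      Or.inr (Or.inr (keep _ _ _ hcv hav hca.ne h))]

end GoodMarked

section Triangulation

variable {V : Type} {H T : SimpleGraph V} {M : Set (Sym2 V)}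

theorem le_addApex (H : SimpleGraph V) (v p q : V) : H ≤ addApex H v p q := by
  intro x y h
  rw [addApex, SimpleGraph.fromRel_adj]
  exact ⟨h.ne, Or.inl (Or.inl h)⟩

/-- Triangulate the cycle closed by the edge `q s`–`q t`, keeping `q k`–`q (k + 1)` marked. -/
theorem GoodMarked.exists_strip {q : ℕ → V} {k s t : ℕ} (hsk : s ≤ k) (hkt : k < t)
    (hinj : ∀ i j, s ≤ i → i ≤ t → s ≤ j → j ≤ t → q i = q j → i = j)
    (hiso : ∀ i, s < i → i < t → ∀ x, ¬ H.Adj (q i) x) (hst : H.Adj (q s) (q t))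
    (hM : ∀ i, s < i → i < t → ∀ x, s(q i, x) ∉ M) (hH : GoodMarked H (M ∪ {s(q s, q t)})) :
    ∃ H' : SimpleGraph V, H ≤ H' ∧
      (∀ x y, H'.Adj x y → H.Adj x y ∨ (x ∈ q '' Set.Icc s t ∧ y ∈ q '' Set.Icc s t)) ∧
      (∀ i, s ≤ i → i < t → H'.Adj (q i) (q (i + 1))) ∧
      GoodMarked H' (M ∪ {s(q k, q (k + 1))}) := by
  induction hn : t - s using Nat.strong_induction_on generalizing s t H with
  | _ n ih =>
  by_cases h1 : t = s + 1
  · subst h1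
    obtain rfl : k = s := by omega
    refine ⟨H, le_rfl, fun x y h => Or.inl h, fun i h1 h2 => ?_, hH⟩
    obtain rfl : i = k := by omega
    exact hst
  have ne : ∀ i j, s ≤ i → i < j → j ≤ t → q i ≠ q j := by
    intro i j h1 h2 h3 h
    have := hinj i j h1 (by omega) (by omega) h3 h
    omega
  have hs' : q s ∈ q '' Set.Icc s t := ⟨s, ⟨le_rfl, by omega⟩, rfl⟩
  have ht' : q t ∈ q '' Set.Icc s t := ⟨t, ⟨by omega, le_rfl⟩, rfl⟩
  by_cases hk : k = s
  · have hp : q (t - 1) ≠ q s := (ne s (t - 1) le_rfl (by omega) (by omega)).symm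
    have hq : q (t - 1) ≠ q t := ne (t - 1) t (by omega) (by omega) le_rfl
    have hadj : ∀ x y, (_root_.addApex H (q (t - 1)) (q s) (q t)).Adj x y ↔ _ :=
      fun x y => addApex_adj hp hq
    have hv' : q (t - 1) ∈ q '' Set.Icc s t := ⟨t - 1, ⟨by omega, by omega⟩, rfl⟩
    have hnew := hH.addApex (v := q (t - 1)) (M' := M ∪ {s(q s, q (t - 1))})
      (hiso _ (by omega) (by omega)) hst
      (by
        rintro a b ha hb (h | h)
        · exact Or.inl h
        · rcases Sym2.eq_iff.1 h with ⟨-, h⟩ | ⟨h, -⟩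
          exacts [absurd h hb, absurd h ha])
      (Or.inr (Or.inl (by
        rintro (h | h)
        · exact hM _ (by omega) (by omega) _ h
        · rcases Sym2.eq_iff.1 h with ⟨h, -⟩ | ⟨-, h⟩
          exacts [hp h, ne s t le_rfl (by omega) le_rfl h.symm])))
    obtain ⟨H', hle, hsup, hpath, hgood⟩ := ih (t - 1 - s) (by omega) hsk (by omega)
      (fun i j h1 h2 h3 h4 => hinj i j h1 (by omega) h3 (by omega))
      (fun i h1 h2 x hx => by
        rcases (hadj _ _).1 hx with h | ⟨h, -⟩ | ⟨-, h | h⟩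
        · exact hiso i h1 (by omega) x h
        · exact ne i (t - 1) (by omega) h2 (by omega) h
        · exact ne s i le_rfl h1 (by omega) h.symm
        · exact ne i t (by omega) (by omega) le_rfl h)
      ((hadj _ _).2 (Or.inr (Or.inr ⟨rfl, Or.inl rfl⟩)))
      (fun i h1 h2 => hM i h1 (by omega)) hnew rfl
    refine ⟨H', (le_addApex _ _ _ _).trans hle, ?_, ?_, hgood⟩
    · intro x y hxy
      rcases hsup x y hxy with h | ⟨h1, h2⟩
      · rcases (hadj _ _).1 h with h | ⟨rfl, rfl | rfl⟩ | ⟨rfl, rfl | rfl⟩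
        exacts [Or.inl h, Or.inr ⟨hv', hs'⟩, Or.inr ⟨hv', ht'⟩, Or.inr ⟨hs', hv'⟩,
          Or.inr ⟨ht', hv'⟩]
      · have hsub : q '' Set.Icc s (t - 1) ⊆ q '' Set.Icc s t :=
          Set.image_mono (Set.Icc_subset_Icc le_rfl (by omega))
        exact Or.inr ⟨hsub h1, hsub h2⟩
    · intro i h1 h2
      by_cases hi : i = t - 1
      · subst hi
        rw [show t - 1 + 1 = t by omega]
        exact hle ((hadj _ _).2 (Or.inr (Or.inl ⟨rfl, Or.inr rfl⟩)))
      · exact hpath i h1 (by omega)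
  · have hp : q (s + 1) ≠ q s := (ne s (s + 1) le_rfl (by omega) (by omega)).symm
    have hq : q (s + 1) ≠ q t := ne (s + 1) t (by omega) (by omega) le_rfl
    have hadj : ∀ x y, (_root_.addApex H (q (s + 1)) (q s) (q t)).Adj x y ↔ _ :=
      fun x y => addApex_adj hp hq
    have hv' : q (s + 1) ∈ q '' Set.Icc s t := ⟨s + 1, ⟨by omega, by omega⟩, rfl⟩
    have hnew := hH.addApex (v := q (s + 1)) (M' := M ∪ {s(q (s + 1), q t)})
      (hiso _ (by omega) (by omega)) hst
      (by
        rintro a b ha hb (h | h)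
        · exact Or.inl h
        · rcases Sym2.eq_iff.1 h with ⟨h, -⟩ | ⟨-, h⟩
          exacts [absurd h ha, absurd h hb])
      (Or.inl (by
        rintro (h | h)
        · exact hM _ (by omega) (by omega) _ h
        · rcases Sym2.eq_iff.1 h with ⟨-, h⟩ | ⟨h, -⟩
          exacts [ne s t le_rfl (by omega) le_rfl h, hq h]))
    obtain ⟨H', hle, hsup, hpath, hgood⟩ := ih (t - (s + 1)) (by omega) (by omega) hkt
      (fun i j h1 h2 h3 h4 => hinj i j (by omega) h2 (by omega) h4)
      (fun i h1 h2 x hx => by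
        rcases (hadj _ _).1 hx with h | ⟨h, -⟩ | ⟨-, h | h⟩
        · exact hiso i (by omega) (by omega) x h
        · exact ne (s + 1) i (by omega) h1 (by omega) h.symm
        · exact ne s i le_rfl (by omega) (by omega) h.symm
        · exact ne i t (by omega) (by omega) le_rfl h)
      ((hadj _ _).2 (Or.inr (Or.inl ⟨rfl, Or.inr rfl⟩)))
      (fun i h1 h2 => hM i (by omega) h2) hnew rfl
    refine ⟨H', (le_addApex _ _ _ _).trans hle, ?_, ?_, hgood⟩
    · intro x y hxy
      rcases hsup x y hxy with h | ⟨h1, h2⟩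
      · rcases (hadj _ _).1 h with h | ⟨rfl, rfl | rfl⟩ | ⟨rfl, rfl | rfl⟩
        exacts [Or.inl h, Or.inr ⟨hv', hs'⟩, Or.inr ⟨hv', ht'⟩, Or.inr ⟨hs', hv'⟩,
          Or.inr ⟨ht', hv'⟩]
      · have hsub : q '' Set.Icc (s + 1) t ⊆ q '' Set.Icc s t :=
          Set.image_mono (Set.Icc_subset_Icc (by omega) le_rfl)
        exact Or.inr ⟨hsub h1, hsub h2⟩
    · intro i h1 h2
      by_cases hi : i = s
      · subst hi
        exact hle ((hadj _ _).2 (Or.inr (Or.inr ⟨rfl, Or.inl rfl⟩)))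
      · exact hpath i (by omega) h2

theorem IsEar.adj_cases {S₀ : Set V} {m : ℕ} {q : ℕ → V} (h : IsEar T S₀ m q) {x y : V}
    (hx : x ∈ S₀ ∪ q '' Set.Iic m) (hy : y ∈ S₀ ∪ q '' Set.Iic m) (hxy : T.Adj x y) :
    (x ∈ S₀ ∧ y ∈ S₀) ∨ ∃ i < m, s(x, y) = s(q i, q (i + 1)) := by
  have h2 := h.two_le
  have split : ∀ x ∈ S₀ ∪ q '' Set.Iic m, x ∈ S₀ ∨ ∃ i, 0 < i ∧ i < m ∧ x = q i := by
    intro x hx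
    by_cases hx0 : x ∈ S₀
    · exact Or.inl hx0
    · obtain ⟨i, hi, rfl⟩ := hx.resolve_left hx0
      have hi' : i ≤ m := hi
      have i0 : i ≠ 0 := by rintro rfl; exact hx0 h.start
      have im : i ≠ m := by rintro rfl; exact hx0 h.last
      exact Or.inr ⟨i, by omega, by omega, rfl⟩
  rcases split x hx with hx | ⟨i, hi0, him, rfl⟩ <;> rcases split y hy with hy | ⟨j, hj0, hjm, rfl⟩
  · exact Or.inl ⟨hx, hy⟩
  · right
    rcases h.only j hj0 hjm x hx hxy.symm with ⟨rfl, rfl⟩ | ⟨rfl, h1⟩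
    · exact ⟨0, by omega, rfl⟩
    · exact ⟨j, by omega, by rw [h1, Sym2.eq_swap]⟩
  · right
    rcases h.only i hi0 him y hy hxy with ⟨rfl, rfl⟩ | ⟨rfl, h1⟩
    · exact ⟨0, by omega, Sym2.eq_swap⟩
    · exact ⟨i, by omega, by rw [h1]⟩
  · right
    rcases Nat.lt_trichotomy i j with hij | rfl | hij
    · have := h.induced i j hi0 hij hjm hxy
      exact ⟨i, him, by rw [this]⟩
    · exact absurd hxy T.irrefl
    · have := h.induced j i hj0 hij him hxy.symm
      exact ⟨j, hjm, by rw [this, Sym2.eq_swap]⟩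

theorem IsEar.isChordlessCycle {S₀ : Set V} {m : ℕ} {q : ℕ → V} (h : IsEar T S₀ m q) :
    IsChordlessCycle T (q '' Set.Iic m) :=
  isChordlessCycle_iff.2 ⟨m + 1, by have := h.two_le; omega, q, h.cycleOn⟩

theorem ETree.exists_chordless {S : Set V} (h : ETree T S) {u v : V} (hu : u ∈ S) (hv : v ∈ S)
    (huv : T.Adj u v) : S ⊆ {u, v} ∨ ∃ C ⊆ S, IsChordlessCycle T C ∧ u ∈ C ∧ v ∈ C := by
  induction h with
  | edge a b hab =>
    left
    have := huv.ne
    rcases hu with rfl | rfl <;> rcases hv with rfl | rfl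
    exacts [absurd rfl this, subset_rfl, (Set.pair_comm _ _).subset, absurd rfl this]
  | ear S₀ m q h₀ hq ih =>
    right
    have m0 : q 0 ∈ q '' Set.Iic m := ⟨0, Nat.zero_le _, rfl⟩
    have mm : q m ∈ q '' Set.Iic m := ⟨m, Set.self_mem_Iic, rfl⟩
    rcases hq.adj_cases hu hv huv with ⟨hu, hv⟩ | ⟨i, hi, he⟩
    · rcases ih hu hv with h | ⟨C, hC, h⟩
      · have hne := hq.chord.ne
        refine ⟨_, Set.subset_union_right, hq.isChordlessCycle, ?_⟩
        have h0 := h hq.start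
        have h1 := h hq.last
        rcases h0 with h0 | h0 <;> rcases h1 with h1 | h1
        · exact absurd (h0.trans h1.symm) hne
        · exact ⟨h0 ▸ m0, h1 ▸ mm⟩
        · exact ⟨h1 ▸ mm, h0 ▸ m0⟩
        · exact absurd (h0.trans h1.symm) hne
      · exact ⟨C, hC.trans Set.subset_union_left, h⟩
    · refine ⟨_, Set.subset_union_right, hq.isChordlessCycle, ?_⟩
      have e1 : q i ∈ q '' Set.Iic m := ⟨i, hi.le, rfl⟩
      have e2 : q (i + 1) ∈ q '' Set.Iic m := ⟨i + 1, hi, rfl⟩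
      rcases Sym2.eq_iff.1 he with ⟨rfl, rfl⟩ | ⟨rfl, rfl⟩
      exacts [⟨e1, e2⟩, ⟨e2, e1⟩]

/-- The edge `u v` is marked or lies in two chordless cycles within `S`. -/
def MarkedIn (T : SimpleGraph V) (S : Set V) (M : Set (Sym2 V)) (u v : V) : Prop :=
  T.Adj u v ∧ (s(u, v) ∈ M ∨ ∃ C₁ C₂ : Set V, C₁ ≠ C₂ ∧ C₁ ⊆ S ∧ C₂ ⊆ S ∧
    IsChordlessCycle T C₁ ∧ IsChordlessCycle T C₂ ∧ u ∈ C₁ ∧ v ∈ C₁ ∧ u ∈ C₂ ∧ v ∈ C₂)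

/-- No chordless cycle within `S` has three marked edges. -/
def TwoMarked (T : SimpleGraph V) (S : Set V) (M : Set (Sym2 V)) : Prop :=
  ∀ C ⊆ S, IsChordlessCycle T C → ∀ u₁ v₁ u₂ v₂ u₃ v₃, u₁ ∈ C → v₁ ∈ C → u₂ ∈ C → v₂ ∈ C →
    u₃ ∈ C → v₃ ∈ C → MarkedIn T S M u₁ v₁ → MarkedIn T S M u₂ v₂ → MarkedIn T S M u₃ v₃ →
    s(u₁, v₁) ≠ s(u₂, v₂) → s(u₁, v₁) ≠ s(u₃, v₃) → s(u₂, v₂) ≠ s(u₃, v₃) → False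

theorem goodMarked_of_adj_eq {a b : V} (hH : ∀ x y, H.Adj x y → (x ∈ ({a, b} : Set V) ∧
    y ∈ ({a, b} : Set V))) : GoodMarked H M := by
  have no3 : ∀ x y z, H.Adj x y → H.Adj y z → H.Adj x z → False := by
    intro x y z h1 h2 h3
    have a1 := hH _ _ h1
    have a2 := hH _ _ h2
    have := h1.ne; have := h2.ne; have := h3.ne
    simp only [Set.mem_insert_iff, Set.mem_singleton_iff] at a1 a2
    grind
  refine ⟨?_, fun x y z _ h1 h2 _ h3 _ _ => no3 x y z h1 h3 h2,
    fun x y z h1 h2 h3 => (no3 x y z h1 h2 h3.symm).elim⟩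
  rintro x y hxy D - hx hy ⟨d, hd, hxd⟩ -
  have a1 := hH _ _ hxy
  have a2 := hH _ _ hxd
  have := hxy.ne
  have := hxd.ne
  simp only [Set.mem_insert_iff, Set.mem_singleton_iff] at a1 a2
  grind

end Triangulation

section Triangulation

variable {V : Type} {T : SimpleGraph V} {M : Set (Sym2 V)}

/-- A triangulation of `T` on `S` in which every triangle has a poor edge outside `M`. -/
def HasGoodTriangulation (T : SimpleGraph V) (S : Set V) (M : Set (Sym2 V)) : Prop :=
  ∃ H : SimpleGraph V, (∀ x y, H.Adj x y → x ∈ S ∧ y ∈ S) ∧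
    (∀ x ∈ S, ∀ y ∈ S, T.Adj x y → H.Adj x y) ∧ GoodMarked H M

theorem IsEar.path_edge_inj {S₀ : Set V} {m : ℕ} {q : ℕ → V} (hq : IsEar T S₀ m q) {i j : ℕ}
    (hi : i < m) (hj : j < m) (h : s(q i, q (i + 1)) = s(q j, q (j + 1))) : i = j := by
  rcases Sym2.eq_iff.1 h with ⟨h1, -⟩ | ⟨h1, h2⟩
  · exact hq.inj _ (by omega) _ (by omega) h1
  · have := hq.inj _ (by omega) _ (by omega) h1
    have := hq.inj _ (by omega) _ (by omega) h2
    omega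

theorem IsEar.chord_ne_path_edge {S₀ : Set V} {m : ℕ} {q : ℕ → V} (hq : IsEar T S₀ m q) {i : ℕ}
    (hi : i < m) : s(q 0, q m) ≠ s(q i, q (i + 1)) := by
  intro h
  have h2 := hq.two_le
  rcases Sym2.eq_iff.1 h with ⟨h1, h2⟩ | ⟨h1, h2⟩
  · have := hq.inj _ (by omega) _ (by omega) h1
    have := hq.inj _ (by omega) _ (by omega) h2
    omega
  · have := hq.inj _ (by omega) _ (by omega) h1
    omega

/-- Extend a triangulation along an ear with at most one marked path edge. -/
theorem IsEar.hasGoodTriangulation_single {S₀ : Set V} {m : ℕ} {q : ℕ → V} (hq : IsEar T S₀ m q)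
    (hMT : ∀ x y, s(x, y) ∈ M →
      T.Adj x y ∧ x ∈ S₀ ∪ q '' Set.Iic m ∧ y ∈ S₀ ∪ q '' Set.Iic m)
    (h₀ : HasGoodTriangulation T S₀ ({e ∈ M | ∀ x ∈ e, x ∈ S₀} ∪ {s(q 0, q m)})) {k : ℕ}
    (hk : k < m) (hkM : ∀ i < m, s(q i, q (i + 1)) ∈ M → i = k) :
    HasGoodTriangulation T (S₀ ∪ q '' Set.Iic m) M := by
  obtain ⟨H₀, hsupp, hT, hgood⟩ := h₀
  have h2 := hq.two_le
  obtain ⟨H, hle, hE, hpath, hG⟩ := GoodMarked.exists_strip (q := q) (k := k) (s := 0) (t := m)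
    (Nat.zero_le _) hk (fun i j _ hi _ hj h => hq.inj i hi j hj h)
    (fun i h0 hm x h => hq.interior i h0 hm (hsupp _ _ h).1)
    (hT _ hq.start _ hq.last hq.chord)
    (fun i h0 hm x h => hq.interior i h0 hm (h.2 _ (Sym2.mem_mk_left _ _))) hgood
  refine ⟨H, fun x y hxy => ?_, fun x hx y hy hxy => ?_, hG.anti ?_⟩
  · rcases hE x y hxy with h | ⟨⟨i, hi, rfl⟩, ⟨j, hj, rfl⟩⟩
    · exact ⟨Or.inl (hsupp _ _ h).1, Or.inl (hsupp _ _ h).2⟩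
    · exact ⟨Or.inr ⟨i, hi.2, rfl⟩, Or.inr ⟨j, hj.2, rfl⟩⟩
  · rcases hq.adj_cases hx hy hxy with ⟨hx, hy⟩ | ⟨i, hi, h⟩
    · exact hle (hT x hx y hy hxy)
    · rw [← SimpleGraph.mem_edgeSet, h]
      exact hpath i (Nat.zero_le _) hi
  · intro e
    induction e using Sym2.ind with
    | _ x y =>
      intro he
      obtain ⟨hxy, hx, hy⟩ := hMT x y he
      rcases hq.adj_cases hx hy hxy with ⟨hx, hy⟩ | ⟨i, hi, h⟩
      · refine Or.inl ⟨he, fun z hz => ?_⟩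
        rcases Sym2.mem_iff.1 hz with rfl | rfl <;> assumption
      · obtain rfl := hkM i hi (h ▸ he)
        exact Or.inr h

/-- Triangulate a single cycle with two marked edges. -/
theorem IsEar.hasGoodTriangulation_pair {S₀ : Set V} {m : ℕ} {q : ℕ → V} (hq : IsEar T S₀ m q)
    (hS₀ : S₀ ⊆ {q 0, q m}) (hab : s(q 0, q m) ∉ M)
    (hMT : ∀ x y, s(x, y) ∈ M →
      T.Adj x y ∧ x ∈ S₀ ∪ q '' Set.Iic m ∧ y ∈ S₀ ∪ q '' Set.Iic m)
    (h₀ : HasGoodTriangulation T S₀ ({e ∈ M | ∀ x ∈ e, x ∈ S₀} ∪ {s(q 0, q m)})) {i j : ℕ}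
    (hij : i < j) (hj : j < m)
    (hijM : ∀ l < m, s(q l, q (l + 1)) ∈ M → l = i ∨ l = j) :
    HasGoodTriangulation T (S₀ ∪ q '' Set.Iic m) M := by
  obtain ⟨H₀, hsupp, hT, hgood⟩ := h₀
  have h2 := hq.two_le
  have inj : ∀ {k l : ℕ}, k ≤ m → l ≤ m → k ≠ l → q k ≠ q l :=
    fun hk hl hkl h => hkl (hq.inj _ hk _ hl h)
  have hiso : ∀ l, 0 < l → l < m → ∀ x, ¬ H₀.Adj (q l) x :=
    fun l h0 hm x h => hq.interior l h0 hm (hsupp _ _ h).1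
  have hadj₀ := hT _ hq.start _ hq.last hq.chord
  have hv0 : q (i + 1) ≠ q 0 := inj (by omega) (by omega) (by omega)
  have hvm : q (i + 1) ≠ q m := inj (by omega) (by omega) (by omega)
  have h0m : q 0 ≠ q m := hadj₀.ne
  have hG₁ : GoodMarked (addApex H₀ (q (i + 1)) (q 0) (q m))
      ({s(q (i + 1), q m)} ∪ {s(q 0, q (i + 1))}) := by
    refine GoodMarked.addApex (M := ∅) (hgood.anti (by simp)) (hiso _ (by omega) (by omega))
      hadj₀ ?_ (Or.inr (Or.inr ⟨?_, ?_⟩))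
    · intro a b ha hb hab
      exfalso
      simp only [Set.mem_union, Set.mem_singleton_iff, Sym2.eq_iff] at hab
      tauto
    · simp only [Set.mem_union, Set.mem_singleton_iff, Sym2.eq_iff]
      grind
    · intro z hz1 hz2
      have := hS₀ (hsupp _ _ hz1).2
      simp only [Set.mem_insert_iff, Set.mem_singleton_iff] at this
      rcases this with rfl | rfl
      exacts [hz1.ne rfl, hz2.ne rfl]
  have hadj₁ := fun x y => addApex_adj (H := H₀) (x := x) (y := y) hv0 hvm
  obtain ⟨H₂, hle₂, hE₂, hpath₂, hG₂⟩ := GoodMarked.exists_strip (q := q) (k := i) (s := 0)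
    (t := i + 1) (Nat.zero_le _) (by omega)
    (fun i j _ hi _ hj h => hq.inj i (by omega) j (by omega) h)
    (by
      intro l h0 hl x h
      rcases (hadj₁ _ _).1 h with h | ⟨h, -⟩ | ⟨-, h | h⟩
      · exact hiso l h0 (by omega) x h
      · exact inj (by omega) (by omega) (by omega) h
      · exact inj (by omega) (by omega) (by omega) h
      · exact inj (by omega) (by omega) (by omega) h)
    ((hadj₁ _ _).2 (Or.inr (Or.inr ⟨rfl, Or.inl rfl⟩)))
    (by
      intro l h0 hl x h
      rcases Sym2.eq_iff.1 h with ⟨h, -⟩ | ⟨h, -⟩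
      · exact inj (by omega) (by omega) (by omega) h
      · exact inj (by omega) (by omega) (by omega) h) hG₁
  obtain ⟨H₃, hle₃, hE₃, hpath₃, hG₃⟩ := GoodMarked.exists_strip (q := q) (k := j) (s := i + 1)
    (t := m) (M := {s(q i, q (i + 1))}) (by omega) hj
    (fun i j _ hi _ hj h => hq.inj i (by omega) j (by omega) h)
    (by
      intro l h0 hl x h
      rcases hE₂ _ _ h with h | ⟨⟨r, hr, h⟩, -⟩
      · rcases (hadj₁ _ _).1 h with h | ⟨h, -⟩ | ⟨-, h | h⟩
        · exact hiso l (by omega) (by omega) x h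
        · exact inj (by omega) (by omega) (by omega) h
        · exact inj (by omega) (by omega) (by omega) h
        · exact inj (by omega) (by omega) (by omega) h
      · have := hr.2
        exact inj (by omega) (by omega) (by omega) h)
    (hle₂ ((hadj₁ _ _).2 (Or.inr (Or.inl ⟨rfl, Or.inr rfl⟩))))
    (by
      intro l h0 hl x h
      rcases Sym2.eq_iff.1 h with ⟨h, -⟩ | ⟨h, -⟩
      · exact inj (by omega) (by omega) (by omega) h
      · exact inj (by omega) (by omega) (by omega) h) (by rwa [Set.union_comm])
  have hmem : ∀ l ≤ m, q l ∈ S₀ ∪ q '' Set.Iic m := fun l hl => Or.inr ⟨l, hl, rfl⟩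
  refine ⟨H₃, fun x y hxy => ?_, fun x hx y hy hxy => ?_, hG₃.anti ?_⟩
  · rcases hE₃ x y hxy with h | ⟨⟨i', hi, rfl⟩, ⟨j', hj, rfl⟩⟩
    · rcases hE₂ x y h with h | ⟨⟨i', hi, rfl⟩, ⟨j', hj, rfl⟩⟩
      · rcases (hadj₁ _ _).1 h with h | ⟨rfl, rfl | rfl⟩ | ⟨rfl, rfl | rfl⟩
        · exact ⟨Or.inl (hsupp _ _ h).1, Or.inl (hsupp _ _ h).2⟩
        all_goals exact ⟨hmem _ (by omega), hmem _ (by omega)⟩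
      · have := hi.2; have := hj.2
        exact ⟨hmem _ (by omega), hmem _ (by omega)⟩
    · exact ⟨hmem _ hi.2, hmem _ hj.2⟩
  · rcases hq.adj_cases hx hy hxy with ⟨hx, hy⟩ | ⟨l, hl, h⟩
    · exact hle₃ (hle₂ (le_addApex _ _ _ _ (hT x hx y hy hxy)))
    · rw [← SimpleGraph.mem_edgeSet, h]
      by_cases hli : l < i + 1
      · exact hle₃ (hpath₂ l (Nat.zero_le _) hli)
      · exact hpath₃ l (by omega) hl
  · intro e
    induction e using Sym2.ind with
    | _ x y =>
      intro he
      obtain ⟨hxy, hx, hy⟩ := hMT x y he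
      rcases hq.adj_cases hx hy hxy with ⟨hx, hy⟩ | ⟨l, hl, h⟩
      · exfalso
        apply hab
        have h1 := hS₀ hx
        have h2 := hS₀ hy
        simp only [Set.mem_insert_iff, Set.mem_singleton_iff] at h1 h2
        rcases h1 with rfl | rfl <;> rcases h2 with rfl | rfl
        · exact absurd hxy T.irrefl
        · exact he
        · rwa [Sym2.eq_swap]
        · exact absurd hxy T.irrefl
      · rw [h] at he ⊢
        rcases hijM l hl he with rfl | rfl
        exacts [Or.inl rfl, Or.inr rfl]

theorem MarkedIn.of_ear {S₀ : Set V} {m : ℕ} {q : ℕ → V} (hq : IsEar T S₀ m q) {C : Set V}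
    (hCS : C ⊆ S₀) (hC : IsChordlessCycle T C) (h0 : q 0 ∈ C) (hm : q m ∈ C) :
    MarkedIn T (S₀ ∪ q '' Set.Iic m) M (q 0) (q m) := by
  have h2 := hq.two_le
  refine ⟨hq.chord, Or.inr ⟨C, q '' Set.Iic m, ?_, hCS.trans Set.subset_union_left,
    Set.subset_union_right, hC, hq.isChordlessCycle, h0, hm, ⟨0, Nat.zero_le _, rfl⟩,
    ⟨m, Set.self_mem_Iic, rfl⟩⟩⟩
  rintro rfl
  exact hq.interior 1 one_pos (by omega) (hCS ⟨1, by simp only [Set.mem_Iic]; omega, rfl⟩)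

theorem MarkedIn.congr {S : Set V} {u v x y : V} (h : MarkedIn T S M u v)
    (he : s(x, y) = s(u, v)) : MarkedIn T S M x y := by
  rcases Sym2.eq_iff.1 he with ⟨rfl, rfl⟩ | ⟨rfl, rfl⟩
  · exact h
  · refine ⟨h.1.symm, h.2.imp (fun h => he ▸ h) ?_⟩
    rintro ⟨C₁, C₂, h1, h2, h3, h4, h5, h6, h7, h8, h9⟩
    exact ⟨C₁, C₂, h1, h2, h3, h4, h5, h7, h6, h9, h8⟩

theorem TwoMarked.of_ear {S₀ : Set V} {m : ℕ} {q : ℕ → V} (h₀ : ETree T S₀)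
    (hq : IsEar T S₀ m q) (hM : TwoMarked T (S₀ ∪ q '' Set.Iic m) M) :
    TwoMarked T S₀ ({e ∈ M | ∀ x ∈ e, x ∈ S₀} ∪ {s(q 0, q m)}) := by
  intro C hCS hC u₁ v₁ u₂ v₂ u₃ v₃ a1 b1 a2 b2 a3 b3 k1 k2 k3 n12 n13 n23
  rcases h₀.exists_chordless hq.start hq.last hq.chord with hS | ⟨C', hC'S, hC', h0, hm⟩
  · have key : ∀ u v, u ∈ C → v ∈ C → T.Adj u v → s(u, v) = s(q 0, q m) := by
      intro u v hu hv huv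
      have h1 := hS (hCS hu)
      have h2 := hS (hCS hv)
      have := huv.ne
      simp only [Set.mem_insert_iff, Set.mem_singleton_iff] at h1 h2
      rw [Sym2.eq_iff]
      grind
    exact n12 ((key _ _ a1 b1 k1.1).trans (key _ _ a2 b2 k2.1).symm)
  · have key : ∀ u v, MarkedIn T S₀ ({e ∈ M | ∀ x ∈ e, x ∈ S₀} ∪ {s(q 0, q m)}) u v →
        MarkedIn T (S₀ ∪ q '' Set.Iic m) M u v := by
      rintro u v ⟨huv, (h | h) | ⟨C₁, C₂, h1, h2, h3, h4⟩⟩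
      · exact ⟨huv, Or.inl h.1⟩
      · exact (MarkedIn.of_ear hq hC'S hC' h0 hm).congr h
      · exact ⟨huv, Or.inr ⟨C₁, C₂, h1, h2.trans Set.subset_union_left,
          h3.trans Set.subset_union_left, h4⟩⟩
    exact hM C (hCS.trans Set.subset_union_left) hC _ _ _ _ _ _ a1 b1 a2 b2 a3 b3
      (key _ _ k1) (key _ _ k2) (key _ _ k3) n12 n13 n23

theorem ETree.hasGoodTriangulation {S : Set V} (h : ETree T S)
    (hMT : ∀ x y, s(x, y) ∈ M → T.Adj x y ∧ x ∈ S ∧ y ∈ S) (hM : TwoMarked T S M) :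
    HasGoodTriangulation T S M := by
  induction h generalizing M with
  | edge a b hab =>
    refine ⟨SimpleGraph.fromRel fun x y => x = a ∧ y = b, ?_, ?_, ?_⟩
    · rintro x y ⟨-, ⟨rfl, rfl⟩ | ⟨rfl, rfl⟩⟩ <;> simp
    · rintro x (rfl | rfl) y (rfl | rfl) hxy
      · exact absurd hxy T.irrefl
      · exact ⟨hxy.ne, Or.inl ⟨rfl, rfl⟩⟩
      · exact ⟨hxy.ne, Or.inr ⟨rfl, rfl⟩⟩
      · exact absurd hxy T.irrefl
    · apply goodMarked_of_adj_eq (a := a) (b := b)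
      rintro x y ⟨-, ⟨rfl, rfl⟩ | ⟨rfl, rfl⟩⟩ <;> simp
  | ear S₀ m q h₀ hq ih =>
    have h2 := hq.two_le
    have hT₀ := ih (M := {e ∈ M | ∀ x ∈ e, x ∈ S₀} ∪ {s(q 0, q m)})
      (by
        rintro x y (h | h)
        · exact ⟨(hMT x y h.1).1, h.2 _ (Sym2.mem_mk_left _ _), h.2 _ (Sym2.mem_mk_right _ _)⟩
        · rcases Sym2.eq_iff.1 h with ⟨rfl, rfl⟩ | ⟨rfl, rfl⟩
          · exact ⟨hq.chord, hq.start, hq.last⟩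
          · exact ⟨hq.chord.symm, hq.last, hq.start⟩) (hM.of_ear h₀ hq)
    by_cases hk : ∃ k < m, ∀ i < m, s(q i, q (i + 1)) ∈ M → i = k
    · obtain ⟨k, hk, hkM⟩ := hk
      exact hq.hasGoodTriangulation_single hMT hT₀ hk hkM
    push Not at hk
    obtain ⟨i₀, hi₀, hi₀M, -⟩ := hk 0 (by omega)
    obtain ⟨i₁, hi₁, hi₁M, hne⟩ := hk i₀ hi₀
    obtain ⟨i, j, hij, hj, hiM, hjM⟩ : ∃ i j, i < j ∧ j < m ∧ s(q i, q (i + 1)) ∈ M ∧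
        s(q j, q (j + 1)) ∈ M := by
      rcases Nat.lt_or_gt_of_ne hne with h | h
      exacts [⟨_, _, h, hi₀, hi₁M, hi₀M⟩, ⟨_, _, h, hi₁, hi₀M, hi₁M⟩]
    have hmem : ∀ l ≤ m, q l ∈ q '' Set.Iic m := fun l hl => ⟨l, hl, rfl⟩
    have hmark : ∀ l < m, s(q l, q (l + 1)) ∈ M →
        MarkedIn T (S₀ ∪ q '' Set.Iic m) M (q l) (q (l + 1)) :=
      fun l hl h => ⟨hq.step l hl, Or.inl h⟩
    have third : ∀ u v, u ∈ q '' Set.Iic m → v ∈ q '' Set.Iic m →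
        MarkedIn T (S₀ ∪ q '' Set.Iic m) M u v → s(u, v) ≠ s(q i, q (i + 1)) →
        s(u, v) ≠ s(q j, q (j + 1)) → False := by
      intro u v hu hv huv h1 h2
      exact hM _ Set.subset_union_right hq.isChordlessCycle _ _ _ _ _ _ hu hv
        (hmem i (by omega)) (hmem _ (by omega)) (hmem j (by omega)) (hmem _ (by omega)) huv
        (hmark i (by omega) hiM) (hmark j hj hjM) h1 h2
        (fun h => hij.ne (hq.path_edge_inj (by omega) hj h))
    have hchord : ¬ MarkedIn T (S₀ ∪ q '' Set.Iic m) M (q 0) (q m) := fun h =>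
      third _ _ (hmem 0 (by omega)) (hmem m le_rfl) h (hq.chord_ne_path_edge (by omega))
        (hq.chord_ne_path_edge hj)
    refine hq.hasGoodTriangulation_pair ?_ (fun h => hchord ⟨hq.chord, Or.inl h⟩) hMT hT₀ hij hj ?_
    · rcases h₀.exists_chordless hq.start hq.last hq.chord with hS | ⟨C', hC'S, hC', h0, hm⟩
      · exact hS
      · exact (hchord (MarkedIn.of_ear hq hC'S hC' h0 hm)).elim
    · intro l hl hlM
      by_contra hcon
      push Not at hcon
      exact third _ _ (hmem l (by omega)) (hmem _ (by omega)) (hmark l hl hlM)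
        (fun h => hcon.1 (hq.path_edge_inj hl (by omega) h))
        (fun h => hcon.2 (hq.path_edge_inj hl hj h))

/-- A finite tree of two-boundaried cycles has a strongly chordal completion without `K₄`. -/
theorem IsTreeOfTwoBoundariedCycles.exists_triangulation [Finite V]
    (hT : IsTreeOfTwoBoundariedCycles T) :
    ∃ H, T ≤ H ∧ EdgeTriangle H ∧ NoFourClique H ∧ NoRich H := by
  obtain ⟨H, -, hTH, hG⟩ := hT.1.eTree.hasGoodTriangulation (M := ∅) (by simp) (by
    intro C _ hC u₁ v₁ u₂ v₂ u₃ v₃ a1 b1 a2 b2 a3 b3 k1 k2 k3 n12 n13 n23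
    have key : ∀ u v, u ∈ C → v ∈ C → MarkedIn T Set.univ ∅ u v → s(u, v) ∈
        {e : Sym2 V | ∃ u v : V, e = s(u, v) ∧ u ∈ C ∧ v ∈ C ∧ IsEdgeSeparator T u v} := by
      rintro u v hu hv ⟨huv, h | ⟨C₁, C₂, h1, -, -, h2⟩⟩
      · exact h.elim
      · exact ⟨u, v, rfl, hu, hv, huv, C₁, C₂, h1, h2⟩
    refine absurd (hT.2 C hC) (not_le.2 ((Set.two_lt_ncard_iff (Set.toFinite _)).2
      ⟨_, _, _, key _ _ a1 b1 k1, key _ _ a2 b2 k2, key _ _ a3 b3 k3, n12, n13, n23⟩)))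
  exact ⟨H, fun x y h => hTH x trivial y trivial h, hG.edgeTriangle, hG.noFourClique, hG.noRich⟩

end Triangulation

/-- The set `A` induces a connected subgraph without a cut vertex. -/
def Biconn {V : Type} (G : SimpleGraph V) (A : Set V) : Prop :=
  ConnSet G A ∧ ∀ v ∈ A, (A \ {v}).Nonempty → ConnSet G (A \ {v})

section Blocks

variable {V : Type} {G : SimpleGraph V}

theorem isBlock_iff {S : Set V} :
    IsBlock G S ↔ Biconn G S ∧ ∀ S' : Set V, S ⊆ S' → Biconn G S' → S' = S := by
  simp only [IsBlock, NoCutVertex, connSet_iff, Biconn]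
  constructor
  · rintro ⟨-, h1, h2, h3⟩
    exact ⟨⟨h1, h2⟩, fun S' hS' h => h3 S' hS' h.1 h.2⟩
  · rintro ⟨⟨h1, h2⟩, h3⟩
    exact ⟨h1.nonempty, h1, h2, fun S' hS' h h' => h3 S' hS' ⟨h, h'⟩⟩

theorem Biconn.diff_singleton {A : Set V} (hA : Biconn G A) {v : V} (h : (A \ {v}).Nonempty) :
    ConnSet G (A \ {v}) := by
  by_cases hv : v ∈ A
  · exact hA.2 v hv h
  · rw [Set.sdiff_singleton_eq_self hv]
    exact hA.1

theorem Biconn.union {A B : Set V} (hA : Biconn G A) (hB : Biconn G B) {x y : V} (hxy : x ≠ y)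
    (hxA : x ∈ A) (hxB : x ∈ B) (hyA : y ∈ A) (hyB : y ∈ B) : Biconn G (A ∪ B) := by
  refine ⟨hA.1.union_inter hB.1 ⟨x, hxA, hxB⟩, fun v _ _ => ?_⟩
  rw [Set.union_sdiff_distrib]
  obtain ⟨z, hzv, hzA, hzB⟩ : ∃ z, z ≠ v ∧ z ∈ A ∧ z ∈ B := by
    by_cases hxv : x = v
    · exact ⟨y, fun h => hxy (hxv.trans h.symm), hyA, hyB⟩
    · exact ⟨x, hxv, hxA, hxB⟩
  exact (hA.diff_singleton ⟨z, hzA, hzv⟩).union_inter (hB.diff_singleton ⟨z, hzB, hzv⟩)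
    ⟨z, ⟨hzA, hzv⟩, hzB, hzv⟩

theorem biconn_pair {x y : V} (h : G.Adj x y) : Biconn G {x, y} := by
  refine ⟨?_, ?_⟩
  · rw [Set.pair_comm]
    exact (connSet_singleton x).insert rfl h
  · rintro v (rfl | rfl) -
    · have : ({v, y} : Set V) \ {v} = {y} := by
        have := h.ne
        ext z
        simp only [Set.mem_sdiff, Set.mem_insert_iff, Set.mem_singleton_iff]
        grind
      rw [this]
      exact connSet_singleton y
    · have : ({x, v} : Set V) \ {v} = {x} := by
        have := h.ne
        ext z
        simp only [Set.mem_sdiff, Set.mem_insert_iff, Set.mem_singleton_iff]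
        grind
      rw [this]
      exact connSet_singleton x

theorem Biconn.exists_isBlock [Finite V] {A : Set V} (hA : Biconn G A) :
    ∃ B, A ⊆ B ∧ IsBlock G B := by
  obtain ⟨B, hB, hmax⟩ := (Set.toFinite {B : Set V | A ⊆ B ∧ Biconn G B}).exists_maximal
    ⟨A, le_rfl, hA⟩
  refine ⟨B, hB.1, isBlock_iff.2 ⟨hB.2, fun S' hS' h => ?_⟩⟩
  exact le_antisymm (hmax ⟨hB.1.trans hS', h⟩ hS') hS'

theorem IsBlock.eq_of_two_mem {A B : Set V} (hA : IsBlock G A) (hB : IsBlock G B) {x y : V}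
    (hxy : x ≠ y) (hxA : x ∈ A) (hxB : x ∈ B) (hyA : y ∈ A) (hyB : y ∈ B) : A = B := by
  rw [isBlock_iff] at hA hB
  have h := hA.1.union hB.1 hxy hxA hxB hyA hyB
  rw [← hA.2 _ Set.subset_union_left h]
  exact hB.2 _ Set.subset_union_right h

theorem Biconn.union_path {A : Set V} (hA : Biconn G A) {m : ℕ} {q : ℕ → V} (h0 : q 0 ∈ A)
    (hm : q m ∈ A) (hne : q 0 ≠ q m)
    (hint : ∀ i, 0 < i → i < m → q i ∉ A) (hinj : ∀ i ≤ m, ∀ j ≤ m, q i = q j → i = j)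
    (hstep : ∀ i < m, G.Adj (q i) (q (i + 1))) : Biconn G (A ∪ q '' Set.Icc 0 m) := by
  have hc : ∀ i j, i ≤ j → j ≤ m → ConnSet G (q '' Set.Icc i j) := fun i j hij hj =>
    connSet_image_Icc hij fun k _ hk => hstep k (by omega)
  have hm0 : 0 < m := Nat.pos_of_ne_zero (by rintro rfl; exact hne rfl)
  have hIcc : ∀ i ≤ m, ∀ v, q i = v →
      (q '' Set.Icc 0 m) \ {v} = q '' {l | l ≤ m ∧ l ≠ i} := by
    rintro i hi v rfl
    ext z
    constructor
    · rintro ⟨⟨l, hl, rfl⟩, hz⟩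
      exact ⟨l, ⟨hl.2, fun h => hz (by rw [h]; rfl)⟩, rfl⟩
    · rintro ⟨l, ⟨hl, hli⟩, rfl⟩
      exact ⟨⟨l, ⟨Nat.zero_le _, hl⟩, rfl⟩, fun h => hli (hinj _ hl _ hi h)⟩
  refine ⟨hA.1.union_inter (hc 0 m (Nat.zero_le _) le_rfl) ⟨_, h0, 0, by simp, rfl⟩,
    fun v hv _ => ?_⟩
  rw [Set.union_sdiff_distrib]
  by_cases hvA : v ∈ A
  · by_cases hv0 : q 0 = v
    · rw [hIcc 0 (Nat.zero_le _) v hv0]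
      have he : {l | l ≤ m ∧ l ≠ 0} = Set.Icc 1 m := by ext l; simp; omega
      rw [he]
      have hmv : q m ∈ A \ {v} := ⟨hm, fun h => hne (hv0.trans h.symm)⟩
      exact (hA.2 v hvA ⟨_, hmv⟩).union_inter (hc 1 m hm0 le_rfl)
        ⟨_, hmv, m, ⟨hm0, le_rfl⟩, rfl⟩
    have h0v : q 0 ∈ A \ {v} := ⟨h0, hv0⟩
    by_cases hvm : q m = v
    · rw [hIcc m le_rfl v hvm]
      have he : {l | l ≤ m ∧ l ≠ m} = Set.Icc 0 (m - 1) := by ext l; simp; omega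
      rw [he]
      exact (hA.2 v hvA ⟨_, h0v⟩).union_inter (hc 0 (m - 1) (Nat.zero_le _) (by omega))
        ⟨_, h0v, 0, ⟨le_rfl, Nat.zero_le _⟩, rfl⟩
    · have : v ∉ q '' Set.Icc 0 m := by
        rintro ⟨i, hi, rfl⟩
        have i0 : i ≠ 0 := by rintro rfl; exact hv0 rfl
        have im : i ≠ m := by rintro rfl; exact hvm rfl
        have := hi.2
        exact hint i (by omega) (by omega) hvA
      rw [Set.sdiff_singleton_eq_self this]
      exact (hA.2 v hvA ⟨_, h0v⟩).union_inter (hc 0 m (Nat.zero_le _) le_rfl)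
        ⟨_, h0v, 0, ⟨le_rfl, Nat.zero_le _⟩, rfl⟩
  · obtain ⟨i, hi, rfl⟩ := hv.resolve_left hvA
    have i0 : i ≠ 0 := by rintro rfl; exact hvA h0
    have im : i ≠ m := by rintro rfl; exact hvA hm
    have := hi.2
    rw [hIcc i hi.2 _ rfl, Set.sdiff_singleton_eq_self hvA]
    have he : {l | l ≤ m ∧ l ≠ i} = Set.Icc 0 (i - 1) ∪ Set.Icc (i + 1) m := by
      ext l; simp; omega
    rw [he, Set.image_union, ← Set.union_assoc]
    exact (hA.1.union_inter (hc 0 (i - 1) (Nat.zero_le _) (by omega))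
      ⟨_, h0, 0, ⟨le_rfl, Nat.zero_le _⟩, rfl⟩).union_inter (hc (i + 1) m (by omega) le_rfl)
      ⟨_, Or.inl hm, m, ⟨by omega, le_rfl⟩, rfl⟩

/-- A connected set outside a block is attached to at most one vertex of the block. -/
theorem IsBlock.eq_of_touch {B : Set V} (hB : IsBlock G B) {K : Set V} (hK : ConnSet G K)
    (hKB : ∀ x ∈ K, x ∉ B) {b b' : V} (hb : b ∈ B) (hb' : b' ∈ B) (h : ∃ d ∈ K, G.Adj b d)
    (h' : ∃ d ∈ K, G.Adj b' d) : b = b' := by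
  by_contra hne
  obtain ⟨m, q, hq, rfl, rfl⟩ := hK.exists_inducedPath (fun h => hKB _ h hb)
    (fun h => hKB _ h hb') hne h h'
  rw [isBlock_iff] at hB
  have := hB.2 _ Set.subset_union_left (hB.1.union_path hb hb' hne
    (fun i h0 hm => hKB _ (hq.interior i h0 hm)) hq.inj hq.step)
  have h2 := hq.two_le
  refine hKB _ (hq.interior 1 one_pos (by omega)) ?_
  rw [← this]
  exact Or.inr ⟨1, ⟨Nat.zero_le _, by omega⟩, rfl⟩

end Blocks

/-- `F B` is a graph on each block `B` of `G`. -/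
def IsBlockFamily {V : Type} (G : SimpleGraph V) (F : Set V → SimpleGraph V) : Prop :=
  ∀ B x y, IsBlock G B → (F B).Adj x y → x ∈ B ∧ y ∈ B

/-- The union of a family of graphs on the blocks of `G`. -/
def blockUnion {V : Type} (G : SimpleGraph V) (F : Set V → SimpleGraph V) : SimpleGraph V where
  Adj x y := ∃ B, IsBlock G B ∧ (F B).Adj x y
  symm := ⟨fun _ _ ⟨B, hB, h⟩ => ⟨B, hB, h.symm⟩⟩
  loopless := ⟨fun _ ⟨_, _, h⟩ => h.ne rfl⟩

section BlockUnion

variable {V : Type} {G : SimpleGraph V} {F : Set V → SimpleGraph V}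

theorem IsBlockFamily.adj_of_mem (hF : IsBlockFamily G F) {B : Set V} (hB : IsBlock G B) {x y : V}
    (hx : x ∈ B) (hy : y ∈ B) (h : (blockUnion G F).Adj x y) : (F B).Adj x y := by
  obtain ⟨B', hB', h'⟩ := h
  have := hF B' x y hB' h'
  obtain rfl := hB.eq_of_two_mem hB' h'.ne hx this.1 hy this.2
  exact h'

/-- The connected sets of `G` obtained from an edge of the block union. -/
theorem IsBlockFamily.exists_connSet (hF : IsBlockFamily G F) {B : Set V} (hB : IsBlock G B)
    {x y : V} (h : (blockUnion G F).Adj x y) (hx : x ∉ B) :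
    ∃ K, ConnSet G K ∧ x ∈ K ∧ (∀ z ∈ K, z ∉ B) ∧
      ((y ∉ B ∧ y ∈ K) ∨ (y ∈ B ∧ ∃ d ∈ K, G.Adj y d)) := by
  obtain ⟨B', hB', h'⟩ := h
  have hmem := hF B' x y hB' h'
  have hbi := (isBlock_iff.1 hB').1
  by_cases hne : ∃ b, b ∈ B' ∧ b ∈ B
  · obtain ⟨b, hb', hb⟩ := hne
    have huniq : ∀ z ∈ B', z ∈ B → z = b := by
      intro z hz hzB
      by_contra hzb
      obtain rfl := hB.eq_of_two_mem hB' hzb hzB hz hb hb'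
      exact hx hmem.1
    have hxb : x ≠ b := by rintro rfl; exact hx hb
    have hK := hbi.2 b hb' ⟨x, hmem.1, hxb⟩
    refine ⟨B' \ {b}, hK, ⟨hmem.1, hxb⟩, fun z hz hzB => hz.2 (huniq z hz.1 hzB), ?_⟩
    by_cases hyB : y ∈ B
    · obtain rfl := huniq y hmem.2 hyB
      obtain ⟨u, hu, huy, hadj⟩ := hbi.1.exists_adj_of_ne hmem.2 hmem.1 hxb
      exact Or.inr ⟨hyB, u, ⟨hu, huy⟩, hadj.symm⟩
    · exact Or.inl ⟨hyB, hmem.2, fun h => hyB (h ▸ hb)⟩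
  · push Not at hne
    exact ⟨B', hbi.1, hmem.1, hne, Or.inl ⟨hne y hmem.2, hmem.2⟩⟩

theorem IsBlockFamily.eq_of_touch (hF : IsBlockFamily G F) {B : Set V} (hB : IsBlock G B)
    {K : Set V} (hK : ConnSet (blockUnion G F) K) (hKB : ∀ x ∈ K, x ∉ B) {b b' : V} (hb : b ∈ B)
    (hb' : b' ∈ B) (h : ∃ d ∈ K, (blockUnion G F).Adj b d)
    (h' : ∃ d ∈ K, (blockUnion G F).Adj b' d) : b = b' := by
  obtain ⟨d, hd, hbd⟩ := h
  obtain ⟨d', hd', hbd'⟩ := h'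
  obtain ⟨K₀, hK₀, hdK₀, hK₀B, ht⟩ := hF.exists_connSet hB hbd.symm (hKB d hd)
  have ht := (ht.resolve_left fun h => h.1 hb).2
  have hspread := hK.2 {z | ∃ K, ConnSet G K ∧ K₀ ⊆ K ∧ z ∈ K ∧ ∀ x ∈ K, x ∉ B}
    ⟨d, hd, K₀, hK₀, le_rfl, hdK₀, hK₀B⟩ (by
      rintro u hu ⟨K₁, hK₁, h01, huK₁, hK₁B⟩ v hv huv
      obtain ⟨K₂, hK₂, huK₂, hK₂B, ht₂⟩ := hF.exists_connSet hB huv (hKB u hu)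
      have hvK₂ := (ht₂.resolve_right fun h => hKB v hv h.1).2
      refine ⟨K₁ ∪ K₂, hK₁.union_inter hK₂ ⟨u, huK₁, huK₂⟩, h01.trans Set.subset_union_left,
        Or.inr hvK₂, ?_⟩
      rintro x (hx | hx)
      exacts [hK₁B x hx, hK₂B x hx])
  obtain ⟨K₁, hK₁, h01, hdK₁, hK₁B⟩ := hspread hd'
  obtain ⟨K₂, hK₂, huK₂, hK₂B, ht₂⟩ := hF.exists_connSet hB hbd'.symm (hKB d' hd')
  obtain ⟨e, he, hbe⟩ := (ht₂.resolve_left fun h => h.1 hb').2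
  obtain ⟨e', he', hbe'⟩ := ht
  refine hB.eq_of_touch (hK₁.union_inter hK₂ ⟨d', hdK₁, huK₂⟩) ?_ hb hb'
    ⟨e', Or.inl (h01 he'), hbe'⟩ ⟨e, Or.inr he, hbe⟩
  rintro x (hx | hx)
  exacts [hK₁B x hx, hK₂B x hx]

/-- Connected sets of the block union meet every block in a connected set. -/
theorem IsBlockFamily.connSet_inter (hF : IsBlockFamily G F) {B : Set V} (hB : IsBlock G B)
    {K : Set V} (hK : ConnSet (blockUnion G F) K) (hne : (K ∩ B).Nonempty) :
    ConnSet (blockUnion G F) (K ∩ B) := by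
  obtain ⟨x, hx⟩ := hne
  obtain ⟨C, hCs, hxC, hC, hcl⟩ := exists_component (G := blockUnion G F) (s := K ∩ B) hx
  suffices h : K ∩ B ⊆ C by rwa [le_antisymm h hCs]
  have hspread := hK.2 {z | z ∈ C ∨ ∃ R, ConnSet (blockUnion G F) R ∧ R ⊆ K ∧ (∀ r ∈ R, r ∉ B) ∧
      z ∈ R ∧ ∃ c ∈ C, ∃ r ∈ R, (blockUnion G F).Adj c r} ⟨x, hx.1, Or.inl hxC⟩ (by
    rintro u hu (huC | ⟨R, hR, hRK, hRB, huR, c, hc, r, hr, hcr⟩) v hv huv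
    · by_cases hvB : v ∈ B
      · exact Or.inl (hcl u huC v ⟨hv, hvB⟩ huv)
      · exact Or.inr ⟨{v}, connSet_singleton v, by simpa using hv, by simpa using hvB, rfl, u, huC,
          v, rfl, huv⟩
    · by_cases hvB : v ∈ B
      · left
        rwa [hF.eq_of_touch hB hR hRB hvB (hCs hc).2 ⟨u, huR, huv.symm⟩ ⟨r, hr, hcr⟩]
      · refine Or.inr ⟨insert v R, hR.insert huR huv, ?_, ?_, Set.mem_insert _ _, c, hc, r,
          Set.mem_insert_of_mem _ hr, hcr⟩
        · rintro z (rfl | hz)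
          exacts [hv, hRK hz]
        · rintro z (rfl | hz)
          exacts [hvB, hRB z hz])
  rintro z ⟨hzK, hzB⟩
  rcases hspread hzK with h | ⟨R, -, -, hRB, hzR, -⟩
  exacts [h, (hRB z hzR hzB).elim]

theorem IsBlockFamily.mem_of_common (hF : IsBlockFamily G F) {B : Set V} (hB : IsBlock G B)
    {x y z : V} (hx : x ∈ B) (hy : y ∈ B) (hxy : x ≠ y) (hxz : (blockUnion G F).Adj x z)
    (hyz : (blockUnion G F).Adj y z) : z ∈ B := by
  by_contra hz
  exact hxy (hF.eq_of_touch hB (connSet_singleton z) (by simpa using hz) hx hy ⟨z, rfl, hxz⟩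
    ⟨z, rfl, hyz⟩)

theorem IsBlockFamily.edgeTriangle (hF : IsBlockFamily G F)
    (h : ∀ B, IsBlock G B → EdgeTriangle (F B)) : EdgeTriangle (blockUnion G F) := by
  intro x y hxy D hD hxD hyD hx hy
  obtain ⟨B, hB, h'⟩ := hxy
  obtain ⟨hxB, hyB⟩ := hF B x y hB h'
  have hle : ∀ u v, (F B).Adj u v → (blockUnion G F).Adj u v := fun u v h => ⟨B, hB, h⟩
  have hne : (D ∩ B).Nonempty := by
    by_contra hcon
    exact h'.ne (hF.eq_of_touch hB hD (fun z hz hzB => hcon ⟨z, hz, hzB⟩) hxB hyB hx hy)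
  have link : ∀ w ∈ B, w ∉ D → (∃ d ∈ D, (blockUnion G F).Adj w d) →
      ∃ d ∈ D ∩ B, (F B).Adj w d := by
    rintro w hwB hwD ⟨d, hd, hwd⟩
    obtain ⟨z, hz⟩ := hne
    have hc := hF.connSet_inter hB (hD.insert hd hwd.symm) ⟨w, Set.mem_insert _ _, hwB⟩
    obtain ⟨u, hu, huw, hadj⟩ := hc.exists_adj_of_ne (v := w) (p := z)
      ⟨Set.mem_insert _ _, hwB⟩ ⟨Set.mem_insert_of_mem _ hz.1, hz.2⟩
      (by rintro rfl; exact hwD hz.1)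
    exact ⟨u, ⟨hu.1.resolve_left huw, hu.2⟩, hF.adj_of_mem hB hwB hu.2 hadj.symm⟩
  obtain ⟨z, hz, h1, h2⟩ := h B hB x y h' (D ∩ B)
    (connSet_congr (fun u hu v hv huv => hF.adj_of_mem hB hu.2 hv.2 huv)
      (hF.connSet_inter hB hD hne)) (fun h => hxD h.1) (fun h => hyD h.1)
    (link x hxB hxD hx) (link y hyB hyD hy)
  exact ⟨z, hz.1, hle _ _ h1, hle _ _ h2⟩

theorem IsBlockFamily.noFourClique (hF : IsBlockFamily G F)
    (h : ∀ B, IsBlock G B → NoFourClique (F B)) : NoFourClique (blockUnion G F) := by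
  intro a b c d hab hac had hbc hbd hcd
  obtain ⟨B, hB, h'⟩ := id hab
  obtain ⟨ha, hb⟩ := hF B a b hB h'
  have hc := hF.mem_of_common hB ha hb h'.ne hac hbc
  have hd := hF.mem_of_common hB ha hb h'.ne had hbd
  have key := fun {u v : V} (hu : u ∈ B) (hv : v ∈ B) => hF.adj_of_mem hB hu hv
  exact h B hB a b c d h' (key ha hc hac) (key ha hd had) (key hb hc hbc) (key hb hd hbd)
    (key hc hd hcd)

theorem IsBlockFamily.noRich (hF : IsBlockFamily G F)
    (h : ∀ B, IsBlock G B → NoRich (F B)) : NoRich (blockUnion G F) := by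
  intro a b c x y z hab hbc hac hxc hax hbx hya hby hcy hzb haz hcz
  obtain ⟨B, hB, h'⟩ := id hab
  obtain ⟨ha, hb⟩ := hF B a b hB h'
  have hc := hF.mem_of_common hB ha hb h'.ne hac hbc
  have hx := hF.mem_of_common hB ha hb h'.ne hax hbx
  have hy := hF.mem_of_common hB hb hc hbc.ne hby hcy
  have hz := hF.mem_of_common hB ha hc hac.ne haz hcz
  have key := fun {u v : V} (hu : u ∈ B) (hv : v ∈ B) => hF.adj_of_mem hB hu hv
  exact h B hB a b c x y z h' (key hb hc hbc) (key ha hc hac) hxc (key ha hx hax) (key hb hx hbx)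
    hya (key hb hy hby) (key hc hy hcy) hzb (key ha hz haz) (key hc hz hcz)

end BlockUnion

section MapGraph

variable {V W : Type} {H : SimpleGraph W}

theorem ConnSet.preimage_map (φ : W ↪ V) {D : Set V} (hD : ConnSet (H.map φ) D)
    (hne : ∃ w, φ w ∈ D) : ConnSet H (φ ⁻¹' D) := by
  refine ⟨hne, ?_⟩
  rintro t ⟨w, hw, hwt⟩ hcl z hz
  obtain ⟨z', hz', h⟩ := hD.2 (φ '' t) ⟨φ w, hw, w, hwt, rfl⟩ (by
    rintro _ hu ⟨u, hut, rfl⟩ v hv huv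
    obtain ⟨u', v', h, hu', rfl⟩ := (SimpleGraph.map_adj _ _ _ _).1 huv
    obtain rfl := φ.injective hu'
    exact ⟨v', hcl u' hu hut v' hv h, rfl⟩) hz
  exact φ.injective h ▸ hz'

theorem EdgeTriangle.map (φ : W ↪ V) (h : EdgeTriangle H) : EdgeTriangle (H.map φ) := by
  rintro x y hxy D hD hxD hyD ⟨d, hd, hxd⟩ ⟨e, he, hye⟩
  obtain ⟨x', y', hxy', rfl, rfl⟩ := (SimpleGraph.map_adj _ _ _ _).1 hxy
  obtain ⟨x₁, d', hxd', hx₁, rfl⟩ := (SimpleGraph.map_adj _ _ _ _).1 hxd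
  obtain ⟨y₁, e', hye', hy₁, rfl⟩ := (SimpleGraph.map_adj _ _ _ _).1 hye
  obtain rfl := φ.injective hx₁
  obtain rfl := φ.injective hy₁
  obtain ⟨z, hz, h1, h2⟩ := h _ _ hxy' _ (hD.preimage_map φ ⟨d', hd⟩) hxD hyD ⟨d', hd, hxd'⟩
    ⟨e', he, hye'⟩
  exact ⟨φ z, hz, (SimpleGraph.map_adj_apply ..).2 h1, (SimpleGraph.map_adj_apply ..).2 h2⟩

theorem NoFourClique.map (φ : W ↪ V) (h : NoFourClique H) : NoFourClique (H.map φ) := by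
  intro a b c d hab hac had hbc hbd hcd
  obtain ⟨a, b, -, rfl, rfl⟩ := (SimpleGraph.map_adj _ _ _ _).1 hab
  obtain ⟨c, d, -, rfl, rfl⟩ := (SimpleGraph.map_adj _ _ _ _).1 hcd
  simp only [SimpleGraph.map_adj_apply] at *
  exact h a b c d hab hac had hbc hbd hcd

theorem NoRich.map (φ : W ↪ V) (h : NoRich H) : NoRich (H.map φ) := by
  intro a b c x y z hab hbc hac hxc hax hbx hya hby hcy hzb haz hcz
  obtain ⟨_, x, -, -, rfl⟩ := (SimpleGraph.map_adj _ _ _ _).1 hax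
  obtain ⟨b, y, -, rfl, rfl⟩ := (SimpleGraph.map_adj _ _ _ _).1 hby
  obtain ⟨a, z, -, rfl, rfl⟩ := (SimpleGraph.map_adj _ _ _ _).1 haz
  obtain ⟨c, _, -, rfl, -⟩ := (SimpleGraph.map_adj _ _ _ _).1 hcz
  simp only [SimpleGraph.map_adj_apply] at *
  exact h a b c x y z hab hbc hac (by rintro rfl; exact hxc rfl) hax hbx
    (by rintro rfl; exact hya rfl) hby hcy (by rintro rfl; exact hzb rfl) haz hcz

end MapGraph

theorem le_cellCompletion {V : Type} (G : SimpleGraph V) : G ≤ cellCompletion G :=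
  fun _ _ h => ⟨h.ne, Or.inl (Or.inl h)⟩

section BlockTriangulation

variable {V : Type} {G : SimpleGraph V}

theorem exists_blockTriangulation [Finite V] {S : Set V}
    (h : (TwoConnected (G.induce S) ∧
        IsTreeOfTwoBoundariedCycles (cellCompletion (G.induce S))) ∨
      (∃ a b : V, a ≠ b ∧ S = {a, b} ∧ G.Adj a b) ∨ (∃ a : V, S = {a})) :
    ∃ H : SimpleGraph V, (∀ x y, H.Adj x y → x ∈ S ∧ y ∈ S) ∧
      (∀ x ∈ S, ∀ y ∈ S, G.Adj x y → H.Adj x y) ∧ EdgeTriangle H ∧ NoFourClique H ∧ NoRich H := by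
  suffices small : ∀ a b, S = {a, b} → ∃ H : SimpleGraph V, (∀ x y, H.Adj x y → x ∈ S ∧ y ∈ S) ∧
      (∀ x ∈ S, ∀ y ∈ S, G.Adj x y → H.Adj x y) ∧ EdgeTriangle H ∧ NoFourClique H ∧ NoRich H by
    rcases h with ⟨-, hT⟩ | ⟨a, b, -, hS, -⟩ | ⟨a, hS⟩
    · obtain ⟨H, hle, h1, h2, h3⟩ := hT.exists_triangulation
      let φ : S ↪ V := Function.Embedding.subtype _
      refine ⟨H.map φ, ?_, ?_, h1.map φ, h2.map φ, h3.map φ⟩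
      · intro x y hxy
        obtain ⟨x, y, -, rfl, rfl⟩ := (SimpleGraph.map_adj _ _ _ _).1 hxy
        exact ⟨x.2, y.2⟩
      · intro x hx y hy hxy
        exact (SimpleGraph.map_adj _ _ _ _).2 ⟨⟨x, hx⟩, ⟨y, hy⟩,
          hle (le_cellCompletion _ (SimpleGraph.comap_adj.2 hxy)), rfl, rfl⟩
    · exact small a b hS
    · exact small a a (by simpa using hS)
  rintro a b rfl
  have hsupp : ∀ x y, (SimpleGraph.fromRel fun x y => x = a ∧ y = b).Adj x y →
      x ∈ ({a, b} : Set V) ∧ y ∈ ({a, b} : Set V) := by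
    rintro x y ⟨-, ⟨rfl, rfl⟩ | ⟨rfl, rfl⟩⟩ <;> simp
  have hG := goodMarked_of_adj_eq (M := ∅) hsupp
  refine ⟨_, hsupp, ?_, hG.edgeTriangle, hG.noFourClique, hG.noRich⟩
  rintro x (rfl | rfl) y (rfl | rfl) hxy
  · exact absurd hxy G.irrefl
  · exact ⟨hxy.ne, Or.inl ⟨rfl, rfl⟩⟩
  · exact ⟨hxy.ne, Or.inr ⟨rfl, rfl⟩⟩
  · exact absurd hxy G.irrefl

theorem sctw_le_two_of_blocks [Finite V]
    (h : ∀ S : Set V, IsBlock G S → (TwoConnected (G.induce S) ∧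
        IsTreeOfTwoBoundariedCycles (cellCompletion (G.induce S))) ∨
      (∃ a b : V, a ≠ b ∧ S = {a, b} ∧ G.Adj a b) ∨ (∃ a : V, S = {a})) : sctw G ≤ 2 := by
  have h' : ∀ S : Set V, ∃ H : SimpleGraph V, IsBlock G S →
      (∀ x y, H.Adj x y → x ∈ S ∧ y ∈ S) ∧
      (∀ x ∈ S, ∀ y ∈ S, G.Adj x y → H.Adj x y) ∧ EdgeTriangle H ∧ NoFourClique H ∧ NoRich H := by
    intro S
    by_cases hS : IsBlock G S
    · obtain ⟨H, hH⟩ := exists_blockTriangulation (h S hS)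
      exact ⟨H, fun _ => hH⟩
    · exact ⟨⊥, fun h => (hS h).elim⟩
  choose F hF using h'
  have hfam : IsBlockFamily G F := fun B x y hB hxy => (hF B hB).1 x y hxy
  refine sctw_le_two_iff.2 ⟨blockUnion G F, fun x y hxy => ?_,
    hfam.edgeTriangle fun B hB => (hF B hB).2.2.1,
    hfam.noFourClique fun B hB => (hF B hB).2.2.2.1, hfam.noRich fun B hB => (hF B hB).2.2.2.2⟩
  obtain ⟨B, hAB, hB⟩ := (biconn_pair hxy).exists_isBlock
  exact ⟨B, hB, (hF B hB).2.1 x (hAB (by simp)) y (hAB (by simp)) hxy⟩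

end BlockTriangulation

/-- `X` is a connected component of `G - {u, v}`. -/
structure IsPiece {V : Type} (G : SimpleGraph V) (u v : V) (X : Set V) : Prop where
  conn : ConnSet G X
  left : u ∉ X
  right : v ∉ X
  closed : ∀ a ∈ X, ∀ b, G.Adj a b → b ∈ X ∨ b = u ∨ b = v

/-- Deleting `u` and `v` from `G` leaves at least three components. -/
def IsVirtual {V : Type} (G : SimpleGraph V) (u v : V) : Prop :=
  u ≠ v ∧ ∃ X₁ X₂ X₃, IsPiece G u v X₁ ∧ IsPiece G u v X₂ ∧ IsPiece G u v X₃ ∧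
    Disjoint X₁ X₂ ∧ Disjoint X₁ X₃ ∧ Disjoint X₂ X₃

/-- No vertex of `G` is a cut vertex. -/
def VertexDeletable {V : Type} (G : SimpleGraph V) : Prop :=
  ∀ v, ConnSet G {x | x ≠ v}

/-- Among three vertices of `M` outside `{p, q}`, two are joined in `M - {p, q}` by a path of
length at most two. -/
def ThreeLinked {ι : Type} (M : SimpleGraph ι) : Prop :=
  ∀ p q x y z, x ≠ p → x ≠ q → y ≠ p → y ≠ q → z ≠ p → z ≠ q → x ≠ y → x ≠ z → y ≠ z →
    (M.Adj x y ∨ M.Adj x z ∨ M.Adj y z) ∨ ∃ w, w ≠ p ∧ w ≠ q ∧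
      ((M.Adj x w ∧ M.Adj y w) ∨ (M.Adj x w ∧ M.Adj z w) ∨ (M.Adj y w ∧ M.Adj z w))

theorem threeLinked_K4 : ThreeLinked K4 := by
  intro p q x y z _ _ _ _ _ _ hxy _ _
  exact Or.inl (Or.inl hxy)

theorem S3_adj (i j : Fin 6) : S3.Adj i j ↔ i ≠ j ∧ ((i.1 % 2 = 1 ∧ j.1 % 2 = 1) ∨
    (i.1 + 1) % 6 = j.1 ∨ (j.1 + 1) % 6 = i.1) := by
  simp only [S3, SimpleGraph.fromRel_adj]
  revert i j
  decide

theorem threeLinked_S3 : ThreeLinked S3 := by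
  intro p q x y z hxp hxq hyp hyq hzp hzq hxy hxz hyz
  by_cases h : S3.Adj x y ∨ S3.Adj x z ∨ S3.Adj y z
  · exact Or.inl h
  obtain ⟨hx, hy, hz⟩ : x.1 % 2 = 0 ∧ y.1 % 2 = 0 ∧ z.1 % 2 = 0 := by
    simp only [S3_adj] at h
    revert x y z
    grind
  right
  obtain ⟨w, hwp, hwq, hw⟩ : ∃ w : Fin 6, w ≠ p ∧ w ≠ q ∧ w.1 % 2 = 1 := by
    have : ∀ p q : Fin 6, ∃ w : Fin 6, w ≠ p ∧ w ≠ q ∧ w.1 % 2 = 1 := by decide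
    exact this p q
  refine ⟨w, hwp, hwq, ?_⟩
  simp only [S3_adj]
  grind

section Pieces

variable {V ι : Type} {G K : SimpleGraph V} {M : SimpleGraph ι} {u v : V}

theorem IsPiece.symm {X : Set V} (h : IsPiece G u v X) : IsPiece G v u X :=
  ⟨h.conn, h.right, h.left, fun a ha b hab => (h.closed a ha b hab).imp_right Or.symm⟩

theorem IsVirtual.symm (h : IsVirtual G u v) : IsVirtual G v u := by
  obtain ⟨hne, X₁, X₂, X₃, h1, h2, h3, h⟩ := h
  exact ⟨hne.symm, X₁, X₂, X₃, h1.symm, h2.symm, h3.symm, h⟩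

theorem IsPiece.exists_adj_left {X : Set V} (h : IsPiece G u v X) (hG : VertexDeletable G)
    (huv : u ≠ v) : ∃ x ∈ X, G.Adj x u := by
  obtain ⟨x, hx⟩ := h.conn.nonempty
  obtain ⟨a, ha, b, hb, hab⟩ := (hG v).touch_compl (t := X)
    ⟨x, fun hxv => h.right (hxv ▸ hx), hx⟩ ⟨u, huv, h.left⟩
  rcases h.closed a ha.2 b hab with hbX | rfl | rfl
  · exact (hb.2 hbX).elim
  · exact ⟨a, ha.2, hab⟩
  · exact (hb.1 rfl).elim

theorem IsPiece.exists_adj_right {X : Set V} (h : IsPiece G u v X) (hG : VertexDeletable G)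
    (huv : u ≠ v) : ∃ x ∈ X, G.Adj x v :=
  h.symm.exists_adj_left hG huv.symm

theorem IsPiece.subset_or_disjoint {X D : Set V} (h : IsPiece G u v X) (hD : ConnSet G D)
    (hu : u ∉ D) (hv : v ∉ D) : D ⊆ X ∨ Disjoint D X := by
  by_cases hne : ∃ x ∈ D, x ∈ X
  · left
    refine hD.2 X hne fun a _ haX b hb hab => ?_
    rcases h.closed a haX b hab with h | rfl | rfl
    exacts [h, (hu hb).elim, (hv hb).elim]
  · right
    push Not at hne
    exact Set.disjoint_left.2 hne

theorem IsPiece.connSet_diff {X D : Set V} (h : IsPiece G u v X) (hD : ConnSet G D)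
    (hu : u ∈ D) (hv : v ∉ D) : ConnSet G (D \ X) := by
  refine ⟨⟨u, hu, h.left⟩, ?_⟩
  intro t ht hcl
  by_cases hut : u ∈ t
  · have := hD.2 (t ∪ X) ⟨u, hu, Or.inl hut⟩ (by
      intro a ha hat b hb hab
      by_cases hbX : b ∈ X
      · exact Or.inr hbX
      left
      by_cases haX : a ∈ X
      · rcases h.closed a haX b hab with h | rfl | rfl
        exacts [(hbX h).elim, hut, (hv hb).elim]
      · exact hcl a ⟨ha, haX⟩ (hat.resolve_right haX) b ⟨hb, hbX⟩ hab)
    rintro z ⟨hz, hzX⟩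
    exact (this hz).resolve_right hzX
  · exfalso
    obtain ⟨x, hx, hxt⟩ := ht
    have := hD.2 (t \ X) ⟨x, hx.1, hxt, hx.2⟩ (by
      intro a ha hat b hb hab
      have hbX : b ∉ X := by
        intro hbX
        rcases h.closed b hbX a hab.symm with h | rfl | rfl
        exacts [hat.2 h, hut hat.1, hv ha]
      exact ⟨hcl a ⟨ha, hat.2⟩ hat.1 b ⟨hb, hbX⟩ hab, hbX⟩)
    exact hut (this hu).1

/-- In a graph without cut vertices, a virtual edge does not leave a piece. -/
theorem IsPiece.closed_virtual {X : Set V} (h : IsPiece G u v X) (hG : VertexDeletable G)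
    {a b : V} (hab : IsVirtual G a b) (ha : a ∈ X) : b ∈ X ∨ b = u ∨ b = v := by
  obtain ⟨hne, X₁, X₂, X₃, h1, h2, h3, d12, d13, d23⟩ := hab
  have key : ∀ Y, IsPiece G a b Y → u ∉ Y → v ∉ Y → b ∈ X ∨ b = u ∨ b = v := by
    intro Y hY hu hv
    obtain ⟨y, hy, hya⟩ := hY.exists_adj_left hG hne
    obtain ⟨z, hz, hzb⟩ := hY.exists_adj_right hG hne
    have hyX : y ∈ X := by
      rcases h.closed a ha y hya.symm with h | rfl | rfl
      exacts [h, (hu hy).elim, (hv hy).elim]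
    rcases h.subset_or_disjoint hY.conn hu hv with hs | hd
    · exact h.closed z (hs hz) b hzb
    · exact (Set.disjoint_left.1 hd hy hyX).elim
  by_cases c1 : u ∉ X₁ ∧ v ∉ X₁
  · exact key X₁ h1 c1.1 c1.2
  by_cases c2 : u ∉ X₂ ∧ v ∉ X₂
  · exact key X₂ h2 c2.1 c2.2
  rw [Set.disjoint_left] at d12 d13 d23
  exact key X₃ h3 (by grind) (by grind)

/-- A piece that avoids all branch sets other than those of `p` and `q`. -/
theorem exists_piece_avoiding (hM : ThreeLinked M) {f : ι → Set V}
    (hconn : ∀ w, ConnSet K (f w))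
    (ht : ∀ w w', M.Adj w w' → Touch K (f w) (f w'))
    (hK : ∀ x y, K.Adj x y → G.Adj x y ∨ (x = u ∧ y = v) ∨ (x = v ∧ y = u))
    {p q : ι} (hp : ∀ w, w ≠ p → w ≠ q → u ∉ f w ∧ v ∉ f w) (huv : IsVirtual G u v) :
    ∃ X, IsPiece G u v X ∧ ∀ w, w ≠ p → w ≠ q → Disjoint (f w) X := by
  obtain ⟨hne, X₁, X₂, X₃, h1, h2, h3, d12, d13, d23⟩ := huv
  have hconnG : ∀ w, w ≠ p → w ≠ q → ConnSet G (f w) := by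
    intro w hwp hwq
    refine connSet_congr (fun a ha b hb hab => ?_) (hconn w)
    rcases hK a b hab with h | ⟨rfl, -⟩ | ⟨rfl, -⟩
    exacts [h, ((hp w hwp hwq).1 ha).elim, ((hp w hwp hwq).2 ha).elim]
  have spread : ∀ X, IsPiece G u v X → ∀ x w, f x ⊆ X → w ≠ p → w ≠ q → M.Adj x w → f w ⊆ X := by
    intro X hX x w hx hwp hwq hxw
    obtain ⟨a, ha, b, hb, hab⟩ := ht x w hxw
    obtain ⟨hu, hv⟩ := hp w hwp hwq
    rcases hX.subset_or_disjoint (hconnG w hwp hwq) hu hv with h | h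
    · exact h
    · rcases hK a b hab with hab | ⟨rfl, rfl⟩ | ⟨rfl, rfl⟩
      · rcases hX.closed a (hx ha) b hab with hbX | rfl | rfl
        exacts [(Set.disjoint_left.1 h hb hbX).elim, (hu hb).elim, (hv hb).elim]
      · exact (hv hb).elim
      · exact (hu hb).elim
  have clash : ∀ {X Y : Set V}, Disjoint X Y → ∀ w, f w ⊆ X → f w ⊆ Y → False := by
    intro X Y hXY w hX hY
    obtain ⟨z, hz⟩ := (hconn w).nonempty
    exact Set.disjoint_left.1 hXY (hX hz) (hY hz)
  by_contra hcon
  push Not at hcon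
  have pick : ∀ X, IsPiece G u v X → ∃ w, w ≠ p ∧ w ≠ q ∧ f w ⊆ X := by
    intro X hX
    obtain ⟨w, hwp, hwq, hw⟩ := hcon X hX
    obtain ⟨hu, hv⟩ := hp w hwp hwq
    exact ⟨w, hwp, hwq, (hX.subset_or_disjoint (hconnG w hwp hwq) hu hv).resolve_right hw⟩
  obtain ⟨x, hxp, hxq, hx⟩ := pick X₁ h1
  obtain ⟨y, hyp, hyq, hy⟩ := pick X₂ h2
  obtain ⟨z, hzp, hzq, hz⟩ := pick X₃ h3
  have hxy : x ≠ y := by rintro rfl; exact clash d12 x hx hy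
  have hxz : x ≠ z := by rintro rfl; exact clash d13 x hx hz
  have hyz : y ≠ z := by rintro rfl; exact clash d23 y hy hz
  rcases hM p q x y z hxp hxq hyp hyq hzp hzq hxy hxz hyz with
    (h | h | h) | ⟨w, hwp, hwq, ⟨h, h'⟩ | ⟨h, h'⟩ | ⟨h, h'⟩⟩
  · exact clash d12 y (spread _ h1 _ _ hx hyp hyq h) hy
  · exact clash d13 z (spread _ h1 _ _ hx hzp hzq h) hz
  · exact clash d23 z (spread _ h2 _ _ hy hzp hzq h) hz
  · exact clash d12 w (spread _ h1 _ _ hx hwp hwq h) (spread _ h2 _ _ hy hwp hwq h')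
  · exact clash d13 w (spread _ h1 _ _ hx hwp hwq h) (spread _ h3 _ _ hz hwp hwq h')
  · exact clash d23 w (spread _ h2 _ _ hy hwp hwq h) (spread _ h3 _ _ hz hwp hwq h')

/-- Adding a virtual edge creates no minor `M`. -/
theorem IsMinorOf.of_add_virtual (hM : ThreeLinked M) (hG : VertexDeletable G)
    (huv : IsVirtual G u v)
    (hK : ∀ x y, K.Adj x y → G.Adj x y ∨ (x = u ∧ y = v) ∨ (x = v ∧ y = u))
    (h : IsMinorOf M K) : IsMinorOf M G := by
  classical
  have hne := huv.1
  rw [isMinorOf_iff] at h ⊢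
  obtain ⟨f, hconn, hdisj, ht⟩ := h
  have hd := fun {w w' : ι} {x : V} (hx : x ∈ f w) (hx' : x ∈ f w') => by_contra fun hww' =>
    Set.disjoint_left.1 (hdisj w w' hww') hx hx'
  have hconnG : ∀ w, (u ∉ f w ∨ v ∉ f w) → ConnSet G (f w) := by
    intro w hw
    refine connSet_congr (fun a ha b hb hab => ?_) (hconn w)
    rcases hK a b hab with h | ⟨rfl, rfl⟩ | ⟨rfl, rfl⟩
    · exact h
    · exact (hw.elim (fun h => h ha) fun h => h hb).elim
    · exact (hw.elim (fun h => h hb) fun h => h ha).elim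
  by_cases hcov : (∃ p, u ∈ f p) ∧ ∃ q, v ∈ f q
  · obtain ⟨⟨p, hup⟩, q, hvq⟩ := hcov
    obtain ⟨X, hX, hXf⟩ := exists_piece_avoiding hM hconn ht hK (p := p) (q := q)
      (fun w hwp hwq => ⟨fun h => hwp (hd h hup), fun h => hwq (hd h hvq)⟩) huv
    obtain ⟨x, hxX, hxu⟩ := hX.exists_adj_left hG hne
    obtain ⟨y, hyX, hyv⟩ := hX.exists_adj_right hG hne
    have hoff : ∀ w, w ≠ p → w ≠ q → f w \ X = f w := fun w hwp hwq =>
      (hXf w hwp hwq).sdiff_eq_left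
    refine ⟨Function.update (fun w => f w \ X) p (f p ∪ X), fun w => ?_, ?_, ?_⟩
    · by_cases hwp : w = p
      · subst hwp
        rw [Function.update_self]
        by_cases hwq : w = q
        · subst hwq
          refine ⟨⟨u, Or.inl hup⟩, fun t ht' hcl => ?_⟩
          have hXt : (∃ z ∈ X, z ∈ t) → X ⊆ t := fun hz => hX.conn.2 t hz
            fun a ha hat b hb hab => hcl a (Or.inr ha) hat b (Or.inr hb) hab
          have huX : u ∈ t → X ⊆ t := fun hut =>
            hXt ⟨x, hxX, hcl u (Or.inl hup) hut x (Or.inr hxX) hxu.symm⟩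
          have hvX : v ∈ t → X ⊆ t := fun hvt =>
            hXt ⟨y, hyX, hcl v (Or.inl hvq) hvt y (Or.inr hyX) hyv.symm⟩
          have hft : (∃ z ∈ f w, z ∈ t) → f w ⊆ t := fun hz => (hconn w).2 t hz (by
            intro a ha hat b hb hab
            rcases hK a b hab with h | ⟨rfl, rfl⟩ | ⟨rfl, rfl⟩
            · exact hcl a (Or.inl ha) hat b (Or.inl hb) h
            · exact hcl y (Or.inr hyX) (huX hat hyX) _ (Or.inl hb) hyv
            · exact hcl x (Or.inr hxX) (hvX hat hxX) _ (Or.inl hb) hxu)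
          obtain ⟨z, hz | hz, hzt⟩ := ht'
          · have := hft ⟨z, hz, hzt⟩
            exact Set.union_subset this (huX (this hup))
          · have h1 := hXt ⟨z, hz, hzt⟩
            exact Set.union_subset
              (hft ⟨u, hup, hcl x (Or.inr hxX) (h1 hxX) u (Or.inl hup) hxu⟩) h1
        · have hv : v ∉ f w := fun h => hwq (hd h hvq)
          rw [← Set.sdiff_union_self]
          exact (hX.connSet_diff (hconnG w (Or.inr hv)) hup hv).union_touch hX.conn
            ⟨u, ⟨hup, hX.left⟩, x, hxX, hxu.symm⟩
      · rw [Function.update_of_ne hwp]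
        by_cases hwq : w = q
        · subst hwq
          have hu : u ∉ f w := fun h => hwp (hd h hup)
          exact hX.symm.connSet_diff (hconnG w (Or.inl hu)) hvq hu
        · rw [hoff w hwp hwq]
          exact hconnG w (Or.inl fun h => hwp (hd h hup))
    · intro w w' hww'
      rw [Set.disjoint_left]
      intro z hz hz'
      by_cases hwp : w = p
      · subst hwp
        rw [Function.update_self] at hz
        rw [Function.update_of_ne (Ne.symm hww')] at hz'
        exact hz.elim (fun h => hww' (hd h hz'.1)) hz'.2
      · rw [Function.update_of_ne hwp] at hz
        by_cases hwp' : w' = p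
        · subst hwp'
          rw [Function.update_self] at hz'
          exact hz'.elim (fun h => hww' (hd hz.1 h)) hz.2
        · rw [Function.update_of_ne hwp'] at hz'
          exact hww' (hd hz.1 hz'.1)
    · suffices key : ∀ w w', M.Adj w w' → w' ≠ p → Touch G (Function.update (fun w => f w \ X) p
          (f p ∪ X) w) (f w' \ X) by
        intro w w' hww'
        by_cases hwp' : w' = p
        · have hwp : w ≠ p := fun h => hww'.ne (h.trans hwp'.symm)
          have := key w' w hww'.symm hwp
          rw [Function.update_of_ne hwp]
          exact this.symm
        · have := key w w' hww' hwp'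
          rwa [Function.update_of_ne hwp']
      intro w w' hww' hwp'
      obtain ⟨a, ha, b, hb, hab⟩ := ht w w' hww'
      by_cases hwp : w = p
      · subst hwp
        rw [Function.update_self]
        by_cases hvw' : v ∈ f w'
        · exact ⟨y, Or.inr hyX, v, ⟨hvw', hX.right⟩, hyv⟩
        · have hwq' : w' ≠ q := fun h => hvw' (h ▸ hvq)
          rw [hoff w' hwp' hwq']
          rcases hK a b hab with h | ⟨rfl, rfl⟩ | ⟨rfl, rfl⟩
          · exact ⟨a, Or.inl ha, b, hb, h⟩
          · exact (hvw' hb).elim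
          · exact (hwp' (hd hb hup)).elim
      · rw [Function.update_of_ne hwp]
        have habG : G.Adj a b := by
          rcases hK a b hab with h | ⟨rfl, rfl⟩ | ⟨rfl, rfl⟩
          exacts [h, (hwp (hd ha hup)).elim, (hwp' (hd hb hup)).elim]
        have notmem : ∀ {c d i j}, c ∈ f i → d ∈ f j → G.Adj c d → i ≠ p → j ≠ p → i ≠ j →
            c ∉ X := by
          intro c d i j hc hd' hcd hip hjp hij hcX
          by_cases hiq : i = q
          · subst hiq
            have hjX := hXf j hjp (Ne.symm hij)
            rcases hX.closed c hcX d hcd with h | rfl | rfl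
            exacts [Set.disjoint_left.1 hjX hd' h, hjp (hd hd' hup), hij (hd hvq hd')]
          · exact Set.disjoint_left.1 (hXf i hip hiq) hc hcX
        exact ⟨a, ⟨ha, notmem ha hb habG hwp hwp' hww'.ne⟩, b,
          ⟨hb, notmem hb ha habG.symm hwp' hwp hww'.ne.symm⟩, habG⟩
  · refine ⟨f, fun w => hconnG w ?_, hdisj, fun w w' hww' => ?_⟩
    · by_contra hw
      push Not at hw
      exact hcov ⟨⟨w, hw.1⟩, w, hw.2⟩
    · obtain ⟨a, ha, b, hb, hab⟩ := ht w w' hww'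
      rcases hK a b hab with h | ⟨rfl, rfl⟩ | ⟨rfl, rfl⟩
      · exact ⟨a, ha, b, hb, h⟩
      · exact (hcov ⟨⟨w, ha⟩, w', hb⟩).elim
      · exact (hcov ⟨⟨w', hb⟩, w, ha⟩).elim

/-- Adding virtual edges creates no minor `M`. -/
theorem IsMinorOf.of_le_virtual [Finite V] (hM : ThreeLinked M) (hG : VertexDeletable G)
    (hle : G ≤ K) (hK : ∀ x y, K.Adj x y → G.Adj x y ∨ IsVirtual G x y)
    (h : IsMinorOf M K) : IsMinorOf M G := by
  induction K using WellFoundedLT.induction with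
  | _ K ih =>
  by_cases hKG : K ≤ G
  · rwa [le_antisymm hle hKG]
  obtain ⟨x, y, hxy, hn⟩ : ∃ x y, K.Adj x y ∧ ¬ G.Adj x y := by
    by_contra hcon
    push Not at hcon
    exact hKG fun x y => hcon x y
  have hxyv := (hK x y hxy).resolve_left hn
  have hadj : ∀ a b, (K.deleteEdges {s(x, y)}).Adj a b ↔ K.Adj a b ∧ s(a, b) ≠ s(x, y) := by
    intro a b
    simp [SimpleGraph.deleteEdges_adj]
  have hGle : G ≤ K.deleteEdges {s(x, y)} := by
    intro a b hab
    refine (hadj a b).2 ⟨hle hab, fun h => hn ?_⟩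
    rwa [← SimpleGraph.mem_edgeSet, ← h]
  have hlt : K.deleteEdges {s(x, y)} < K := by
    refine lt_of_le_of_ne (SimpleGraph.deleteEdges_le _) fun h => ?_
    rw [← h] at hxy
    exact ((hadj x y).1 hxy).2 rfl
  refine ih _ hlt hGle (fun a b hab => hK a b ((hadj a b).1 hab).1) ?_
  have piece : ∀ X, IsPiece G x y X → IsPiece (K.deleteEdges {s(x, y)}) x y X := by
    intro X hX
    refine ⟨hX.conn.mono hGle, hX.left, hX.right, fun a ha b hab => ?_⟩
    rcases hK a b ((hadj a b).1 hab).1 with h | h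
    · exact hX.closed a ha b h
    · exact hX.closed_virtual hG h ha
  obtain ⟨hne, X₁, X₂, X₃, h1, h2, h3, hd⟩ := hxyv
  refine IsMinorOf.of_add_virtual (u := x) (v := y) hM (fun v => (hG v).mono hGle)
    ⟨hne, X₁, X₂, X₃, piece _ h1, piece _ h2, piece _ h3, hd⟩ (fun a b hab => ?_) h
  by_cases he : s(a, b) = s(x, y)
  · exact Or.inr (Sym2.eq_iff.1 he)
  · exact Or.inl ((hadj a b).2 ⟨hab, he⟩)

end Pieces

section Theta

variable {V : Type} {G T : SimpleGraph V} {u v : V}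

theorem isMinorOf_K4 {A B C D : Set V} (hA : ConnSet G A) (hB : ConnSet G B) (hC : ConnSet G C)
    (hD : ConnSet G D) (dAB : Disjoint A B) (dAC : Disjoint A C) (dAD : Disjoint A D)
    (dBC : Disjoint B C) (dBD : Disjoint B D) (dCD : Disjoint C D)
    (tAB : Touch G A B) (tAC : Touch G A C) (tAD : Touch G A D)
    (tBC : Touch G B C) (tBD : Touch G B D) (tCD : Touch G C D) : IsMinorOf K4 G := by
  refine isMinorOf_iff.2 ⟨![A, B, C, D], ?_, ?_, ?_⟩
  · intro w
    fin_cases w <;> assumption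
  · intro w w' hw
    fin_cases w <;> fin_cases w' <;>
      first
      | exact (hw rfl).elim
      | assumption
      | (apply Disjoint.symm; assumption)
  · intro w w' hw
    replace hw := hw.ne
    fin_cases w <;> fin_cases w' <;>
      first
      | exact (hw rfl).elim
      | assumption
      | (apply Touch.symm; assumption)

theorem VertexDeletable.mono (h : VertexDeletable G) (hle : G ≤ T) : VertexDeletable T :=
  fun v => (h v).mono hle

theorem IsPiece.exists_subset {X : Set V} (hle : G ≤ T) (h : IsPiece T u v X) :
    ∃ Y ⊆ X, IsPiece G u v Y := by
  obtain ⟨x, hx⟩ := h.conn.nonempty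
  obtain ⟨C, hCX, -, hC, hcl⟩ := exists_component (G := G) hx
  refine ⟨C, hCX, hC, fun hu => h.left (hCX hu), fun hv => h.right (hCX hv), ?_⟩
  intro a ha b hab
  rcases h.closed a (hCX ha) b (hle hab) with hb | hb
  · exact Or.inl (hcl a ha b hb hab)
  · exact Or.inr hb

theorem IsVirtual.anti (hle : G ≤ T) (h : IsVirtual T u v) : IsVirtual G u v := by
  obtain ⟨hne, X₁, X₂, X₃, h1, h2, h3, d12, d13, d23⟩ := h
  obtain ⟨Y₁, s1, g1⟩ := h1.exists_subset hle
  obtain ⟨Y₂, s2, g2⟩ := h2.exists_subset hle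
  obtain ⟨Y₃, s3, g3⟩ := h3.exists_subset hle
  exact ⟨hne, Y₁, Y₂, Y₃, g1, g2, g3, d12.mono s1 s2, d13.mono s1 s3, d23.mono s2 s3⟩

theorem isVirtual_of_three_le [Finite V] (huv : u ≠ v)
    (h : 3 ≤ Nat.card ((G.induce {x | x ≠ u ∧ x ≠ v}).ConnectedComponent)) :
    IsVirtual G u v := by
  set s : Set V := {x | x ≠ u ∧ x ≠ v} with hs
  rw [← Set.ncard_univ] at h
  obtain ⟨a, b, c, -, -, -, hab, hac, hbc⟩ := (Set.two_lt_ncard_iff (Set.toFinite _)).1 h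
  induction a using SimpleGraph.ConnectedComponent.ind with | _ a
  induction b using SimpleGraph.ConnectedComponent.ind with | _ b
  induction c using SimpleGraph.ConnectedComponent.ind with | _ c
  have key : ∀ a : s, ∃ X, a.1 ∈ X ∧ IsPiece G u v X := by
    intro a
    obtain ⟨C, hCs, haC, hC, hcl⟩ := exists_component (G := G) a.2
    refine ⟨C, haC, hC, fun h => (hCs h).1 rfl, fun h => (hCs h).2 rfl, ?_⟩
    intro x hx y hxy
    by_cases hy : y ∈ s
    · exact Or.inl (hcl x hx y hy hxy)
    · right
      by_contra hne
      exact hy (by simpa [hs] using hne)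
  have key2 : ∀ (a b : s) (X Y : Set V), a.1 ∈ X → b.1 ∈ Y → IsPiece G u v X → IsPiece G u v Y →
      (G.induce s).connectedComponentMk a ≠ (G.induce s).connectedComponentMk b →
      Disjoint X Y := by
    intro a b X Y ha hb hX hY hne
    rcases hY.subset_or_disjoint hX.conn hX.left hX.right with h | h
    · exfalso
      apply hne
      have hY' := connSet_iff.2 hY.conn
      have hr := hY'.preconnected ⟨a.1, h ha⟩ ⟨b.1, hb⟩
      have hYs : Y ⊆ s := fun y hy => ⟨fun e => hY.left (e ▸ hy), fun e => hY.right (e ▸ hy)⟩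
      exact SimpleGraph.ConnectedComponent.sound
        (hr.map (SimpleGraph.induceHomOfLE G hYs).toHom)
    · exact h
  obtain ⟨X, haX, hX⟩ := key a
  obtain ⟨Y, hbY, hY⟩ := key b
  obtain ⟨Z, hcZ, hZ⟩ := key c
  exact ⟨huv, X, Y, Z, hX, hY, hZ, key2 a b X Y haX hbY hX hY hab, key2 a c X Z haX hcZ hX hZ hac,
    key2 b c Y Z hbY hcZ hY hZ hbc⟩

theorem IsVirtual.three_le [Finite V] (h : IsVirtual G u v) :
    3 ≤ Nat.card ((G.induce {x | x ≠ u ∧ x ≠ v}).ConnectedComponent) := by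
  obtain ⟨-, X, Y, Z, hX, hY, hZ, dXY, dXZ, dYZ⟩ := h
  set s : Set V := {x | x ≠ u ∧ x ≠ v} with hs
  have hsub : ∀ {X}, IsPiece G u v X → X ⊆ s := fun hX y hy =>
    ⟨fun e => hX.left (e ▸ hy), fun e => hX.right (e ▸ hy)⟩
  have key : ∀ {X Y} (a b : s), IsPiece G u v X → a.1 ∈ X → b.1 ∈ Y → Disjoint X Y →
      (G.induce s).connectedComponentMk a ≠ (G.induce s).connectedComponentMk b := by
    intro X Y a b hX ha hb hd he
    have hr := (SimpleGraph.reachable_iff_reflTransGen _ _).1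
      (SimpleGraph.ConnectedComponent.exact he)
    have : ∀ z : s, Relation.ReflTransGen (G.induce s).Adj a z → z.1 ∈ X := by
      intro z hz
      induction hz with
      | refl => exact ha
      | @tail b c _ hbc ih =>
        rcases hX.closed _ ih c.1 hbc with h | h | h
        exacts [h, (c.2.1 h).elim, (c.2.2 h).elim]
    exact Set.disjoint_left.1 hd (this b hr) hb
  obtain ⟨x, hx⟩ := hX.conn.nonempty
  obtain ⟨y, hy⟩ := hY.conn.nonempty
  obtain ⟨z, hz⟩ := hZ.conn.nonempty
  rw [← Set.ncard_univ]
  exact (Set.two_lt_ncard_iff (Set.toFinite _)).2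
    ⟨(G.induce s).connectedComponentMk ⟨x, hsub hX hx⟩,
      (G.induce s).connectedComponentMk ⟨y, hsub hY hy⟩,
      (G.induce s).connectedComponentMk ⟨z, hsub hZ hz⟩, trivial, trivial, trivial,
      key _ _ hX hx hy dXY, key _ _ hX hx hz dXZ, key _ _ hY hy hz dYZ⟩

theorem adj_or_isVirtual_of_cellCompletion [Finite V] (h : (cellCompletion G).Adj u v) :
    G.Adj u v ∨ IsVirtual G u v := by
  obtain ⟨hne, (h | h) | (h | h)⟩ := (SimpleGraph.fromRel_adj _ _ _).1 h
  · exact Or.inl h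
  · exact Or.inr (isVirtual_of_three_le hne h)
  · exact Or.inl h.symm
  · exact Or.inr (isVirtual_of_three_le hne.symm h).symm

theorem IsVirtual.cellCompletion_adj [Finite V] (h : IsVirtual G u v) :
    (cellCompletion G).Adj u v :=
  (SimpleGraph.fromRel_adj _ _ _).2 ⟨h.1, Or.inl (Or.inr h.three_le)⟩

/-- `P` is connected, avoids `u` and `v`, and has neighbours of both. -/
structure IsLink (G : SimpleGraph V) (u v : V) (P : Set V) : Prop where
  conn : ConnSet G P
  left : u ∉ P
  right : v ∉ P
  adj_left : ∃ p ∈ P, G.Adj u p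
  adj_right : ∃ p ∈ P, G.Adj v p

theorem IsLink.symm {P : Set V} (h : IsLink G u v P) : IsLink G v u P :=
  ⟨h.conn, h.right, h.left, h.adj_right, h.adj_left⟩

theorem IsLink.mono {P Q : Set V} (h : IsLink G u v P) (hPQ : P ⊆ Q) (hQ : ConnSet G Q)
    (hu : u ∉ Q) (hv : v ∉ Q) : IsLink G u v Q :=
  ⟨hQ, hu, hv, h.adj_left.imp fun _ => And.imp_left (@hPQ _),
    h.adj_right.imp fun _ => And.imp_left (@hPQ _)⟩

/-- Three disjoint links, two of which touch, form a `K4` minor. -/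
theorem isMinorOf_K4_of_links (huv : u ≠ v) {P Q R : Set V} (hP : IsLink G u v P)
    (hQ : IsLink G u v Q) (hR : IsLink G u v R) (dPQ : Disjoint P Q) (dPR : Disjoint P R)
    (dQR : Disjoint Q R) (h : Touch G P Q) : IsMinorOf K4 G := by
  obtain ⟨p, hp, hup⟩ := hP.adj_left
  obtain ⟨p', hp', hvp⟩ := hP.adj_right
  obtain ⟨q, hq, huq⟩ := hQ.adj_left
  obtain ⟨q', hq', hvq⟩ := hQ.adj_right
  obtain ⟨r, hr, hur⟩ := hR.adj_left
  obtain ⟨r', hr', hvr⟩ := hR.adj_right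
  have d1 := hP.left
  have d2 := hP.right
  have d3 := hQ.left
  have d4 := hQ.right
  have d5 := hR.left
  have d6 := hR.right
  refine isMinorOf_K4 (A := {u}) (B := insert v R) (connSet_singleton u)
    (hR.conn.insert hr' hvr.symm) hP.conn hQ.conn ?_ ?_ ?_ ?_ ?_ dPQ
    ⟨u, rfl, r, Or.inr hr, hur⟩ ⟨u, rfl, p, hp, hup⟩ ⟨u, rfl, q, hq, huq⟩
    ⟨v, Or.inl rfl, p', hp', hvp⟩ ⟨v, Or.inl rfl, q', hq', hvq⟩ h
  all_goals
    rw [Set.disjoint_left] at *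
    grind

theorem exists_piece_of_links (hK : ¬ IsMinorOf K4 T) (huv : u ≠ v) {P Q R : Set V}
    (hP : IsLink T u v P) (hQ : IsLink T u v Q) (hR : IsLink T u v R) (dPQ : Disjoint P Q)
    (dPR : Disjoint P R) (dQR : Disjoint Q R) :
    ∃ C, IsPiece T u v C ∧ P ⊆ C ∧ Disjoint C Q ∧ Disjoint C R := by
  obtain ⟨x, hx⟩ := hP.conn.nonempty
  have hPs : P ⊆ {y | y ≠ u ∧ y ≠ v ∧ y ∉ Q ∧ y ∉ R} := fun y hy =>
    ⟨fun e => hP.left (e ▸ hy), fun e => hP.right (e ▸ hy), Set.disjoint_left.1 dPQ hy,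
      Set.disjoint_left.1 dPR hy⟩
  obtain ⟨C, hCs, hxC, hC, hcl⟩ := exists_component (G := T) (hPs hx)
  have hPC : P ⊆ C := hP.conn.2 C ⟨x, hx, hxC⟩ fun a _ haC b hb hab => hcl a haC b (hPs hb) hab
  have dCQ : Disjoint C Q := Set.disjoint_left.2 fun y hy => (hCs hy).2.2.1
  have dCR : Disjoint C R := Set.disjoint_left.2 fun y hy => (hCs hy).2.2.2
  have huC : u ∉ C := fun h => (hCs h).1 rfl
  have hvC : v ∉ C := fun h => (hCs h).2.1 rfl
  have hCL := hP.mono hPC hC huC hvC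
  refine ⟨C, ⟨hC, huC, hvC, ?_⟩, hPC, dCQ, dCR⟩
  intro a ha b hab
  by_contra hb
  push Not at hb
  by_cases hbQ : b ∈ Q
  · exact hK (isMinorOf_K4_of_links huv hCL hQ hR dCQ dCR dQR ⟨a, ha, b, hbQ, hab⟩)
  by_cases hbR : b ∈ R
  · exact hK (isMinorOf_K4_of_links huv hCL hR hQ dCR dCQ dQR.symm ⟨a, ha, b, hbR, hab⟩)
  exact hb.1 (hcl a ha b ⟨hb.2.1, hb.2.2, hbQ, hbR⟩ hab)

theorem isVirtual_of_links (hK : ¬ IsMinorOf K4 T) (huv : u ≠ v) {P Q R : Set V}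
    (hP : IsLink T u v P) (hQ : IsLink T u v Q) (hR : IsLink T u v R) (dPQ : Disjoint P Q)
    (dPR : Disjoint P R) (dQR : Disjoint Q R) : IsVirtual T u v := by
  obtain ⟨C₁, c1, s1, d12, d13⟩ := exists_piece_of_links hK huv hP hQ hR dPQ dPR dQR
  obtain ⟨C₂, c2, s2, d21, d23⟩ := exists_piece_of_links hK huv hQ hP hR dPQ.symm dQR dPR
  obtain ⟨C₃, c3, s3, d31, d32⟩ := exists_piece_of_links hK huv hR hP hQ dPR.symm dQR.symm dPQ
  have key : ∀ {C D Q : Set V}, IsPiece T u v C → IsPiece T u v D → Q.Nonempty → Q ⊆ D →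
      Disjoint C Q → Disjoint C D := by
    rintro C D Q hC hD ⟨x, hx⟩ hQD hCQ
    rcases hC.subset_or_disjoint hD.conn hD.left hD.right with h | h
    · exact (Set.disjoint_left.1 hCQ (h (hQD hx)) hx).elim
    · exact h.symm
  exact ⟨huv, C₁, C₂, C₃, c1, c2, c3, key c1 c2 hQ.conn.nonempty s2 d12,
    key c1 c3 hR.conn.nonempty s3 d13, key c2 c3 hR.conn.nonempty s3 d23⟩

end Theta

section TwoLinks

variable {V : Type} {G T : SimpleGraph V} {u v : V}

/-- Two disjoint links between `u` and `v` inside `A`. -/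
def HasTwoLinks (G : SimpleGraph V) (A : Set V) (u v : V) : Prop :=
  ∃ P Q, P ⊆ A ∧ Q ⊆ A ∧ IsLink G u v P ∧ IsLink G u v Q ∧ Disjoint P Q

theorem HasTwoLinks.of_mem {A P Q : Set V} {a b : V} (ha : a ∈ A) (hab : G.Adj a b)
    (hbu : b ≠ u) (hua : ¬ a = u)
    (hub : ¬ G.Adj u b) (hPA : P ⊆ A) (hQA : Q ⊆ A) (hP : IsLink G u a P) (hQ : IsLink G u a Q)
    (hd : Disjoint P Q) (hb : b ∈ P) : HasTwoLinks G A u b := by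
  obtain ⟨p, hp, hup⟩ := hP.adj_left
  obtain ⟨q', hq', haq⟩ := hQ.adj_right
  obtain ⟨q, hq, huq⟩ := hQ.adj_left
  have hbQ := Set.disjoint_left.1 hd hb
  obtain ⟨R, hR, hRc, hRu, hRb⟩ := (hP.conn.insert hp hup.symm).exists_link (Or.inl rfl)
    (Or.inr hb) hbu.symm hub
  have hRP : R ⊆ P := fun x hx => (hR hx).1.resolve_left fun h => (hR hx).2 (Or.inl h)
  refine ⟨R, insert a Q, hRP.trans hPA, Set.insert_subset ha hQA,
    ⟨hRc, fun h => (hR h).2 (Or.inl rfl), fun h => (hR h).2 (Or.inr rfl), hRu, hRb⟩,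
    ⟨hQ.conn.insert hq' haq.symm, ?_, ?_, ⟨q, Or.inr hq, huq⟩, ⟨a, Or.inl rfl, hab.symm⟩⟩, ?_⟩
  · rintro (h | h)
    exacts [hua h.symm, hQ.left h]
  · rintro (h | h)
    exacts [hab.ne h.symm, hbQ h]
  · refine Set.disjoint_left.2 fun x hx => ?_
    rintro (rfl | h)
    exacts [hP.right (hRP hx), Set.disjoint_left.1 hd (hRP hx) h]

theorem HasTwoLinks.of_touch {A P Q C : Set V} {a b : V} (ha : a ∈ A) (hab : G.Adj a b)
    (hua : ¬ a = u) (hPA : P ⊆ A) (hQA : Q ⊆ A) (hP : IsLink G u a P)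
    (hQ : IsLink G u a Q) (hd : Disjoint P Q) (hC : ConnSet G C) (hbC : b ∈ C)
    (hCs : C ⊆ {x | x ∈ A ∧ x ≠ a ∧ x ≠ u ∧ x ∉ P ∧ x ∉ Q}) (ht : Touch G C Q) :
    HasTwoLinks G A u b := by
  obtain ⟨p', hp', hap⟩ := hP.adj_right
  obtain ⟨p, hp, hup⟩ := hP.adj_left
  obtain ⟨q, hq, huq⟩ := hQ.adj_left
  have hb := hCs hbC
  obtain ⟨C', hC', hqC', hCc, hbC', -⟩ := (hC.union_touch hQ.conn ht).exists_component_diff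
    (v := b) (p := q) (Or.inl hbC) (Or.inr hq) fun e => hb.2.2.2.2 (e ▸ hq)
  have hsub : C' ⊆ C ∪ Q := fun x hx => (hC' hx).1
  refine ⟨insert a P, C', Set.insert_subset ha hPA, ?_, ⟨hP.conn.insert hp' hap.symm, ?_, ?_,
    ⟨p, Or.inr hp, hup⟩, a, Or.inl rfl, hab.symm⟩, ⟨hCc, ?_, fun h => (hC' h).2 rfl,
    ⟨q, hqC', huq⟩, ?_⟩, ?_⟩
  · intro x hx
    rcases hsub hx with h | h
    exacts [(hCs h).1, hQA h]
  · rintro (h | h)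
    exacts [hua h.symm, hP.left h]
  · rintro (h | h)
    exacts [hab.ne h.symm, hb.2.2.2.1 h]
  · intro h
    rcases hsub h with h | h
    exacts [(hCs h).2.2.1 rfl, hQ.left h]
  · obtain ⟨c, hc, hcb⟩ := hbC'
    exact ⟨c, hc, hcb.symm⟩
  · refine Set.disjoint_left.2 fun x hx hx' => ?_
    rcases hsub hx' with h | h
    · have := hCs h
      rcases hx with rfl | hx
      exacts [this.2.1 rfl, this.2.2.2.1 hx]
    · rcases hx with rfl | hx
      exacts [hQ.right h, Set.disjoint_left.1 hd hx h]

/-- Menger's theorem for two paths. -/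
theorem Biconn.hasTwoLinks {A : Set V} (hA : Biconn G A) (hu : u ∈ A) (hv : v ∈ A)
    (huv : u ≠ v) (hn : ¬ G.Adj u v) : HasTwoLinks G A u v := by
  have key := hA.1.2 {w | w = u ∨ G.Adj u w ∨ HasTwoLinks G A u w} ⟨u, hu, Or.inl rfl⟩ (by
    intro a ha hga b hb hab
    by_cases hbu : b = u
    · exact Or.inl hbu
    by_cases hub : G.Adj u b
    · exact Or.inr (Or.inl hub)
    refine Or.inr (Or.inr ?_)
    by_cases hau : a = u
    · exact (hub (hau ▸ hab)).elim
    have hD : ConnSet G (A \ {a}) := hA.2 a ha ⟨u, hu, fun h => hau h.symm⟩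
    have huD : u ∈ A \ {a} := ⟨hu, fun h => hau h.symm⟩
    have hbD : b ∈ A \ {a} := ⟨hb, hab.ne'⟩
    rcases hga with h | hua | ⟨P, Q, hPA, hQA, hP, hQ, hd⟩
    · exact (hau h).elim
    · obtain ⟨R, hR, hRc, hRu, hRb⟩ := hD.exists_link huD hbD (Ne.symm hbu) hub
      refine ⟨{a}, R, Set.singleton_subset_iff.2 ha, fun x hx => (hR hx).1.1,
        ⟨connSet_singleton a, fun h => hau h.symm, fun h => hab.ne' h, ⟨a, rfl, hua⟩,
          ⟨a, rfl, hab.symm⟩⟩,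
        ⟨hRc, fun h => (hR h).2 (Or.inl rfl), fun h => (hR h).2 (Or.inr rfl), hRu, hRb⟩, ?_⟩
      rw [Set.disjoint_singleton_left]
      exact fun h => (hR h).1.2 rfl
    · by_cases hbP : b ∈ P
      · exact .of_mem ha hab hbu hau hub hPA hQA hP hQ hd hbP
      by_cases hbQ : b ∈ Q
      · exact .of_mem ha hab hbu hau hub hQA hPA hQ hP hd.symm hbQ
      obtain ⟨C, hCs, hbC, hC, hcl⟩ := exists_component (G := G)
        (s := {x | x ∈ A ∧ x ≠ a ∧ x ≠ u ∧ x ∉ P ∧ x ∉ Q}) (x := b)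
        ⟨hb, hab.ne', hbu, hbP, hbQ⟩
      obtain ⟨c, hc, y, hy, hcy⟩ := hD.touch_compl (t := C) ⟨b, hbD, hbC⟩
        ⟨u, huD, fun h => (hCs h).2.2.1 rfl⟩
      by_cases hyP : y ∈ P
      · refine .of_touch ha hab hau hQA hPA hQ hP hd.symm hC hbC (hCs.trans ?_)
          ⟨c, hc.2, y, hyP, hcy⟩
        rintro x ⟨h1, h2, h3, h4, h5⟩
        exact ⟨h1, h2, h3, h5, h4⟩
      by_cases hyQ : y ∈ Q
      · exact .of_touch ha hab hau hPA hQA hP hQ hd hC hbC hCs ⟨c, hc.2, y, hyQ, hcy⟩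
      have hyu : y = u := by
        by_contra hyu
        exact hy.2 (hcl c hc.2 y ⟨hy.1.1, hy.1.2, hyu, hyP, hyQ⟩ hcy)
      subst hyu
      obtain ⟨R, hR, hRc, hRu, hRb⟩ := (hC.insert hc.2 hcy).exists_link (Or.inl rfl)
        (Or.inr hbC) (Ne.symm hbu) hub
      have hRC : R ⊆ C := fun x hx => (hR hx).1.resolve_left fun h => (hR hx).2 (Or.inl h)
      obtain ⟨p', hp', hap⟩ := hP.adj_right
      obtain ⟨p, hp, hup⟩ := hP.adj_left
      refine ⟨insert a P, R, Set.insert_subset ha hPA, fun x hx => (hCs (hRC hx)).1,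
        ⟨hP.conn.insert hp' hap.symm, ?_, ?_, ⟨p, Or.inr hp, hup⟩, a, Or.inl rfl, hab.symm⟩,
        ⟨hRc, fun h => (hR h).2 (Or.inl rfl), fun h => (hR h).2 (Or.inr rfl), hRu, hRb⟩, ?_⟩
      · rintro (h | h)
        exacts [hau h.symm, hP.left h]
      · rintro (h | h)
        exacts [hab.ne' h, hbP h]
      · refine Set.disjoint_left.2 fun x hx hx' => ?_
        have := hCs (hRC hx')
        rcases hx with rfl | hx
        exacts [this.2.1 rfl, this.2.2.2.1 hx])
  rcases key hv with h | h | h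
  exacts [(huv h.symm).elim, (hn h).elim, h]

/-- A graph without `K4` minor whose virtual edges are edges. -/
structure CellComplete (T : SimpleGraph V) : Prop where
  no_K4 : ¬ IsMinorOf K4 T
  adj : ∀ u v, IsVirtual T u v → T.Adj u v
  deletable : VertexDeletable T

/-- `X` is a component of the complement of `A`. -/
structure IsBridge (G : SimpleGraph V) (A X : Set V) : Prop where
  conn : ConnSet G X
  disj : Disjoint X A
  closed : ∀ a ∈ X, ∀ b, G.Adj a b → b ∈ X ∨ b ∈ A

theorem exists_isBridge {A : Set V} {x : V} (hx : x ∉ A) : ∃ X, x ∈ X ∧ IsBridge G A X := by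
  obtain ⟨C, hCs, hxC, hC, hcl⟩ := exists_component (G := G) (s := Aᶜ) (x := x) hx
  refine ⟨C, hxC, hC, Set.disjoint_left.2 fun y hy => hCs hy, fun a ha b hab => ?_⟩
  by_cases hb : b ∈ A
  · exact Or.inr hb
  · exact Or.inl (hcl a ha b hb hab)

/-- Any two attachments of a bridge are adjacent. -/
theorem IsBridge.adj_of_attached (hT : CellComplete T) {A X : Set V} (hA : Biconn T A)
    (hX : IsBridge T A X) (hu : u ∈ A) (hv : v ∈ A) (huv : u ≠ v)
    (hXu : ∃ x ∈ X, T.Adj u x) (hXv : ∃ x ∈ X, T.Adj v x) : T.Adj u v := by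
  by_contra hn
  obtain ⟨P, Q, hPA, hQA, hP, hQ, hd⟩ := hA.hasTwoLinks hu hv huv hn
  have hXA := Set.disjoint_left.1 hX.disj
  exact hn (hT.adj u v (isVirtual_of_links hT.no_K4 huv hP hQ
    (R := X) ⟨hX.conn, fun h => hXA h hu, fun h => hXA h hv, hXu, hXv⟩ hd
    (hX.disj.symm.mono_left hPA) (hX.disj.symm.mono_left hQA)))

theorem IsBridge.not_three_attached (hT : CellComplete T) {A X : Set V} (hA : Biconn T A)
    (hX : IsBridge T A X) {w : V} (hu : u ∈ A) (hv : v ∈ A) (hw : w ∈ A) (huv : u ≠ v)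
    (huw : u ≠ w) (hvw : v ≠ w)
    (hXu : ∃ x ∈ X, T.Adj u x) (hXv : ∃ x ∈ X, T.Adj v x) (hXw : ∃ x ∈ X, T.Adj w x) : False := by
  have hXA := Set.disjoint_left.1 hX.disj
  refine hT.no_K4 (isMinorOf_K4 (A := {u}) (B := {v}) (C := {w}) (D := X) (connSet_singleton _)
    (connSet_singleton _) (connSet_singleton _) hX.conn (by simpa using huv) (by simpa using huw)
    (by simpa using fun h => hXA h hu) (by simpa using hvw) (by simpa using fun h => hXA h hv)
    (by simpa using fun h => hXA h hw) ⟨u, rfl, v, rfl, hX.adj_of_attached hT hA hu hv huv hXu hXv⟩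
    ⟨u, rfl, w, rfl, hX.adj_of_attached hT hA hu hw huw hXu hXw⟩ ?_
    ⟨v, rfl, w, rfl, hX.adj_of_attached hT hA hv hw hvw hXv hXw⟩ ?_ ?_)
  · obtain ⟨x, hx, h⟩ := hXu
    exact ⟨u, rfl, x, hx, h⟩
  · obtain ⟨x, hx, h⟩ := hXv
    exact ⟨v, rfl, x, hx, h⟩
  · obtain ⟨x, hx, h⟩ := hXw
    exact ⟨w, rfl, x, hx, h⟩

/-- A bridge has exactly two attachments, which are adjacent. -/
theorem IsBridge.exists_attached (hT : CellComplete T) {A X : Set V} (hA : Biconn T A)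
    (hA2 : ∀ a, ∃ b ∈ A, b ≠ a) (hX : IsBridge T A X) :
    ∃ u ∈ A, ∃ v ∈ A, T.Adj u v ∧ (∃ x ∈ X, T.Adj u x) ∧ (∃ x ∈ X, T.Adj v x) ∧
      ∀ a ∈ X, ∀ b, T.Adj a b → b ∈ X ∨ b = u ∨ b = v := by
  have hXA := Set.disjoint_left.1 hX.disj
  have hex : ∀ a, a ∉ X → ∃ u ∈ A, u ≠ a ∧ ∃ x ∈ X, T.Adj u x := by
    intro a haX
    obtain ⟨x, hx⟩ := hX.conn.nonempty
    obtain ⟨b, hb, hba⟩ := hA2 a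
    obtain ⟨y, hy, z, hz, hyz⟩ := (hT.deletable a).touch_compl (t := X)
      ⟨x, fun e => haX (e ▸ hx), hx⟩ ⟨b, hba, fun h => hXA h hb⟩
    rcases hX.closed y hy.2 z hyz with h | h
    · exact (hz.2 h).elim
    · exact ⟨z, h, hz.1, y, hy.2, hyz.symm⟩
  obtain ⟨a, ha⟩ := hA.1.nonempty
  obtain ⟨u, hu, -, hXu⟩ := hex a fun h => hXA h ha
  obtain ⟨v, hv, hvu, hXv⟩ := hex u fun h => hXA h hu
  refine ⟨u, hu, v, hv, hX.adj_of_attached hT hA hu hv hvu.symm hXu hXv, hXu, hXv, ?_⟩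
  intro c hc b hcb
  rcases hX.closed c hc b hcb with h | h
  · exact Or.inl h
  right
  by_contra hne
  push Not at hne
  exact hX.not_three_attached hT hA hu hv h hvu.symm hne.1.symm hne.2.symm hXu hXv
    ⟨c, hc, hcb.symm⟩

end TwoLinks

section EarDecomposition

variable {V W : Type} {G T : SimpleGraph V} {H : SimpleGraph W}

theorem IsTreeOfCycles.of_iso (h : IsTreeOfCycles G) (e : H ≃g G) : IsTreeOfCycles H := by
  cases h with
  | cycle _ n hn e' => exact .cycle _ n hn (e'.map fun e' => e'.comp e)
  | glue G₀ hG₀ n hn a b hab _ e' => exact .glue G₀ hG₀ n hn a b hab _ (e'.map fun e' => e'.comp e)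

theorem ETree.biconn {S : Set V} (h : ETree G S) : Biconn G S := by
  induction h with
  | edge a b hab => exact biconn_pair hab
  | ear S₀ m q _ hq ih =>
    have := ih.union_path hq.start hq.last hq.chord.ne hq.interior hq.inj hq.step
    rwa [← Set.Iic_def, show {x | x ≤ m} = Set.Icc 0 m by ext; simp]

theorem ETree.exists_ne {S : Set V} (h : ETree G S) (x : V) : ∃ b ∈ S, b ≠ x := by
  induction h with
  | edge a b hab =>
    by_cases hax : a = x
    · exact ⟨b, Or.inr rfl, hax ▸ hab.ne'⟩
    · exact ⟨a, Or.inl rfl, hax⟩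
  | ear S₀ m q _ hq ih =>
    obtain ⟨b, hb, hbx⟩ := ih
    exact ⟨b, Or.inl hb, hbx⟩

theorem ETree.exists_ssuperset (hT : CellComplete T) {S : Set V} (h : ETree T S) {x : V}
    (hx : x ∉ S) : ∃ S', ETree T S' ∧ S ⊂ S' := by
  obtain ⟨X, hxX, hX⟩ := exists_isBridge (G := T) hx
  obtain ⟨u, hu, v, hv, huv, hXu, hXv, hcl⟩ := hX.exists_attached hT h.biconn h.exists_ne
  have hXS := Set.disjoint_left.1 hX.disj
  obtain ⟨m, q, hq, rfl, rfl⟩ := hX.conn.exists_inducedPath (fun h => hXS h hu)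
    (fun h => hXS h hv) huv.ne hXu hXv
  have h2 := hq.two_le
  refine ⟨_, .ear S m q h ⟨h2, hq.inj, hu, hv, fun i h0 hm => hXS (hq.interior i h0 hm), huv,
    hq.step, ?_, ?_⟩, Set.subset_union_left, fun hsub => ?_⟩
  · intro i h0 hm y hy hiy
    rcases hcl _ (hq.interior i h0 hm) y hiy with h | rfl | rfl
    · exact (hXS h hy).elim
    · refine Or.inl ⟨rfl, ?_⟩
      have := hq.induced 0 (by omega) i (by omega) h0 hiy.symm
      omega
    · refine Or.inr ⟨rfl, ?_⟩
      have := hq.induced i (by omega) m le_rfl hm hiy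
      omega
  · intro i j h0 hij hj hadj
    have := hq.induced i (by omega) j (by omega) hij hadj
    omega
  · exact hXS (hq.interior 1 (by omega) (by omega))
      (hsub (Or.inr ⟨1, Set.mem_Iic.2 (by omega), rfl⟩))

theorem CellComplete.isTreeOfCycles [Finite V] (hT : CellComplete T) (h3 : 3 ≤ Nat.card V) :
    IsTreeOfCycles T := by
  rw [← Set.ncard_univ] at h3
  obtain ⟨a, b, c, -, -, -, hab, hac, hbc⟩ := (Set.two_lt_ncard_iff (Set.toFinite _)).1 h3
  obtain ⟨d, -, -, hdb⟩ := (hT.deletable a).exists_adj_of_ne hab.symm hac.symm hbc.symm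
  obtain ⟨S, hS⟩ := (Set.toFinite {S | ETree T S}).exists_maximal ⟨_, ETree.edge d b hdb⟩
  have huniv : S = Set.univ := by
    by_contra hne
    obtain ⟨x, hx⟩ := (Set.ne_univ_iff_exists_notMem S).1 hne
    obtain ⟨S', hS', hlt⟩ := ETree.exists_ssuperset hT hS.1 hx
    exact hlt.2 (hS.2 hS' hlt.1)
  subst huniv
  rcases hS.1.isTreeOfCycles with ⟨x, y, -, hxy⟩ | h
  · have h := Set.ncard_insert_le x {y}
    rw [← hxy, Set.ncard_singleton] at h
    omega
  · exact h.of_iso (SimpleGraph.induceUnivIso T).symm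

end EarDecomposition

section TwoBoundaried

variable {V : Type} {G T : SimpleGraph V} {u v : V}

theorem ConnSet.diff_leaf {D : Set V} (hD : ConnSet G D) {d : V} (hne : (D \ {d}).Nonempty)
    (hleaf : ∀ a ∈ D, ∀ b ∈ D, G.Adj d a → G.Adj d b → a = b) : ConnSet G (D \ {d}) := by
  refine ⟨hne, ?_⟩
  rintro t ⟨x, hx, hxt⟩ hc
  by_cases h : ∃ e ∈ D, G.Adj d e ∧ e ∈ t
  · obtain ⟨e, heD, hde, het⟩ := h
    have := hD.2 ({d} ∪ t) ⟨x, hx.1, Or.inr hxt⟩ (by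
      intro a ha hat b hb hab
      by_cases hbd : b = d
      · exact Or.inl hbd
      by_cases had : a = d
      · subst had
        exact Or.inr (hleaf e heD b hb hde hab ▸ het)
      · exact Or.inr (hc a ⟨ha, had⟩ (hat.resolve_left had) b ⟨hb, hbd⟩ hab))
    exact fun y hy => (this hy.1).resolve_left hy.2
  · push Not at h
    have := hD.2 (t \ {d}) ⟨x, hx.1, hxt, hx.2⟩ (by
      intro a ha hat b hb hab
      have hbd : b ≠ d := by
        rintro rfl
        exact h a ha hab.symm hat.1
      exact ⟨hc a ⟨ha, hat.2⟩ hat.1 b ⟨hb, hbd⟩ hab, hbd⟩)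
    exact fun y hy => (this hy.1).1

theorem CycleOn.biconn {n : ℕ} {q : ℕ → V} {S : Set V} (h : CycleOn G n q S) (hn : 3 ≤ n) :
    Biconn G S := by
  have hadj : G.Adj (q 0) (q (n - 1)) :=
    (h.adj 0 (by omega) (n - 1) (by omega)).2 (by unfold CycNbr; omega)
  have := (biconn_pair hadj).union_path (m := n - 1) (q := q) (Or.inl rfl) (Or.inr rfl) hadj.ne ?_
    (fun i hi j hj => h.inj i (by omega) j (by omega))
    (fun i hi => (h.adj i (by omega) (i + 1) (by omega)).2 (Or.inl rfl))
  · convert this using 1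
    ext x
    rw [h.range]
    constructor
    · rintro ⟨i, hi, rfl⟩
      exact Or.inr ⟨i, ⟨by omega, by omega⟩, rfl⟩
    · rintro ((rfl | rfl) | ⟨i, hi, rfl⟩)
      · exact ⟨0, by omega, rfl⟩
      · exact ⟨n - 1, by omega, rfl⟩
      · exact ⟨i, by have := hi.2; omega, rfl⟩
  · rintro i h0 hi (he | he)
    · have := h.inj i (by omega) 0 (by omega) he
      omega
    · have := h.inj i (by omega) (n - 1) (by omega) he
      omega

theorem CycleOn.exists_nbrs {n : ℕ} {q : ℕ → V} {S : Set V} (h : CycleOn G n q S) (hn : 3 ≤ n)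
    (hu : u ∈ S) : ∃ a ∈ S, ∃ b ∈ S, a ≠ b ∧ G.Adj u a ∧ G.Adj u b ∧
      ∀ c ∈ S, G.Adj u c → c = a ∨ c = b := by
  obtain ⟨i, hi, rfl⟩ := (h.range _).1 hu
  obtain ⟨j, k, hj, hk, hjk, hij, hik, hall⟩ : ∃ j k, j < n ∧ k < n ∧ j ≠ k ∧ CycNbr n i j ∧
      CycNbr n i k ∧ ∀ l < n, CycNbr n i l → l = j ∨ l = k := by
    unfold CycNbr
    by_cases h0 : i = 0
    · exact ⟨1, n - 1, by omega, by omega, by omega, by omega, by omega, by omega⟩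
    by_cases h1 : i + 1 = n
    · exact ⟨0, i - 1, by omega, by omega, by omega, by omega, by omega, by omega⟩
    · exact ⟨i - 1, i + 1, by omega, by omega, by omega, by omega, by omega, by omega⟩
  refine ⟨q j, (h.range _).2 ⟨j, hj, rfl⟩, q k, (h.range _).2 ⟨k, hk, rfl⟩,
    fun e => hjk (h.inj j hj k hk e), (h.adj i hi j hj).2 hij, (h.adj i hi k hk).2 hik, ?_⟩
  intro c hc hadj
  obtain ⟨l, hl, rfl⟩ := (h.range _).1 hc
  rcases hall l hl ((h.adj i hi l hl).1 hadj) with rfl | rfl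
  exacts [Or.inl rfl, Or.inr rfl]

theorem IsChordlessCycle.biconn {S : Set V} (h : IsChordlessCycle G S) : Biconn G S := by
  obtain ⟨n, hn, q, hq⟩ := isChordlessCycle_iff.1 h
  exact hq.biconn hn

theorem IsChordlessCycle.exists_nbrs {S : Set V} (h : IsChordlessCycle G S) (hu : u ∈ S) :
    ∃ a ∈ S, ∃ b ∈ S, a ≠ b ∧ G.Adj u a ∧ G.Adj u b ∧ ∀ c ∈ S, G.Adj u c → c = a ∨ c = b := by
  obtain ⟨n, hn, q, hq⟩ := isChordlessCycle_iff.1 h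
  exact hq.exists_nbrs hn hu

theorem IsChordlessCycle.eq_of_subset {S S' : Set V} (hS : IsChordlessCycle G S)
    (hS' : IsChordlessCycle G S') (hsub : S' ⊆ S) : S' = S := by
  refine hsub.antisymm (hS.biconn.1.2 S' ?_ ?_)
  · obtain ⟨x, hx⟩ := hS'.biconn.1.nonempty
    exact ⟨x, hsub hx, hx⟩
  · intro a ha haS' b hb hab
    obtain ⟨c, hc, d, hd, hcd, hac, had, -⟩ := hS'.exists_nbrs haS'
    obtain ⟨x, -, y, -, -, -, -, hall⟩ := hS.exists_nbrs ha
    have h1 := hall b hb hab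
    have h2 := hall c (hsub hc) hac
    have h3 := hall d (hsub hd) had
    grind

theorem IsChordlessCycle.exists_third {S : Set V} (h : IsChordlessCycle G S) (u v : V) :
    ∃ x ∈ S, x ≠ u ∧ x ≠ v := by
  obtain ⟨x, hx⟩ := h.biconn.1.nonempty
  obtain ⟨a, ha, b, hb, hab, hxa, hxb, -⟩ := h.exists_nbrs hx
  have := hxa.ne
  have := hxb.ne
  by_contra! hno
  have h1 := hno x hx
  have h2 := hno a ha
  have h3 := hno b hb
  by_cases x = u <;> by_cases a = u <;> by_cases b = u <;> simp_all

theorem IsChordlessCycle.connSet_diff_edge {S : Set V} (h : IsChordlessCycle G S)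
    (hu : u ∈ S) (hv : v ∈ S) (huv : G.Adj u v) : ConnSet G (S \ {u, v}) := by
  have h1 : ConnSet G (S \ {u}) := h.biconn.2 u hu ⟨v, hv, huv.ne'⟩
  obtain ⟨x, hx, hxu, hxv⟩ := h.exists_third u v
  have h2 := h1.diff_leaf (d := v) ⟨x, ⟨hx, hxu⟩, hxv⟩ ?_
  · rwa [Set.sdiff_sdiff, Set.union_comm, ← Set.insert_eq, Set.pair_comm] at h2
  · intro a ha b hb hva hvb
    obtain ⟨c, hc, d, hd, hcd, -, -, hall⟩ := h.exists_nbrs hv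
    have h3 := hall a ha.1 hva
    have h4 := hall b hb.1 hvb
    have h5 := hall u hu huv.symm
    have h6 : a ≠ u := ha.2
    have h7 : b ≠ u := hb.2
    grind

/-- An edge separator of a chordless cycle carries a bridge of that cycle. -/
theorem IsEdgeSeparator.exists_isBridge (hT : CellComplete T) {S : Set V}
    (hS : IsChordlessCycle T S) (hu : u ∈ S) (hv : v ∈ S) (h : IsEdgeSeparator T u v) :
    ∃ X, IsBridge T S X ∧ (∃ x ∈ X, T.Adj u x) ∧ (∃ x ∈ X, T.Adj v x) ∧
      ∀ a ∈ X, ∀ b, T.Adj a b → b ∈ X ∨ b = u ∨ b = v := by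
  obtain ⟨huv, S', hne, hS', hu', hv'⟩ : T.Adj u v ∧ ∃ S', S' ≠ S ∧ IsChordlessCycle T S' ∧
      u ∈ S' ∧ v ∈ S' := by
    obtain ⟨huv, S₁, S₂, hne, h1, h2, hu1, hv1, hu2, hv2⟩ := h
    by_cases he : S₁ = S
    · exact ⟨huv, S₂, fun e => hne (he.trans e.symm), h2, hu2, hv2⟩
    · exact ⟨huv, S₁, he, h1, hu1, hv1⟩
  obtain ⟨x, hxS', hxS⟩ := Set.not_subset.1 fun hsub => hne (hS.eq_of_subset hS' hsub)
  obtain ⟨X, hxX, hX⟩ := _root_.exists_isBridge (G := T) hxS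
  have hXS := Set.disjoint_left.1 hX.disj
  obtain ⟨c, hc, d, hd, hcd, hXc, hXd, hcl⟩ := hX.exists_attached hT hS.biconn fun a => by
    obtain ⟨b, hb, hba, -⟩ := hS.exists_third a a
    exact ⟨b, hb, hba⟩
  have huX : u ∉ X := fun h => hXS h hu
  have hvX : v ∉ X := fun h => hXS h hv
  have hxc : x ≠ c := fun e => hXS hxX (e ▸ hc)
  have hxd : x ≠ d := fun e => hXS hxX (e ▸ hd)
  have hmem : ∀ c, ConnSet T (S' \ {c}) → x ≠ c → ∃ b ∈ S', b ≠ c ∧ ∃ a ∈ X, T.Adj a b ∧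
      b ∉ X := by
    intro c hconn hxc
    obtain ⟨y, hy, hyc, hyX⟩ : ∃ y ∈ S', y ≠ c ∧ y ∉ X := by
      by_cases huc : u = c
      · exact ⟨v, hv', huc ▸ huv.ne', hvX⟩
      · exact ⟨u, hu', huc, huX⟩
    obtain ⟨a, ha, b, hb, hab⟩ := hconn.touch_compl (t := X) ⟨x, ⟨hxS', hxc⟩, hxX⟩
      ⟨y, ⟨hy, hyc⟩, hyX⟩
    exact ⟨b, hb.1.1, hb.1.2, a, ha.2, hab, hb.2⟩
  have hdel : ∀ c, ConnSet T (S' \ {c}) := by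
    intro c
    by_cases hc : c ∈ S'
    · obtain ⟨y, hy, hyc, -⟩ := hS'.exists_third c c
      exact hS'.biconn.2 c hc ⟨y, hy, hyc⟩
    · rw [Set.sdiff_singleton_eq_self hc]
      exact hS'.biconn.1
  have hd' : d ∈ S' := by
    obtain ⟨b, hb, hbc, a, ha, hab, hbX⟩ := hmem c (hdel c) hxc
    rcases hcl a ha b hab with h | h | h
    exacts [(hbX h).elim, (hbc h).elim, h ▸ hb]
  have hc' : c ∈ S' := by
    obtain ⟨b, hb, hbd, a, ha, hab, hbX⟩ := hmem d (hdel d) hxd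
    rcases hcl a ha b hab with h | h | h
    exacts [(hbX h).elim, h ▸ hb, (hbd h).elim]
  have hsub : S' \ {c, d} ⊆ X := by
    refine (hS'.connSet_diff_edge hc' hd' hcd).2 X ⟨x, ⟨hxS', ?_⟩, hxX⟩ ?_
    · rintro (h | h)
      exacts [hxc h, hxd h]
    · intro a _ haX b hb hab
      exact (hcl a haX b hab).resolve_right hb.2
  have hu2 : u = c ∨ u = d := by
    by_contra hn
    exact huX (hsub ⟨hu', hn⟩)
  have hv2 : v = c ∨ v = d := by
    by_contra hn
    exact hvX (hsub ⟨hv', hn⟩)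
  have := huv.ne
  refine ⟨X, hX, ?_⟩
  rcases hu2 with rfl | rfl <;> rcases hv2 with rfl | rfl
  · exact (this rfl).elim
  · exact ⟨hXc, hXd, hcl⟩
  · exact ⟨hXd, hXc, fun a ha b hab => (hcl a ha b hab).imp_right Or.symm⟩
  · exact (this rfl).elim

theorem IsBridge.subset_of_mem {A X Y : Set V} (hX : IsBridge G A X) (hY : IsBridge G A Y)
    {x : V} (hxX : x ∈ X) (hxY : x ∈ Y) : X ⊆ Y :=
  hX.conn.2 Y ⟨x, hxX, hxY⟩ fun a _ haY b hb hab =>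
    (hY.closed a haY b hab).resolve_right (Set.disjoint_left.1 hX.disj hb)

theorem isMinorOf_S3 {S A B C X Y Z : Set V} (hA : ConnSet G A) (hB : ConnSet G B)
    (hC : ConnSet G C) (hX : ConnSet G X) (hY : ConnSet G Y) (hZ : ConnSet G Z)
    (hAS : A ⊆ S) (hBS : B ⊆ S) (hCS : C ⊆ S) (hXS : Disjoint X S) (hYS : Disjoint Y S)
    (hZS : Disjoint Z S) (dAB : Disjoint A B) (dAC : Disjoint A C) (dBC : Disjoint B C)
    (dXY : Disjoint X Y) (dXZ : Disjoint X Z) (dYZ : Disjoint Y Z)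
    (tAB : Touch G A B) (tAC : Touch G A C) (tBC : Touch G B C)
    (tXA : Touch G X A) (tXC : Touch G X C) (tYA : Touch G Y A) (tYB : Touch G Y B)
    (tZB : Touch G Z B) (tZC : Touch G Z C) : IsMinorOf S3 G := by
  have d1 := hXS.mono_right hAS
  have d2 := hXS.mono_right hBS
  have d3 := hXS.mono_right hCS
  have d4 := hYS.mono_right hAS
  have d5 := hYS.mono_right hBS
  have d6 := hYS.mono_right hCS
  have d7 := hZS.mono_right hAS
  have d8 := hZS.mono_right hBS
  have d9 := hZS.mono_right hCS
  refine isMinorOf_iff.2 ⟨![X, A, Y, B, Z, C], ?_, ?_, ?_⟩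
  · intro w
    fin_cases w <;> assumption
  · intro w w' hw
    fin_cases w <;> fin_cases w' <;>
      first
      | exact (hw rfl).elim
      | assumption
      | (apply Disjoint.symm; assumption)
  · intro w w' hw
    rw [S3_adj] at hw
    fin_cases w <;> fin_cases w' <;>
      first
      | (exfalso; revert hw; decide)
      | assumption
      | (apply Touch.symm; assumption)

end TwoBoundaried

section BlockStructure

variable {V : Type} {G T : SimpleGraph V} {u v : V}

theorem IsEdgeSeparator.symm (h : IsEdgeSeparator G u v) : IsEdgeSeparator G v u := by
  obtain ⟨huv, S₁, S₂, hne, h1, h2, hu1, hv1, hu2, hv2⟩ := h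
  exact ⟨huv.symm, S₁, S₂, hne, h1, h2, hv1, hu1, hv2, hu2⟩

/-- The successor of `i < n` on the cycle `0, 1, …, n - 1`. -/
def cycSucc (n i : ℕ) : ℕ := if i + 1 = n then 0 else i + 1

theorem cycSucc_spec {n i : ℕ} (hi : i < n) :
    cycSucc n i < n ∧ (i + 1 = cycSucc n i ∨ (cycSucc n i = 0 ∧ i + 1 = n)) := by
  unfold cycSucc
  split_ifs <;> omega

theorem disjoint_of_bridges {n : ℕ} {q : ℕ → V} {S : Set V} (hq : CycleOn T n q S) (hn : 3 ≤ n)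
    {X Y : Set V} {i j : ℕ} (hi : i < n) (hj : j < n) (hij : i ≠ j) (hX : IsBridge T S X)
    (hY : IsBridge T S Y) (hYj : ∃ x ∈ Y, T.Adj (q j) x)
    (hYj' : ∃ x ∈ Y, T.Adj (q (cycSucc n j)) x)
    (hcl : ∀ a ∈ X, ∀ b, T.Adj a b → b ∈ X ∨ b = q i ∨ b = q (cycSucc n i)) :
    Disjoint X Y := by
  refine Set.disjoint_left.2 fun x hxX hxY => ?_
  have hYX := hY.subset_of_mem hX hxY hxX
  have hXS := Set.disjoint_left.1 hX.disj
  obtain ⟨hi', hi''⟩ := cycSucc_spec hi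
  obtain ⟨hj', hj''⟩ := cycSucc_spec hj
  have key : ∀ k < n, (∃ x ∈ Y, T.Adj (q k) x) → k = i ∨ k = cycSucc n i := by
    rintro k hk ⟨y, hy, hky⟩
    rcases hcl y (hYX hy) (q k) hky.symm with h | h | h
    · exact (hXS h ((hq.range _).2 ⟨k, hk, rfl⟩)).elim
    · exact Or.inl (hq.inj k hk i hi h)
    · exact Or.inr (hq.inj k hk _ hi' h)
  have h1 := key j hj hYj
  have h2 := key _ hj' hYj'
  omega

theorem isMinorOf_S3_of_separators (hT : CellComplete T) {n : ℕ} {q : ℕ → V} {S : Set V}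
    (hn : 3 ≤ n) (hq : CycleOn T n q S) {i j k : ℕ} (hij : i < j) (hjk : j < k) (hk : k < n)
    (hi' : IsEdgeSeparator T (q i) (q (cycSucc n i)))
    (hj' : IsEdgeSeparator T (q j) (q (cycSucc n j)))
    (hk' : IsEdgeSeparator T (q k) (q (cycSucc n k))) : IsMinorOf S3 T := by
  have hS : IsChordlessCycle T S := isChordlessCycle_iff.2 ⟨n, hn, q, hq⟩
  have hmem : ∀ i < n, q i ∈ S := fun i hi => (hq.range _).2 ⟨i, hi, rfl⟩
  have hi : i < n := by omega
  have hj : j < n := by omega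
  obtain ⟨X, hX, hXi, hXi', hXcl⟩ := hi'.exists_isBridge hT hS (hmem i hi)
    (hmem _ (cycSucc_spec hi).1)
  obtain ⟨Y, hY, hYj, hYj', hYcl⟩ := hj'.exists_isBridge hT hS (hmem j hj)
    (hmem _ (cycSucc_spec hj).1)
  obtain ⟨Z, hZ, hZk, hZk', hZcl⟩ := hk'.exists_isBridge hT hS (hmem k hk)
    (hmem _ (cycSucc_spec hk).1)
  have hsi : cycSucc n i = i + 1 := if_neg (by omega)
  have hsj : cycSucc n j = j + 1 := if_neg (by omega)
  rw [hsi] at hXi'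
  rw [hsj] at hYj'
  have hC : q '' {l | l < n ∧ (l ≤ i ∨ k < l)} =
      q '' Set.Icc (k + 1) (n - 1) ∪ q '' Set.Icc 0 i := by
    rw [← Set.image_union]
    congr 1
    ext l
    simp only [Set.mem_ofPred_eq, Set.mem_union, Set.mem_Icc]
    omega
  have hCc : ConnSet T (q '' {l | l < n ∧ (l ≤ i ∨ k < l)}) := by
    have h0 : ConnSet T (q '' Set.Icc 0 i) := hq.connSet_image_Icc (by omega) hi
    by_cases hkn : k + 1 = n
    · rw [hC, Set.Icc_eq_empty (by omega), Set.image_empty, Set.empty_union]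
      exact h0
    · rw [hC]
      refine (hq.connSet_image_Icc (by omega) (by omega)).union_touch h0
        ⟨q (n - 1), ⟨n - 1, ⟨by omega, le_rfl⟩, rfl⟩, q 0, ⟨0, ⟨le_rfl, by omega⟩, rfl⟩, ?_⟩
      exact (hq.adj _ (by omega) _ (by omega)).2 (by unfold CycNbr; omega)
  have hsub : ∀ t : Set ℕ, (∀ l ∈ t, l < n) → q '' t ⊆ S := by
    rintro t ht _ ⟨l, hl, rfl⟩
    exact hmem l (ht l hl)
  have hdisj : ∀ s t : Set ℕ, (∀ l ∈ s, l < n) → (∀ l ∈ t, l < n) → (∀ l ∈ s, l ∉ t) →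
      Disjoint (q '' s) (q '' t) := by
    intro s t hs ht hst
    refine Set.disjoint_left.2 ?_
    rintro _ ⟨l, hl, rfl⟩ ⟨m, hm, hml⟩
    exact hst l hl (hq.inj m (ht m hm) l (hs l hl) hml ▸ hm)
  have htouch : ∀ (s t : Set ℕ) (l m : ℕ), l ∈ s → m ∈ t → l < n → m < n → CycNbr n l m →
      Touch T (q '' s) (q '' t) := fun s t l m hl hm hln hmn h =>
    ⟨q l, ⟨l, hl, rfl⟩, q m, ⟨m, hm, rfl⟩, (hq.adj l hln m hmn).2 h⟩
  have hbridge : ∀ (X : Set V) (s : Set ℕ) (l : ℕ), l ∈ s → (∃ x ∈ X, T.Adj (q l) x) →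
      Touch T X (q '' s) := by
    rintro X s l hl ⟨x, hx, hlx⟩
    exact ⟨x, hx, q l, ⟨l, hl, rfl⟩, hlx.symm⟩
  have hA : ∀ l ∈ Set.Icc (i + 1) j, l < n := fun l hl => by have := hl.2; omega
  have hB : ∀ l ∈ Set.Icc (j + 1) k, l < n := fun l hl => by have := hl.2; omega
  have hC' : ∀ l ∈ {l | l < n ∧ (l ≤ i ∨ k < l)}, l < n := fun l hl => hl.1
  obtain ⟨hsk1, hsk2⟩ := cycSucc_spec hk
  refine isMinorOf_S3 (S := S) (A := q '' Set.Icc (i + 1) j) (B := q '' Set.Icc (j + 1) k)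
    (hq.connSet_image_Icc (by omega) hj) (hq.connSet_image_Icc (by omega) hk) hCc hX.conn hY.conn
    hZ.conn (hsub _ hA) (hsub _ hB) (hsub _ hC') hX.disj hY.disj hZ.disj
    (hdisj _ _ hA hB ?_) (hdisj _ _ hA hC' ?_) (hdisj _ _ hB hC' ?_)
    (disjoint_of_bridges hq hn hi hj (by omega) hX hY hYj (hsj ▸ hYj') hXcl)
    (disjoint_of_bridges hq hn hi hk (by omega) hX hZ hZk hZk' hXcl)
    (disjoint_of_bridges hq hn hj hk (by omega) hY hZ hZk hZk' hYcl)
    (htouch _ _ j (j + 1) ⟨by omega, le_rfl⟩ ⟨le_rfl, by omega⟩ hj (by omega) (Or.inl rfl))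
    (htouch _ _ (i + 1) i ⟨le_rfl, by omega⟩ ⟨hi, Or.inl le_rfl⟩ (by omega) hi
      (Or.inr (Or.inl rfl)))
    (htouch _ _ k (cycSucc n k) ⟨by omega, le_rfl⟩ ⟨hsk1, by omega⟩ hk hsk1
      (by unfold CycNbr; omega))
    (hbridge _ _ (i + 1) ⟨le_rfl, by omega⟩ hXi') (hbridge _ _ i ⟨hi, Or.inl le_rfl⟩ hXi)
    (hbridge _ _ j ⟨by omega, le_rfl⟩ hYj) (hbridge _ _ (j + 1) ⟨le_rfl, by omega⟩ hYj')
    (hbridge _ _ k ⟨by omega, le_rfl⟩ hZk) (hbridge _ _ (cycSucc n k) ⟨hsk1, by omega⟩ hZk')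
  all_goals
    intro l hl hl'
    simp only [Set.mem_ofPred_eq, Set.mem_Icc] at hl hl'
    omega

theorem CellComplete.isTreeOfTwoBoundariedCycles [Finite V] (hT : CellComplete T)
    (hS3 : ¬ IsMinorOf S3 T) (h3 : 3 ≤ Nat.card V) : IsTreeOfTwoBoundariedCycles T := by
  refine ⟨hT.isTreeOfCycles h3, fun S hS => ?_⟩
  obtain ⟨n, hn, q, hq⟩ := isChordlessCycle_iff.1 hS
  let I : Set ℕ := {i | i < n ∧ IsEdgeSeparator T (q i) (q (cycSucc n i))}
  have hI : I.Finite := (Set.finite_Iio n).subset fun i hi => hi.1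
  have hsub : {e : Sym2 V | ∃ u v, e = s(u, v) ∧ u ∈ S ∧ v ∈ S ∧ IsEdgeSeparator T u v} ⊆
      (fun i => s(q i, q (cycSucc n i))) '' I := by
    rintro e ⟨u, v, rfl, hu, hv, huv⟩
    obtain ⟨i, hi, rfl⟩ := (hq.range _).1 hu
    obtain ⟨j, hj, rfl⟩ := (hq.range _).1 hv
    have hor : cycSucc n i = j ∨ cycSucc n j = i := by
      have h1 := cycSucc_spec hi
      have h2 := cycSucc_spec hj
      have h3 := (hq.adj i hi j hj).1 huv.1
      unfold CycNbr at h3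
      omega
    rcases hor with rfl | rfl
    · exact ⟨i, ⟨hi, huv⟩, rfl⟩
    · exact ⟨j, ⟨hj, huv.symm⟩, Sym2.eq_swap⟩
  refine (Set.ncard_le_ncard hsub (hI.image _)).trans ((Set.ncard_image_le hI).trans ?_)
  by_contra hlt
  obtain ⟨a, b, c, ha, hb, hc, hab, hac, hbc⟩ :=
    (Set.two_lt_ncard_iff hI).1 (not_le.1 hlt)
  have key : ∀ i ∈ I, ∀ j ∈ I, ∀ k ∈ I, i < j → j < k → False := fun i hi j hj k hk hij hjk =>
    hS3 (isMinorOf_S3_of_separators hT hn hq hij hjk hk.1 hi.2 hj.2 hk.2)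
  rcases lt_or_gt_of_ne hab with h1 | h1 <;> rcases lt_or_gt_of_ne hac with h2 | h2 <;>
    rcases lt_or_gt_of_ne hbc with h3 | h3
  · exact key a ha b hb c hc h1 h3
  · exact key a ha c hc b hb h2 h3
  · exact (h1.trans h3).not_gt h2
  · exact key c hc a ha b hb h2 h1
  · exact key b hb a ha c hc h1 h2
  · exact (h1.trans h2).not_gt h3
  · exact key b hb c hc a ha h3 h2
  · exact key c hc b hb a ha h3 h1

theorem connSet_image_val {S : Set V} {D : Set S} :
    ConnSet G (Subtype.val '' D) ↔ ConnSet (G.induce S) D := by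
  constructor
  · rintro ⟨⟨_, x, hx, rfl⟩, h⟩
    refine ⟨⟨x, hx⟩, ?_⟩
    rintro t ⟨y, hy, hyt⟩ hc z hz
    have := h (Subtype.val '' t) ⟨y.1, ⟨y, hy, rfl⟩, ⟨y, hyt, rfl⟩⟩ (by
      rintro _ ⟨a, ha, rfl⟩ ⟨a', hat, hae⟩ _ ⟨b, hb, rfl⟩ hab
      obtain rfl := Subtype.ext hae
      exact ⟨b, hc a' ha hat b hb hab, rfl⟩)
    obtain ⟨z', hz', he⟩ := this ⟨z, hz, rfl⟩
    exact Subtype.ext he ▸ hz'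
  · rintro ⟨⟨x, hx⟩, h⟩
    refine ⟨⟨x.1, x, hx, rfl⟩, ?_⟩
    rintro t ⟨_, ⟨y, hy, rfl⟩, hyt⟩ hc _ ⟨z, hz, rfl⟩
    exact h (Subtype.val ⁻¹' t) ⟨y, hy, hyt⟩ (fun a ha hat b hb hab =>
      hc a.1 ⟨a, ha, rfl⟩ hat b.1 ⟨b, hb, rfl⟩ hab) hz

theorem IsMinorOf.of_induce {ι : Type} {M : SimpleGraph ι} {S : Set V}
    (h : IsMinorOf M (G.induce S)) : IsMinorOf M G := by
  rw [isMinorOf_iff] at h ⊢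
  obtain ⟨f, hf, hd, ht⟩ := h
  refine ⟨fun w => Subtype.val '' f w, fun w => connSet_image_val.2 (hf w), fun w w' hw => ?_,
    fun w w' hw => ?_⟩
  · exact (Set.disjoint_image_iff Subtype.val_injective).2 (hd w w' hw)
  · obtain ⟨a, ha, b, hb, hab⟩ := ht w w' hw
    exact ⟨a.1, ⟨a, ha, rfl⟩, b.1, ⟨b, hb, rfl⟩, hab⟩

theorem VertexDeletable.isTreeOfTwoBoundariedCycles [Finite V] (hG : VertexDeletable G)
    (h3 : 3 ≤ Nat.card V) (hK4 : ¬ IsMinorOf K4 G) (hS3 : ¬ IsMinorOf S3 G) :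
    IsTreeOfTwoBoundariedCycles (cellCompletion G) := by
  have hle : G ≤ cellCompletion G := le_cellCompletion G
  have hvirt : ∀ x y, (cellCompletion G).Adj x y → G.Adj x y ∨ IsVirtual G x y :=
    fun x y => adj_or_isVirtual_of_cellCompletion
  refine CellComplete.isTreeOfTwoBoundariedCycles
    ⟨fun h => hK4 (.of_le_virtual threeLinked_K4 hG hle hvirt h), fun u v h =>
      (h.anti hle).cellCompletion_adj, hG.mono hle⟩
    (fun h => hS3 (.of_le_virtual threeLinked_S3 hG hle hvirt h)) h3

theorem IsBlock.structure_of_not_isMinorOf [Finite V] {S : Set V} (hS : IsBlock G S)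
    (hK4 : ¬ IsMinorOf K4 G) (hS3 : ¬ IsMinorOf S3 G) :
    (TwoConnected (G.induce S) ∧ IsTreeOfTwoBoundariedCycles (cellCompletion (G.induce S))) ∨
      (∃ a b : V, a ≠ b ∧ S = {a, b} ∧ G.Adj a b) ∨ (∃ a : V, S = {a}) := by
  obtain ⟨hconn, hcut⟩ := (isBlock_iff.1 hS).1
  by_cases h3 : 3 ≤ S.ncard
  · left
    rw [← Nat.card_coe_set_eq] at h3
    have hdel : VertexDeletable (G.induce S) := by
      intro v
      rw [← connSet_image_val]
      have himg : Subtype.val '' {x : S | x ≠ v} = S \ {v.1} := by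
        ext x
        constructor
        · rintro ⟨y, hy, rfl⟩
          exact ⟨y.2, fun e => hy (Subtype.ext e)⟩
        · rintro ⟨hx, hxv⟩
          exact ⟨⟨x, hx⟩, fun e => hxv (congrArg Subtype.val e), rfl⟩
      rw [himg]
      refine hcut v.1 v.2 (Set.nonempty_of_not_subset fun hsub => ?_)
      have := Set.ncard_le_ncard hsub
      rw [Set.ncard_singleton, ← Nat.card_coe_set_eq] at this
      omega
    exact ⟨⟨h3, fun v => connSet_iff.2 (hdel v)⟩, hdel.isTreeOfTwoBoundariedCycles h3
      (fun h => hK4 h.of_induce) (fun h => hS3 h.of_induce)⟩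
  · right
    have hpos : 0 < S.ncard := (Set.ncard_pos (Set.toFinite _)).2 hconn.nonempty
    obtain h1 | h2 : S.ncard = 1 ∨ S.ncard = 2 := by omega
    · exact Or.inr (Set.ncard_eq_one.1 h1)
    · left
      obtain ⟨a, b, hab, rfl⟩ := Set.ncard_eq_two.1 h2
      refine ⟨a, b, hab, rfl, ?_⟩
      obtain ⟨x, hx, hxb, hadj⟩ := hconn.exists_adj_of_ne (v := b) (p := a) (Or.inr rfl)
        (Or.inl rfl) hab
      rwa [hx.resolve_right hxb] at hadj

end BlockStructure

/-- For every finite simple graph `G`, TFAE: (1) `G` has strongly chordal treewidth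
at most two; (2) every block of `G` is a 2-connected subgraph whose cell completion
is a tree of two-boundaried cycles, a single edge, or an isolated vertex; (3) `G`
has no minor isomorphic to `K₄` or `S₃`. -/
theorem statement8 {V : Type} [Fintype V] (G : SimpleGraph V) :
    List.TFAE
      [sctw G ≤ 2,
       ∀ S : Set V, IsBlock G S →
         (TwoConnected (G.induce S) ∧
            IsTreeOfTwoBoundariedCycles (cellCompletion (G.induce S))) ∨
           (∃ a b : V, a ≠ b ∧ S = {a, b} ∧ G.Adj a b) ∨ (∃ a : V, S = {a}),
       ¬ IsMinorOf K4 G ∧ ¬ IsMinorOf S3 G] := by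
  tfae_have 1 → 3 := not_isMinorOf_of_sctw_le_two
  tfae_have 3 → 2 := fun h _ hS => hS.structure_of_not_isMinorOf h.1 h.2
  tfae_have 2 → 1 := sctw_le_two_of_blocks
  tfae_finish
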